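/- Let N ≥ 1 and let P, Q ∈ ℚ̄[x_1, …, x_N] be coprime polynomials. Then there exists a constant B depending only on P and Q with the following property. Let a_1, …, a_N ∈ ℤ, let ζ_1, …, ζ_N be roots of unity, and let ξ ∈ ℂ^× be such that P(ζ_1 ξ^{a_1}, …, ζ_N ξ^{a_N}) = Q(ζ_1 ξ^{a_1}, …, ζ_N ξ^{a_N}) = 0. Then there exist b_1, …, b_N ∈ ℤ with 0 < max_j |b_j| ≤ B and ∏_{j=1}^{N} (ζ_j ξ^{a_j})^{b_j} = 1. In particular, if ξ is not a root of unity, then a_1 b_1 + ⋯ + a_N b_N = 0. -/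

import Mathlib

/-- The size (sup-norm) `max_j |b_j|` of an integer vector. -/
def vecSize {n : ℕ} (a : Fin n → ℤ) : ℕ := Finset.univ.sup fun i => (a i).natAbs

namespace BZ

open Polynomial

/-- Evaluation of an integral Laurent polynomial at a character. -/
noncomputable def ev {L K : Type*} [AddCommGroup L] [Field K] (χ : AddChar L K) (f : L →₀ ℤ) : K :=
  f.sum fun m c => (c : K) * χ m

/-- A character all of whose values are roots of unity of a common order. -/
def IsTors {L K : Type*} [AddCommGroup L] [Field K] (χ : AddChar L K) : Prop :=
  ∃ M : ℕ, 0 < M ∧ ∀ m, χ m ^ M = 1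

theorem sum_pow_prime {R ι : Type*} [CommRing R] {p : ℕ} (hp : p.Prime) (s : Finset ι)
    (f : ι → R) : ∃ r, (∑ i ∈ s, f i) ^ p = ∑ i ∈ s, f i ^ p + p * r := by
  classical
  induction s using Finset.induction_on with
  | empty => exact ⟨0, by simp [hp.ne_zero]⟩
  | insert a s ha ih =>
    obtain ⟨r, hr⟩ := ih
    obtain ⟨r', hr'⟩ := exists_add_pow_prime_eq hp (f a) (∑ i ∈ s, f i)
    refine ⟨r + f a * (∑ i ∈ s, f i) * r', ?_⟩
    rw [Finset.sum_insert ha, Finset.sum_insert ha, hr', hr]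
    ring

theorem int_pow_prime {R : Type*} [CommRing R] {p : ℕ} (hp : p.Prime) (c : ℤ) :
    ∃ r : R, (c : R) ^ p = c + p * r := by
  have := Fact.mk hp
  have : (p : ℤ) ∣ c ^ p - c := by
    rw [← ZMod.intCast_zmod_eq_zero_iff_dvd]
    simp
  obtain ⟨r, hr⟩ := this
  refine ⟨r, ?_⟩
  have h : c ^ p = c + p * r := by linarith
  exact_mod_cast congrArg (Int.cast : ℤ → R) h

theorem eq_zero_of_norm_lt_one {K : Type*} [Field K] [NumberField K] (x : K)
    (hx : IsIntegral ℤ x) (h : ∀ φ : K →+* ℂ, ‖φ x‖ < 1) : x = 0 := by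
  by_contra hx0
  have h1 : IsIntegral ℤ (Algebra.norm ℚ x) := Algebra.isIntegral_norm ℚ hx
  obtain ⟨n, hn⟩ := IsIntegrallyClosed.isIntegral_iff.1 h1
  have h2 := Algebra.norm_eq_prod_embeddings ℚ ℂ x
  have h4 : Algebra.norm ℚ x ≠ 0 := (Algebra.norm_ne_zero_iff).2 hx0
  have h3 : ‖∏ σ : K →ₐ[ℚ] ℂ, σ x‖ < 1 := by
    rw [norm_prod]
    obtain ⟨φ⟩ : Nonempty (K →ₐ[ℚ] ℂ) := ⟨IsAlgClosed.lift⟩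
    calc _ < ∏ σ : K →ₐ[ℚ] ℂ, (1 : ℝ) :=
          Finset.prod_lt_prod_of_nonempty
            (fun σ _ => norm_pos_iff.2 ((map_ne_zero σ).2 hx0)) (fun σ _ => h σ)
            ⟨φ, Finset.mem_univ _⟩
      _ = 1 := by simp
  rw [← h2, ← hn] at h3
  rw [← hn] at h4
  have h5 : n ≠ 0 := by rintro rfl; simp at h4
  have h6 : |(n : ℝ)| < 1 := by simpa using h3
  exact h5 (Int.abs_lt_one_iff.1 (by exact_mod_cast h6))

theorem exists_galois_field (T : Finset ℂ) (hT : ∀ t ∈ T, IsAlgebraic ℚ t) :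
    ∃ E : IntermediateField ℚ ℂ, FiniteDimensional ℚ E ∧ IsGalois ℚ E ∧ ∀ t ∈ T, t ∈ E := by
  classical
  set p : ℚ[X] := ∏ t ∈ T, minpoly ℚ t with hp
  have hp0 : p ≠ 0 := Finset.prod_ne_zero_iff.2 fun t ht => minpoly.ne_zero (hT t ht).isIntegral
  have hs : (p.map (algebraMap ℚ ℂ)).Splits := IsAlgClosed.splits _
  have hsf := IntermediateField.adjoin_rootSet_isSplittingField hs
  refine ⟨IntermediateField.adjoin ℚ (p.rootSet ℂ), ?_, ?_, ?_⟩
  · exact @IsSplittingField.finiteDimensional _ _ _ _ _ p hsf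
  · have : Normal ℚ (IntermediateField.adjoin ℚ (p.rootSet ℂ)) := Normal.of_isSplittingField (hFEp := hsf)
    exact { }
  · intro t ht
    refine IntermediateField.subset_adjoin _ _ ?_
    rw [mem_rootSet]
    refine ⟨hp0, ?_⟩
    rw [hp, map_prod]
    exact Finset.prod_eq_zero ht (minpoly.aeval _ _)

/-- Corestriction of a character to an intermediate field. -/
def liftChar {L : Type*} [AddCommGroup L] (E : IntermediateField ℚ ℂ) (χ : AddChar L ℂ)
    (h : ∀ m, χ m ∈ E) : AddChar L E where
  toFun m := ⟨χ m, h m⟩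
  map_zero_eq_one' := by ext; simp
  map_add_eq_mul' a b := by ext; simp [AddChar.map_add_eq_mul]

@[simp] theorem liftChar_apply {L : Type*} [AddCommGroup L] (E : IntermediateField ℚ ℂ)
    (χ : AddChar L ℂ) (h : ∀ m, χ m ∈ E) (m : L) : ((liftChar E χ h m : E) : ℂ) = χ m := rfl

section ev
variable {L K K' : Type*} [AddCommGroup L] [Field K] [Field K']

theorem ev_eq_sum (χ : AddChar L K) (f : L →₀ ℤ) : ev χ f = ∑ m ∈ f.support, (f m : K) * χ m := rfl

/-- Transport of a character along a ring homomorphism. -/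
def mapChar (σ : K →+* K') (χ : AddChar L K) : AddChar L K' :=
  (σ : K →* K').compAddChar χ

@[simp] theorem mapChar_apply (σ : K →+* K') (χ : AddChar L K) (m : L) :
    mapChar σ χ m = σ (χ m) := rfl

theorem ev_map (σ : K →+* K') (χ : AddChar L K) (f : L →₀ ℤ) :
    ev (mapChar σ χ) f = σ (ev χ f) := by
  simp [ev_eq_sum, map_sum]

theorem char_ne_zero (χ : AddChar L K) (m : L) : χ m ≠ 0 := (χ.val_isUnit m).ne_zero

end ev

/-- A generalised Vandermonde argument: an exponential sum vanishing identically has a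
coincidence among its bases. -/
theorem exists_eq_of_expSum {ι K : Type*} [Field K] (s : Finset ι) (hs : s.Nonempty)
    (c x : ι → K) (hc : ∀ i ∈ s, c i ≠ 0) (h : ∀ j : ℕ, ∑ i ∈ s, c i * x i ^ j = 0) :
    ∃ i ∈ s, ∃ j ∈ s, i ≠ j ∧ x i = x j := by
  classical
  by_contra! hne
  have hg : ∀ g : K[X], ∑ i ∈ s, c i * g.eval (x i) = 0 := by
    intro g
    simp_rw [eval_eq_sum, Polynomial.sum_def, Finset.mul_sum]
    rw [Finset.sum_comm]
    refine Finset.sum_eq_zero fun j _ => ?_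
    have := h j
    calc _ = g.coeff j * ∑ i ∈ s, c i * x i ^ j := by
          rw [Finset.mul_sum]; exact Finset.sum_congr rfl fun i _ => by ring
      _ = 0 := by rw [this, mul_zero]
  obtain ⟨i0, hi0⟩ := hs
  have := hg (∏ i ∈ s.erase i0, (X - C (x i)))
  rw [Finset.sum_eq_single_of_mem i0 hi0] at this
  · rw [eval_prod] at this
    refine mul_ne_zero (hc i0 hi0) (Finset.prod_ne_zero_iff.2 fun i hi => ?_) this
    simp only [eval_sub, eval_X, eval_C]
    exact sub_ne_zero.2 (hne _ hi0 _ (Finset.mem_of_mem_erase hi) (Finset.ne_of_mem_erase hi).symm)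
  · intro i hi hii
    rw [eval_prod, Finset.prod_eq_zero (i := i) (Finset.mem_erase.2 ⟨hii, hi⟩) (by simp), mul_zero]

/-- The `ℓ¹` norm of an integral Laurent polynomial. -/
def l1 {L : Type*} (f : L →₀ ℤ) : ℕ := f.sum fun _ c => c.natAbs

theorem norm_ev_le {L : Type*} [AddCommGroup L] (χ : AddChar L ℂ) (h : ∀ m, ‖χ m‖ = 1)
    (f : L →₀ ℤ) : ‖ev χ f‖ ≤ l1 f := by
  rw [ev_eq_sum, l1, Finsupp.sum, Nat.cast_sum]
  refine (norm_sum_le _ _).trans (Finset.sum_le_sum fun m _ => ?_)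
  rw [norm_mul, h, mul_one, Nat.cast_natAbs]
  simp

theorem IsTors.pow {L K : Type*} [AddCommGroup L] [Field K] {χ : AddChar L K} (h : IsTors χ)
    (n : ℕ) : IsTors (χ ^ n) := by
  obtain ⟨M, hM, h⟩ := h
  exact ⟨M, hM, fun m => by rw [AddChar.pow_apply, ← pow_mul, mul_comm, pow_mul, h, one_pow]⟩

theorem tors_prime {L : Type*} [AddCommGroup L] {χ : AddChar L ℂ} (hχ : IsTors χ)
    {f : L →₀ ℤ} (hf : ev χ f = 0) {p : ℕ} (hp : p.Prime) (hpf : l1 f < p) :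
    ev (χ ^ p) f = 0 := by
  classical
  obtain ⟨M, hM, h⟩ := hχ
  set z : ℂ := Complex.exp (2 * Real.pi * Complex.I / M)
  have hz : IsPrimitiveRoot z M := Complex.isPrimitiveRoot_exp M hM.ne'
  have : NeZero M := ⟨hM.ne'⟩
  obtain ⟨E, hE1, hE2, hE3⟩ := exists_galois_field {z} (by
    simpa using (hz.isIntegral hM).tower_top.isAlgebraic)
  have hzE : z ∈ E := hE3 z (by simp)
  have hmem : ∀ m, χ m ∈ E := fun m => by
    obtain ⟨i, -, hi⟩ := hz.eq_pow_of_pow_eq_one (h m)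
    rw [← hi]; exact pow_mem hzE i
  have : NumberField E := { }
  set ψ := liftChar E χ hmem with hψ
  have hψM : ∀ m, ψ m ^ M = 1 := fun m => by ext; simp [hψ, h]
  have hmint : ∀ m, IsIntegral ℤ (ψ m) := fun m =>
    IsIntegral.of_pow hM (by rw [hψM]; exact isIntegral_one)
  let u : L → NumberField.RingOfIntegers E := fun m => ⟨ψ m, hmint m⟩
  have hu : ∀ m, ((u m : NumberField.RingOfIntegers E) : E) = ψ m := fun m => rfl
  have hψf : ev ψ f = 0 := by
    have := ev_map E.val.toRingHom ψ f
    have h2 : mapChar E.val.toRingHom ψ = χ := by ext m; rfl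
    rw [h2, hf] at this
    exact (map_eq_zero _).1 this.symm
  have hUf : ∑ m ∈ f.support, (f m : NumberField.RingOfIntegers E) * u m = 0 := by
    apply NumberField.RingOfIntegers.coe_injective
    rw [ev_eq_sum] at hψf
    simpa [hu] using hψf
  obtain ⟨r, hr⟩ := sum_pow_prime hp f.support
    (fun m => (f m : NumberField.RingOfIntegers E) * u m)
  rw [hUf, zero_pow hp.ne_zero] at hr
  choose g hg using fun c : ℤ => int_pow_prime (R := NumberField.RingOfIntegers E) hp c
  set r' : NumberField.RingOfIntegers E := - r - ∑ m ∈ f.support, g (f m) * u m ^ p with hr'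
  have key : ∑ m ∈ f.support, (f m : NumberField.RingOfIntegers E) * u m ^ p = p * r' := by
    have : ∑ m ∈ f.support, ((f m : NumberField.RingOfIntegers E) * u m) ^ p =
        ∑ m ∈ f.support, (f m : NumberField.RingOfIntegers E) * u m ^ p +
        p * ∑ m ∈ f.support, g (f m) * u m ^ p := by
      rw [Finset.mul_sum, ← Finset.sum_add_distrib]
      refine Finset.sum_congr rfl fun m _ => ?_
      rw [mul_pow, hg]; ring
    rw [this] at hr
    rw [hr']; linear_combination -hr
  have key2 : ev (ψ ^ p) f = p * (r' : E) := by
    have := congrArg (fun x : NumberField.RingOfIntegers E => (x : E)) key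
    simpa [hu, ev_eq_sum] using this
  have hr0 : (r' : E) = 0 := by
    refine eq_zero_of_norm_lt_one _ r'.2 fun φ => ?_
    have h1 : ev (mapChar φ (ψ ^ p)) f = p * φ r' := by rw [ev_map, key2]; simp
    have h2 : ‖ev (mapChar φ (ψ ^ p)) f‖ ≤ l1 f := by
      refine norm_ev_le _ (fun m => ?_) f
      refine Complex.norm_eq_one_of_pow_eq_one (n := M) ?_ hM.ne'
      simp only [mapChar_apply, AddChar.pow_apply]
      rw [← map_pow, ← pow_mul, mul_comm, pow_mul, hψM, one_pow, map_one]
    rw [h1, norm_mul] at h2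
    have hp0 : (0 : ℝ) < p := by exact_mod_cast hp.pos
    have h3 : (l1 f : ℝ) < p := by exact_mod_cast hpf
    simp only [Complex.norm_natCast] at h2
    by_contra! hcon
    nlinarith
  have h5 : ev (mapChar E.val.toRingHom (ψ ^ p)) f = 0 := by
    rw [ev_map, key2, hr0]; simp
  have h6 : mapChar E.val.toRingHom (ψ ^ p) = χ ^ p := by ext m; rfl
  rwa [h6] at h5

theorem tors_coprime {L : Type*} [AddCommGroup L] {f : L →₀ ℤ} (n : ℕ) (hn : n ≠ 0)
    (hn2 : ∀ p : ℕ, p.Prime → p ∣ n → l1 f < p) {χ : AddChar L ℂ} (hχ : IsTors χ)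
    (hf : ev χ f = 0) : ev (χ ^ n) f = 0 := by
  induction n using Nat.recOnMul generalizing χ with
  | zero => exact absurd rfl hn
  | one => simpa
  | prime p hp => exact tors_prime hχ hf hp (hn2 p hp dvd_rfl)
  | mul a b iha ihb =>
    rw [pow_mul]
    exact ihb (right_ne_zero_of_mul hn) (fun p hp hd => hn2 p hp (hd.mul_left a)) (hχ.pow a)
      (iha (left_ne_zero_of_mul hn) (fun p hp hd => hn2 p hp (hd.mul_right b)) hχ hf)

/-- Torsion zeros of a fixed nonzero integral Laurent polynomial satisfy one of finitely many
nontrivial relations. -/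
theorem torsion_lemma {L : Type*} [AddCommGroup L] [Module.Free ℤ L] {f : L →₀ ℤ} (hf : f ≠ 0) :
    ∃ S : Finset L, 0 ∉ S ∧ ∀ χ : AddChar L ℂ, IsTors χ → ev χ f = 0 → ∃ s ∈ S, χ s = 1 := by
  classical
  set M := (l1 f).factorial with hM
  have hMpos : 0 < M := Nat.factorial_pos _
  refine ⟨(f.support ×ˢ f.support).image (fun q => (M : ℤ) • (q.1 - q.2)) \ {0}, by simp, ?_⟩
  intro χ hχ hev
  have hs : f.support.Nonempty := Finsupp.support_nonempty_iff.2 hf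
  have h1 : ∀ j : ℕ, ∑ m ∈ f.support, ((f m : ℂ) * χ m) * (χ m ^ M) ^ j = 0 := by
    intro j
    have := tors_coprime (f := f) (1 + M * j) (by omega) (fun p hp hd => by
      by_contra! hle
      have h1 : p ∣ M := (hp.dvd_factorial).2 hle
      have h2 : p ∣ 1 := (Nat.dvd_add_left (h1.mul_right j)).1 hd
      exact hp.one_lt.ne' (Nat.dvd_one.1 h2)) hχ hev
    rw [ev_eq_sum] at this
    rw [← this]
    refine Finset.sum_congr rfl fun m _ => ?_
    rw [AddChar.pow_apply, pow_add, pow_one, pow_mul, mul_assoc]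
  obtain ⟨m, hm, m', hm', hne, heq⟩ := exists_eq_of_expSum f.support hs _ _ (fun m hm =>
    mul_ne_zero (by simpa using hm) (char_ne_zero χ m)) h1
  refine ⟨(M : ℤ) • (m - m'), ?_, ?_⟩
  · simp only [Finset.mem_sdiff, Finset.mem_image, Finset.mem_product, Finset.mem_singleton]
    refine ⟨⟨(m, m'), ⟨hm, hm'⟩, rfl⟩, ?_⟩
    have : (M : ℤ) ≠ 0 := by exact_mod_cast hMpos.ne'
    exact smul_ne_zero this (sub_ne_zero.2 hne)
  · rw [AddChar.map_zsmul_eq_zpow, AddChar.map_sub_eq_div, div_zpow]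
    rw [div_eq_one_iff_eq (zpow_ne_zero _ (char_ne_zero χ m'))]
    exact_mod_cast heq

end BZ

namespace BZ

open Module

/-- A character killed by all members of a family of integral Laurent polynomials. -/
def Kills {L K : Type*} [AddCommGroup L] [Field K] (fam : Finset (L →₀ ℤ)) (χ : AddChar L K) :
    Prop := ∀ f ∈ fam, ev χ f = 0

/-- The zero set of the family has codimension at least two. -/
def Codim2 {L : Type} [AddCommGroup L] (fam : Finset (L →₀ ℤ)) : Prop :=
  ∀ (F : Type) [Field F] [CharZero F] (c : AddChar L F), Kills fam c →
    ∀ (ι : Type) [Fintype ι] (l : ι → L), AlgebraicIndependent ℚ (fun i => c (l i)) →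
      Fintype.card ι + 2 ≤ finrank ℤ L

/-- Characters of the form torsion times one-parameter. -/
def Rank1 {L : Type*} [AddCommGroup L] (χ : AddChar L ℂ) : Prop :=
  ∃ (ζ : AddChar L ℂ) (a : L →ₗ[ℤ] ℤ) (ξ : ℂ), IsTors ζ ∧ ξ ≠ 0 ∧ ∀ m, χ m = ζ m * ξ ^ (a m)

/-- The part of `f` supported on a level set of `w`. -/
noncomputable def part {L : Type*} [AddCommGroup L] (w : L →ₗ[ℤ] ℤ) (e : ℤ) (f : L →₀ ℤ) :
    L →₀ ℤ := f.filter (fun m => w m = e)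

/-- All `w`-homogeneous parts of all members of the family vanish at `χ`. -/
def PartsVanish {L K : Type*} [AddCommGroup L] [Field K] (w : L →ₗ[ℤ] ℤ) (fam : Finset (L →₀ ℤ))
    (χ : AddChar L K) : Prop := ∀ f ∈ fam, ∀ e, ev χ (part w e f) = 0

/-- All homogeneous parts vanish for some nontrivial grading. -/
def Degen {L K : Type*} [AddCommGroup L] [Field K] (fam : Finset (L →₀ ℤ)) (χ : AddChar L K) :
    Prop := ∃ w : L →ₗ[ℤ] ℤ, w ≠ 0 ∧ PartsVanish w fam χ

/-- The main statement for a given lattice. -/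
def TStat (L : Type) [AddCommGroup L] : Prop :=
  ∀ fam : Finset (L →₀ ℤ), Codim2 fam → ∃ S : Finset L, 0 ∉ S ∧
    ∀ χ : AddChar L ℂ, Rank1 χ → Kills fam χ → ∃ s ∈ S, χ s = 1

section
variable {L : Type} [AddCommGroup L] [Free ℤ L] [Module.Finite ℤ L]

/-- Restriction of a character to a submodule. -/
def resChar {K : Type*} [Field K] (L' : Submodule ℤ L) (χ : AddChar L K) : AddChar L' K :=
  χ.compAddMonoidHom L'.subtype.toAddMonoidHom

@[simp] theorem resChar_apply {K : Type*} [Field K] (L' : Submodule ℤ L) (χ : AddChar L K)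
    (m : L') : resChar L' χ m = χ m := rfl

theorem exists_section (w : L →ₗ[ℤ] ℤ) (hw : w ≠ 0) :
    ∃ (l0 : L) (v : L →ₗ[ℤ] ℤ) (g : ℤ), g ≠ 0 ∧ v l0 = 1 ∧ (∀ m, w m = v m * g) := by
  have h1 : (LinearMap.range w).IsPrincipal := inferInstance
  obtain ⟨g, hg⟩ := h1
  have hg0 : g ≠ 0 := by
    rintro rfl
    rw [Submodule.span_zero_singleton, LinearMap.range_eq_bot] at hg
    exact hw hg
  have h2 : ∀ m, ∃ c, w m = c * g := fun m => by
    have : w m ∈ Submodule.span ℤ {g} := hg ▸ LinearMap.mem_range_self w m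
    obtain ⟨c, hc⟩ := Submodule.mem_span_singleton.1 this
    exact ⟨c, by simpa using hc.symm⟩
  choose c hc using h2
  have h3 : g ∈ LinearMap.range w := hg ▸ Submodule.mem_span_singleton_self g
  obtain ⟨l0, hl0⟩ := h3
  refine ⟨l0, { toFun := c, map_add' := ?_, map_smul' := ?_ }, g, hg0, ?_, hc⟩
  · intro x y
    apply mul_right_cancel₀ hg0
    rw [← hc, map_add, hc x, hc y]; ring
  · intro r x
    apply mul_right_cancel₀ hg0
    rw [← hc, map_smul, hc x]; simp; ring
  · have := hc l0
    rw [hl0] at this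
    apply mul_right_cancel₀ hg0
    change c l0 * g = 1 * g
    rw [← this, one_mul]

theorem finrank_ker (v : L →ₗ[ℤ] ℤ) (l0 : L) (h : v l0 = 1) :
    finrank ℤ L = finrank ℤ (LinearMap.ker v) + 1 := by
  have h1 := LinearMap.rank_range_add_rank_ker v
  have h2 : LinearMap.range v = ⊤ := by
    rw [LinearMap.range_eq_top]
    intro c
    exact ⟨c • l0, by simp [h]⟩
  rw [h2, rank_top, rank_self] at h1
  rw [← finrank_eq_rank, ← finrank_eq_rank] at h1
  have : (1 + finrank ℤ (LinearMap.ker v) : ℕ) = finrank ℤ L := by exact_mod_cast h1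
  omega

/-- The translated homogeneous part, as a polynomial on the kernel. -/
noncomputable def slice (v : L →ₗ[ℤ] ℤ) (l0 : L) (j : ℤ) (f : L →₀ ℤ) :
    LinearMap.ker v →₀ ℤ :=
  f.comapDomain (fun m : LinearMap.ker v => (m : L) + j • l0) (by
    intro a _ b _ h
    exact Subtype.ext (add_right_cancel h))

theorem slice_apply (v : L →ₗ[ℤ] ℤ) (l0 : L) (j : ℤ) (f : L →₀ ℤ) (m : LinearMap.ker v) :
    slice v l0 j f m = f ((m : L) + j • l0) := rfl

theorem part_apply (v : L →ₗ[ℤ] ℤ) (j : ℤ) (f : L →₀ ℤ) (m : L) [Decidable (v m = j)] :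
    part v j f m = if v m = j then f m else 0 := by
  classical
  simp [part, Finsupp.filter_apply]

theorem ev_part_slice {K : Type*} [Field K] (v : L →ₗ[ℤ] ℤ) (l0 : L) (h : v l0 = 1) (j : ℤ)
    (f : L →₀ ℤ) (χ : AddChar L K) :
    ev χ (part v j f) = χ (j • l0) * ev (resChar (LinearMap.ker v) χ) (slice v l0 j f) := by
  classical
  rw [ev_eq_sum, ev_eq_sum, Finset.mul_sum]
  symm
  refine Finset.sum_bij (fun m _ => (m : L) + j • l0) ?_ ?_ ?_ ?_
  · intro m hm
    have h0 : v m = 0 := m.2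
    rw [Finsupp.mem_support_iff, slice_apply] at hm
    rw [Finsupp.mem_support_iff, part_apply, if_pos (by simp [h0, h])]
    exact hm
  · intro a _ b _ hab
    exact Subtype.ext (add_right_cancel hab)
  · intro m hm
    rw [Finsupp.mem_support_iff, part_apply] at hm
    simp only [ne_eq, ite_eq_right_iff, not_forall] at hm
    obtain ⟨hv, hm⟩ := hm
    refine ⟨⟨m - j • l0, by simp [hv, h]⟩, ?_, by simp⟩
    rw [Finsupp.mem_support_iff, slice_apply]
    simpa using hm
  · intro m hm
    have h0 : v m = 0 := m.2
    rw [slice_apply, part_apply, if_pos (by simp [h0, h]), AddChar.map_add_eq_mul, resChar_apply]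
    ring

theorem ev_eq_sum_parts {K : Type*} [Field K] (v : L →ₗ[ℤ] ℤ) (f : L →₀ ℤ) (χ : AddChar L K)
    (J : Finset ℤ) (hJ : ∀ m ∈ f.support, v m ∈ J) :
    ev χ f = ∑ j ∈ J, ev χ (part v j f) := by
  classical
  rw [ev_eq_sum, ← Finset.sum_fiberwise_of_maps_to hJ]
  refine Finset.sum_congr rfl fun j _ => ?_
  rw [ev_eq_sum]
  refine Finset.sum_congr ?_ ?_
  · ext m; simp [part, and_comm]
  · intro m hm
    rw [part_apply, if_pos (Finset.mem_filter.1 hm).2]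

theorem codim2_slice {fam : Finset (L →₀ ℤ)} (hfam : Codim2 fam) (v : L →ₗ[ℤ] ℤ) (l0 : L)
    (h : v l0 = 1) {fam' : Finset (LinearMap.ker v →₀ ℤ)}
    (hf' : ∀ f ∈ fam, ∀ m ∈ f.support, slice v l0 (v m) f ∈ fam') : Codim2 fam' := by
  classical
  intro F _ _ c hc ι _ l hl
  let R := RatFunc F
  have : CharZero R := charZero_of_injective_algebraMap (algebraMap F R).injective
  have hX : (RatFunc.X : R) ≠ 0 := RatFunc.X_ne_zero
  let π : L → LinearMap.ker v := fun m => ⟨m - v m • l0, by simp [h]⟩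
  have hπ : ∀ a b, π (a + b) = π a + π b := fun a b => by
    ext; simp only [π, map_add, Submodule.coe_add]; module
  let d : AddChar L R :=
    { toFun := fun m => algebraMap F R (c (π m)) * RatFunc.X ^ (v m)
      map_zero_eq_one' := by
        have : π 0 = 0 := by ext; simp [π]
        simp [this]
      map_add_eq_mul' := fun a b => by
        rw [hπ, AddChar.map_add_eq_mul, map_mul, map_add, zpow_add₀ hX]; ring }
  have hd : ∀ m, d m = algebraMap F R (c (π m)) * RatFunc.X ^ (v m) := fun m => rfl
  have hres : resChar (LinearMap.ker v) d = mapChar (algebraMap F R) c := by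
    ext m
    have h0 : v m = 0 := m.2
    have : π m = m := by ext; simp [π, h0]
    simp [hd, h0, this]
  have hdk : Kills fam d := by
    intro f hf
    rw [ev_eq_sum_parts v f d (f.support.image v) (fun m hm => Finset.mem_image_of_mem _ hm)]
    refine Finset.sum_eq_zero fun j hj => ?_
    obtain ⟨m, hm, rfl⟩ := Finset.mem_image.1 hj
    rw [ev_part_slice v l0 h, hres, ev_map, hc _ (hf' f hf m hm), map_zero, mul_zero]
  let l' : Unit ⊕ ι → L := Sum.elim (fun _ => l0) (fun i => (l i : L))
  have hind : AlgebraicIndependent ℚ (fun i => d (l' i)) := by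
    have hy : AlgebraicIndependent F (fun _ : Unit => (RatFunc.X : R)) := by
      rw [algebraicIndependent_unique_type_iff]
      exact RatFunc.transcendental_X
    have := AlgebraicIndependent.sumElim_comp (R := ℚ) hl hy
    convert this using 1
    ext i
    rcases i with i | i
    · have : π l0 = 0 := by ext; simp [π, h]
      simp [l', hd, h, this]
    · exact DFunLike.congr_fun hres (l i)
  have := hfam R d hdk _ l' hind
  rw [finrank_ker v l0 h] at this
  simp at this
  omega

theorem degen_fixed (ih : ∀ (L' : Type) [AddCommGroup L'] [Free ℤ L'] [Module.Finite ℤ L'],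
      finrank ℤ L' < finrank ℤ L → TStat L')
    {fam : Finset (L →₀ ℤ)} (hfam : Codim2 fam) (w : L →ₗ[ℤ] ℤ) (hw : w ≠ 0) :
    ∃ S : Finset L, 0 ∉ S ∧ ∀ χ : AddChar L ℂ, Rank1 χ → PartsVanish w fam χ →
      ∃ s ∈ S, χ s = 1 := by
  classical
  obtain ⟨l0, v, g, hg, hv, hwv⟩ := exists_section w hw
  let fam' : Finset (LinearMap.ker v →₀ ℤ) :=
    fam.biUnion fun f => f.support.image fun m => slice v l0 (v m) f
  have hf' : ∀ f ∈ fam, ∀ m ∈ f.support, slice v l0 (v m) f ∈ fam' := fun f hf m hm =>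
    Finset.mem_biUnion.2 ⟨f, hf, Finset.mem_image_of_mem _ hm⟩
  obtain ⟨S, hS0, hS⟩ := ih (LinearMap.ker v) (by rw [finrank_ker v l0 hv]; omega) fam'
    (codim2_slice hfam v l0 hv hf')
  refine ⟨S.image Subtype.val, ?_, ?_⟩
  · intro h
    obtain ⟨s, hs, hs0⟩ := Finset.mem_image.1 h
    have : s = 0 := Subtype.ext hs0
    exact hS0 (this ▸ hs)
  · intro χ hχ hpv
    have hr : Rank1 (resChar (LinearMap.ker v) χ) := by
      obtain ⟨ζ, a, ξ, ⟨M, hM, hζ⟩, hξ, he⟩ := hχ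
      exact ⟨resChar _ ζ, a ∘ₗ (LinearMap.ker v).subtype, ξ, ⟨M, hM, fun m => hζ m⟩, hξ,
        fun m => he m⟩
    obtain ⟨s, hs, hs1⟩ := hS _ hr (by
      intro f' hf'
      obtain ⟨f, hf, hf2⟩ := Finset.mem_biUnion.1 hf'
      obtain ⟨m, hm, rfl⟩ := Finset.mem_image.1 hf2
      have h1 := hpv f hf (w m)
      have h2 : part w (w m) f = part v (v m) f := by
        ext x
        simp only [part, Finsupp.filter_apply, hwv]
        simp only [mul_left_inj' hg]
      rw [h2, ev_part_slice v l0 hv] at h1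
      exact (mul_eq_zero.1 h1).resolve_left (char_ne_zero _ _))
    exact ⟨s, Finset.mem_image_of_mem _ hs, hs1⟩

theorem degen_lemma (ih : ∀ (L' : Type) [AddCommGroup L'] [Free ℤ L'] [Module.Finite ℤ L'],
      finrank ℤ L' < finrank ℤ L → TStat L')
    {fam : Finset (L →₀ ℤ)} (hfam : Codim2 fam) :
    ∃ S : Finset L, 0 ∉ S ∧ ∀ χ : AddChar L ℂ, Rank1 χ → Degen fam χ → ∃ s ∈ S, χ s = 1 := by
  classical
  let G : Finset (L →₀ ℤ) := fam.biUnion fun f => f.support.powerset.image fun s =>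
    f.filter (· ∈ s)
  let parts : (L →ₗ[ℤ] ℤ) → Set (L →₀ ℤ) := fun w => {g | ∃ f ∈ fam, ∃ e, g = part w e f}
  have hG : ∀ w, parts w ⊆ G := by
    rintro w g ⟨f, hf, e, rfl⟩
    refine Finset.mem_coe.2 (Finset.mem_biUnion.2 ⟨f, hf, Finset.mem_image.2
      ⟨f.support.filter (fun m => w m = e), by simp, ?_⟩⟩)
    ext x
    by_cases hx : f x = 0 <;> simp [part, Finsupp.filter_apply, hx]
  have hpv : ∀ w (χ : AddChar L ℂ), PartsVanish w fam χ ↔ ∀ g ∈ parts w, ev χ g = 0 := by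
    intro w χ
    constructor
    · rintro h g ⟨f, hf, e, rfl⟩; exact h f hf e
    · intro h f hf e; exact h _ ⟨f, hf, e, rfl⟩
  have key : ∀ H : Set (L →₀ ℤ), ∃ S : Finset L, 0 ∉ S ∧ ∀ w, w ≠ 0 → parts w = H →
      ∀ χ : AddChar L ℂ, Rank1 χ → PartsVanish w fam χ → ∃ s ∈ S, χ s = 1 := by
    intro H
    by_cases hex : ∃ w, w ≠ 0 ∧ parts w = H
    · obtain ⟨w, hw, hwH⟩ := hex
      obtain ⟨S, hS0, hS⟩ := degen_fixed ih hfam w hw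
      refine ⟨S, hS0, fun w' _ hw' χ hχ hp => hS χ hχ ?_⟩
      rw [hpv] at hp ⊢
      rwa [hwH, ← hw']
    · exact ⟨∅, by simp, fun w hw hwH => absurd ⟨w, hw, hwH⟩ hex⟩
  choose Sf hSf0 hSf using key
  refine ⟨G.powerset.biUnion fun H => Sf H, ?_, ?_⟩
  · simp only [Finset.mem_biUnion, not_exists, not_and]
    exact fun H _ => hSf0 H
  · rintro χ hχ ⟨w, hw, hp⟩
    obtain ⟨s, hs, hs1⟩ := hSf (parts w) w hw rfl χ hχ hp
    have hfin : (parts w).Finite := G.finite_toSet.subset (hG w)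
    refine ⟨s, Finset.mem_biUnion.2 ⟨hfin.toFinset, ?_, ?_⟩, hs1⟩
    · rw [Finset.mem_powerset, ← Finset.coe_subset, Set.Finite.coe_toFinset]; exact hG w
    · rwa [Set.Finite.coe_toFinset]

end

end BZ

namespace BZ

open NumberField Height

theorem posLog_support_finite {K : Type*} [Field K] [NumberField K] (y : K) :
    (Function.support fun v : FinitePlace K => Real.posLog (v y)).Finite := by
  by_cases hy : y = 0
  · subst hy; simp
  · refine (FinitePlace.hasFiniteMulSupport hy).subset fun v hv => ?_
    simp only [Function.mem_support, Function.mem_mulSupport] at hv ⊢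
    rintro h
    exact hv (by rw [h]; simp)

theorem log_product_formula {K : Type*} [Field K] [NumberField K] {x : K} (hx : x ≠ 0) :
    ∑ v : InfinitePlace K, v.mult * Real.log (v x) + ∑ᶠ v : FinitePlace K, Real.log (v x) = 0 := by
  have h := prod_abs_eq_one hx
  have hpos : ∀ v : FinitePlace K, v x ≠ 0 := fun v => (FinitePlace.pos_iff.2 hx).ne'
  have hsub := FinitePlace.hasFiniteMulSupport (K := K) hx
  have hsub' : (Function.mulSupport fun v : FinitePlace K => v x).Finite := hsub
  rw [finprod_eq_prod_of_mulSupport_subset (s := hsub'.toFinset) _ (by simp)] at h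
  rw [finsum_eq_sum_of_support_subset (s := hsub'.toFinset)]
  · have := congrArg Real.log h
    rw [Real.log_mul, Real.log_prod, Real.log_prod, Real.log_one] at this
    · simpa [Real.log_pow] using this
    · exact fun v _ => hpos v
    · intro v _
      exact pow_ne_zero _ (InfinitePlace.pos_iff.2 hx).ne'
    · exact Finset.prod_ne_zero_iff.2 fun v _ => pow_ne_zero _ (InfinitePlace.pos_iff.2 hx).ne'
    · exact Finset.prod_ne_zero_iff.2 fun v _ => hpos v
  · intro v hv
    simp only [Function.mem_support, Set.Finite.coe_toFinset, Function.mem_mulSupport] at hv ⊢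
    intro h
    exact hv (by rw [h]; simp)

theorem sum_mult_eq (K : Type*) [Field K] [NumberField K] :
    ∑ v : InfinitePlace K, (v.mult : ℝ) = Module.finrank ℚ K := by
  exact_mod_cast InfinitePlace.sum_mult_eq (K := K)

theorem arch_natCast {K : Type*} [Field K] [NumberField K] (v : InfinitePlace K) (n : ℕ) :
    v (n : K) = n := by
  rw [← v.norm_embedding_eq, map_natCast, Complex.norm_natCast]

theorem arch_intCast {K : Type*} [Field K] [NumberField K] (v : InfinitePlace K) (n : ℤ) :
    v (n : K) = |(n : ℝ)| := by
  rw [← v.norm_embedding_eq, map_intCast, Complex.norm_intCast]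

theorem fin_le_one {K : Type*} [Field K] [NumberField K] (v : FinitePlace K) (x : K)
    (hx : IsIntegral ℤ x) : v x ≤ 1 := by
  rw [← v.norm_embedding_eq x]
  exact FinitePlace.norm_le_one K v.maximalIdeal (⟨x, hx⟩ : 𝓞 K)

theorem fin_intCast_le {K : Type*} [Field K] [NumberField K] (v : FinitePlace K) (n : ℤ) :
    v (n : K) ≤ 1 := fin_le_one v _ (isIntegral_algebraMap (R := ℤ) (x := n))

theorem fin_sum_le {K ι : Type*} [Field K] [NumberField K] (v : FinitePlace K) (s : Finset ι)
    (f : ι → K) (B : ℝ) (hB : 0 ≤ B) (h : ∀ i ∈ s, v (f i) ≤ B) : v (∑ i ∈ s, f i) ≤ B := by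
  classical
  induction s using Finset.induction_on with
  | empty => simpa
  | insert a s ha ih =>
    rw [Finset.sum_insert ha]
    refine (v.add_le _ _).trans (max_le (h a (Finset.mem_insert_self _ _)) (ih fun i hi =>
      h i (Finset.mem_insert_of_mem hi)))

theorem arch_sum_le {K ι : Type*} [Field K] [NumberField K] (v : InfinitePlace K) (s : Finset ι)
    (f : ι → K) : v (∑ i ∈ s, f i) ≤ ∑ i ∈ s, v (f i) := by
  simp only [← v.norm_embedding_eq, map_sum]
  exact norm_sum_le _ _

theorem place_root_eq_one {r : ℝ} (hr : 0 ≤ r) {M : ℕ} (hM : 0 < M) (h : r ^ M = 1) : r = 1 :=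
  (pow_eq_one_iff_of_nonneg hr hM.ne').1 h

/-- The product formula applied to a nonzero element with bounds at all places. -/
theorem product_formula_ineq {K ι : Type*} [Field K] [NumberField K] {x : K} (hx : x ≠ 0)
    (z : ℕ) (hz : z ≠ 0) (C : ℝ) (hC : 0 < C) (s : Finset ι) (y : ι → K) (n : ι → ℤ)
    (harch : ∀ v : InfinitePlace K, v x ≤ C * ∏ i ∈ s, max 1 (v (y i)) ^ n i)
    (hfin : ∀ v : FinitePlace K, v x ≤ v (z : K) * ∏ i ∈ s, max 1 (v (y i)) ^ n i) :
    Module.finrank ℚ K * Real.log z ≤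
      Module.finrank ℚ K * Real.log C + ∑ i ∈ s, n i * logHeight₁ (y i) := by
  have hz' : (z : K) ≠ 0 := by exact_mod_cast hz
  have h1 := log_product_formula hx
  have h2 := log_product_formula hz'
  have hmax : ∀ r : ℝ, (0 : ℝ) < max 1 r := fun r => lt_max_of_lt_left one_pos
  have ha : ∀ v : InfinitePlace K, Real.log (v x) ≤
      Real.log C + ∑ i ∈ s, n i * Real.posLog (v (y i)) := by
    intro v
    have := Real.log_le_log (InfinitePlace.pos_iff.2 hx) (harch v)
    rw [Real.log_mul hC.ne' (Finset.prod_ne_zero_iff.2 fun i _ => zpow_ne_zero _ (hmax _).ne'),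
      Real.log_prod (fun i _ => zpow_ne_zero _ (hmax _).ne')] at this
    simpa [Real.log_zpow, ← Real.posLog_eq_log_max_one (apply_nonneg v _)] using this
  have hf : ∀ v : FinitePlace K, Real.log (v x) ≤
      Real.log (v (z : K)) + ∑ i ∈ s, n i * Real.posLog (v (y i)) := by
    intro v
    have := Real.log_le_log (FinitePlace.pos_iff.2 hx) (hfin v)
    rw [Real.log_mul (FinitePlace.pos_iff.2 hz').ne'
      (Finset.prod_ne_zero_iff.2 fun i _ => zpow_ne_zero _ (hmax _).ne'),
      Real.log_prod (fun i _ => zpow_ne_zero _ (hmax _).ne')] at this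
    simpa [Real.log_zpow, ← Real.posLog_eq_log_max_one (apply_nonneg v _)] using this
  have hlogsupp : ∀ w : K, w ≠ 0 →
      (Function.support fun v : FinitePlace K => Real.log (v w)).Finite := by
    intro w hw
    refine (FinitePlace.hasFiniteMulSupport hw).subset fun v hv => ?_
    simp only [Function.mem_support, Function.mem_mulSupport] at hv ⊢
    rintro h
    exact hv (by rw [h]; simp)
  classical
  let T : Finset (FinitePlace K) := (hlogsupp x hx).toFinset ∪ (hlogsupp z hz').toFinset ∪
    s.biUnion fun i => (posLog_support_finite (y i)).toFinset
  have e1 : ∑ᶠ v : FinitePlace K, Real.log (v x) = ∑ v ∈ T, Real.log (v x) :=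
    finsum_eq_sum_of_support_subset _ fun v hv => by
      simp only [T, Finset.coe_union, Set.Finite.coe_toFinset]
      exact Or.inl (Or.inl hv)
  have e2 : ∑ᶠ v : FinitePlace K, Real.log (v (z : K)) = ∑ v ∈ T, Real.log (v (z : K)) :=
    finsum_eq_sum_of_support_subset _ fun v hv => by
      simp only [T, Finset.coe_union, Set.Finite.coe_toFinset]
      exact Or.inl (Or.inr hv)
  have e3 : ∀ i ∈ s, ∑ᶠ v : FinitePlace K, Real.posLog (v (y i)) = ∑ v ∈ T, Real.posLog (v (y i)) :=
    fun i hi => finsum_eq_sum_of_support_subset _ fun v hv => by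
      refine Finset.mem_coe.2 (Finset.mem_union_right _ (Finset.mem_biUnion.2 ⟨i, hi, ?_⟩))
      simpa using hv
  rw [e1] at h1
  rw [e2] at h2
  have hzarch : ∀ v : InfinitePlace K, Real.log (v (z : K)) = Real.log z := fun v => by
    rw [arch_natCast]
  simp_rw [hzarch] at h2
  rw [← Finset.sum_mul, sum_mult_eq] at h2
  have g1 : ∑ v : InfinitePlace K, v.mult * Real.log (v x) ≤ Module.finrank ℚ K * Real.log C +
      ∑ i ∈ s, n i * ∑ v : InfinitePlace K, v.mult * Real.posLog (v (y i)) := by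
    calc _ ≤ ∑ v : InfinitePlace K, v.mult * (Real.log C + ∑ i ∈ s, n i * Real.posLog (v (y i))) :=
          Finset.sum_le_sum fun v _ => mul_le_mul_of_nonneg_left (ha v) (by positivity)
      _ = _ := by
          simp_rw [mul_add, Finset.sum_add_distrib, ← Finset.sum_mul, sum_mult_eq, Finset.mul_sum]
          congr 1
          rw [Finset.sum_comm]
          exact Finset.sum_congr rfl fun i _ => Finset.sum_congr rfl fun v _ => by ring
  have g2 : ∑ v ∈ T, Real.log (v x) ≤ ∑ v ∈ T, Real.log (v (z : K)) +
      ∑ i ∈ s, n i * ∑ v ∈ T, Real.posLog (v (y i)) := by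
    calc _ ≤ ∑ v ∈ T, (Real.log (v (z : K)) + ∑ i ∈ s, n i * Real.posLog (v (y i))) :=
          Finset.sum_le_sum fun v _ => hf v
      _ = _ := by
          simp_rw [Finset.sum_add_distrib, Finset.mul_sum]
          congr 1
          rw [Finset.sum_comm]
  have g3 : ∑ i ∈ s, n i * logHeight₁ (y i) =
      ∑ i ∈ s, n i * ∑ v : InfinitePlace K, v.mult * Real.posLog (v (y i)) +
      ∑ i ∈ s, n i * ∑ v ∈ T, Real.posLog (v (y i)) := by
    rw [← Finset.sum_add_distrib]
    refine Finset.sum_congr rfl fun i hi => ?_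
    rw [NumberField.logHeight₁_eq, e3 i hi]; ring
  rw [g3]
  linarith

end BZ

namespace BZ

open NumberField Height Module

section
variable {L : Type} [AddCommGroup L] {E : Type*} [Field E] [NumberField E]

/-- A split zero forces a bound at each absolute value. -/
theorem split_bound (v : AbsoluteValue E ℝ) (c : ℝ) (hc : 0 ≤ c) (f : L →₀ ℤ)
    (χ ζ : AddChar L E) (a : L →ₗ[ℤ] ℤ) (ξ : E) (hζ : IsTors ζ) (hξ : ξ ≠ 0)
    (hχ : ∀ m, χ m = ζ m * ξ ^ (a m))
    (hv : ∀ s ⊆ f.support, ∀ B : ℝ, 0 ≤ B → (∀ m ∈ s, v (χ m) ≤ B) →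
      v (∑ m ∈ s, (f m : E) * χ m) ≤ c * B)
    (t : ℤ) (G : ℕ) (hsplit : ∀ m ∈ f.support, a m ≤ t ∨ t + G ≤ a m) (h0 : ev χ f = 0) :
    v ((∑ m ∈ f.support with a m ≤ t, (f m : E) * χ m) * ξ ^ (-(t + G))) ≤
      c * max 1 (v ξ) ^ (-(G : ℤ)) := by
  classical
  obtain ⟨M, hM, hζM⟩ := hζ
  have hζ1 : ∀ m, v (ζ m) = 1 := fun m =>
    place_root_eq_one (v.nonneg _) hM (by rw [← map_pow, hζM, map_one])
  have hχv : ∀ m, v (χ m) = v ξ ^ (a m) := fun m => by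
    rw [hχ, map_mul, hζ1, one_mul, map_zpow₀]
  have hpos : 0 < v ξ := v.pos hξ
  rw [map_mul, map_zpow₀]
  rcases le_total 1 (v ξ) with h1 | h1
  · rw [max_eq_right h1]
    have := hv (f.support.filter fun m => a m ≤ t) (Finset.filter_subset _ _) (v ξ ^ t)
      (by positivity) (fun m hm => by
        rw [hχv]; exact zpow_le_zpow_right₀ h1 (Finset.mem_filter.1 hm).2)
    calc _ ≤ c * v ξ ^ t * v ξ ^ (-(t + G)) := by gcongr
      _ = _ := by
        rw [mul_assoc, ← zpow_add₀ hpos.ne']; congr 2; ring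
  · rw [max_eq_left h1, one_zpow, mul_one]
    have hsum : ∑ m ∈ f.support with a m ≤ t, (f m : E) * χ m =
        - ∑ m ∈ f.support with ¬ a m ≤ t, (f m : E) * χ m := by
      rw [eq_neg_iff_add_eq_zero, Finset.sum_filter_add_sum_filter_not, ← h0, ev_eq_sum]
    rw [hsum, v.map_neg]
    have := hv (f.support.filter fun m => ¬ a m ≤ t) (Finset.filter_subset _ _) (v ξ ^ (t + G))
      (by positivity) (fun m hm => by
        rw [hχv]
        have hm' := Finset.mem_filter.1 hm
        exact zpow_le_zpow_right_of_le_one₀ hpos h1 ((hsplit m hm'.1).resolve_left hm'.2))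
    calc _ ≤ c * v ξ ^ (t + G) * v ξ ^ (-(t + G)) := by gcongr
      _ = _ := by
        rw [mul_assoc, ← zpow_add₀ hpos.ne']; simp

theorem split_height (f : L →₀ ℤ)
    (χ ζ : AddChar L E) (a : L →ₗ[ℤ] ℤ) (ξ : E) (hζ : IsTors ζ) (hξ : ξ ≠ 0)
    (hχ : ∀ m, χ m = ζ m * ξ ^ (a m))
    (t : ℤ) (G : ℕ) (hsplit : ∀ m ∈ f.support, a m ≤ t ∨ t + G ≤ a m) (h0 : ev χ f = 0)
    (hne : ∑ m ∈ f.support with a m ≤ t, (f m : E) * χ m ≠ 0) :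
    G * logHeight₁ ξ ≤ finrank ℚ E * Real.log (l1 f) := by
  have hl1 : 0 < l1 f := by
    rw [Nat.pos_iff_ne_zero]
    intro h
    simp only [l1, Finsupp.sum, Finset.sum_eq_zero_iff, Int.natAbs_eq_zero] at h
    apply hne
    refine Finset.sum_eq_zero fun m hm => ?_
    rw [h m (Finset.mem_filter.1 hm).1]; simp
  have key := product_formula_ineq (K := E) (mul_ne_zero hne (zpow_ne_zero (-(t + G)) hξ)) 1
    one_ne_zero (l1 f) (by exact_mod_cast hl1) {()} (fun _ => ξ) (fun _ => -(G : ℤ)) ?_ ?_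
  · simp at key; linarith
  · intro v
    rw [Finset.prod_singleton]
    refine split_bound v.val (l1 f) (by positivity) f χ ζ a ξ hζ hξ hχ ?_ t G hsplit h0
    intro s hs B hB hmB
    refine (arch_sum_le v s _).trans ?_
    rw [l1, Finsupp.sum, Nat.cast_sum, Finset.sum_mul]
    refine (Finset.sum_le_sum fun m hm => ?_).trans (Finset.sum_le_sum_of_subset_of_nonneg hs
      fun m _ _ => by positivity)
    rw [map_mul, arch_intCast, Nat.cast_natAbs, Int.cast_abs]
    exact mul_le_mul_of_nonneg_left (hmB m hm) (abs_nonneg _)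
  · intro v
    rw [Finset.prod_singleton, Nat.cast_one, map_one]
    refine split_bound v.val 1 zero_le_one f χ ζ a ξ hζ hξ hχ ?_ t G hsplit h0
    intro s hs B hB hmB
    rw [one_mul]
    refine fin_sum_le v s _ B hB fun m hm => ?_
    rw [map_mul]
    calc _ ≤ 1 * B := mul_le_mul (fin_intCast_le v _) (hmB m hm) (apply_nonneg v _) zero_le_one
      _ = B := one_mul _

end

section
variable {L : Type} [AddCommGroup L] [Free ℤ L] [Module.Finite ℤ L]

/-- Size of a linear form with respect to a fixed basis. -/
noncomputable def sz (a : L →ₗ[ℤ] ℤ) : ℕ :=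
  Finset.univ.sup fun i => (a (Free.chooseBasis ℤ L i)).natAbs

theorem exists_multiple_or_form (N : Submodule ℤ L) (x : L) :
    (∃ n : ℤ, n ≠ 0 ∧ n • x ∈ N) ∨ ∃ w : L →ₗ[ℤ] ℤ, w ≠ 0 ∧ ∀ y ∈ N, w y = 0 := by
  by_contra! h
  obtain ⟨h1, h2⟩ := h
  let Q := L ⧸ N
  let T := Submodule.torsion ℤ Q
  let R := Q ⧸ T
  have : IsTorsionFree ℤ R := inferInstance
  have : Module.Finite ℤ R := inferInstance
  have : Free ℤ R := inferInstance
  let φ : L →ₗ[ℤ] R := T.mkQ ∘ₗ N.mkQ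
  have hφ : φ x ≠ 0 := by
    intro h
    have hm : N.mkQ x ∈ T := by
      rwa [← Submodule.Quotient.mk_eq_zero]
    obtain ⟨n, hn⟩ := (Submodule.mem_torsion_iff _).1 hm
    refine h1 n (nonZeroDivisors.coe_ne_zero n) ?_
    rw [← Submodule.Quotient.mk_eq_zero]
    exact hn
  let b := Free.chooseBasis ℤ R
  have : ∃ i, b.repr (φ x) i ≠ 0 := by
    by_contra! h
    exact hφ (b.repr.map_eq_zero_iff.1 (Finsupp.ext h))
  obtain ⟨i, hi⟩ := this
  obtain ⟨y, hy, hy0⟩ := h2 (b.coord i ∘ₗ φ) (fun h => hi (by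
    have := LinearMap.congr_fun h x
    simpa using this))
  apply hy0
  have : N.mkQ y = 0 := (Submodule.Quotient.mk_eq_zero N).2 hy
  simp [φ, this]

theorem bound_of_span (Δ : Finset L) : ∃ C : ℕ, 0 < C ∧ ∀ (a : L →ₗ[ℤ] ℤ) (B : ℕ),
    (∀ d ∈ Δ, (a d).natAbs ≤ B) →
    (∃ w : L →ₗ[ℤ] ℤ, w ≠ 0 ∧ ∀ d ∈ Δ, w d = 0) ∨ sz a ≤ C * B := by
  classical
  by_cases hw : ∃ w : L →ₗ[ℤ] ℤ, w ≠ 0 ∧ ∀ d ∈ Δ, w d = 0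
  · exact ⟨1, one_pos, fun a B _ => Or.inl hw⟩
  have h1 : ∀ x : L, ∃ n : ℤ, n ≠ 0 ∧ n • x ∈ Submodule.span ℤ (Δ : Set L) := fun x =>
    (exists_multiple_or_form _ x).resolve_right fun ⟨w, hw0, hwN⟩ =>
      hw ⟨w, hw0, fun d hd => hwN d (Submodule.subset_span hd)⟩
  have h2 : ∀ x : L, ∃ C : ℕ, ∀ (a : L →ₗ[ℤ] ℤ) (B : ℕ),
      (∀ d ∈ Δ, (a d).natAbs ≤ B) → (a x).natAbs ≤ C * B := by
    intro x
    obtain ⟨n, hn, hx⟩ := h1 x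
    obtain ⟨c, hc⟩ := Submodule.mem_span_finset.1 hx
    refine ⟨∑ d ∈ Δ, (c d).natAbs, fun a B hB => ?_⟩
    have : (a (n • x)).natAbs ≤ (∑ d ∈ Δ, (c d).natAbs) * B := by
      rw [← hc.2, map_sum, Finset.sum_mul]
      refine (Int.natAbs_sum_le _ _).trans (Finset.sum_le_sum fun d hd => ?_)
      rw [map_smul, smul_eq_mul, Int.natAbs_mul]
      exact Nat.mul_le_mul_left _ (hB d hd)
    rw [map_smul, smul_eq_mul, Int.natAbs_mul] at this
    exact (Nat.le_mul_of_pos_left _ (Int.natAbs_pos.2 hn)).trans this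
  choose C hC using h2
  refine ⟨∑ i, C (Free.chooseBasis ℤ L i) + 1, Nat.succ_pos _, fun a B hB => Or.inr ?_⟩
  refine Finset.sup_le fun i _ => ?_
  refine (hC _ a B hB).trans (Nat.mul_le_mul_right _ ?_)
  exact (Finset.single_le_sum (f := fun i => C (Free.chooseBasis ℤ L i)) (fun _ _ => Nat.zero_le _)
    (Finset.mem_univ i)).trans (Nat.le_succ _)

theorem cluster_sum {M R : Type*} [CommRing R] (a : M → ℤ) (c : M → R) (G : ℕ) (hG : 0 < G) :
    ∀ (n : ℕ) (s : Finset M), s.card ≤ n → ∀ g : M → R,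
    (∀ t : ℤ, (∀ m ∈ s, a m ≤ t ∨ t + G ≤ a m) → ∑ m ∈ s with a m ≤ t, c m = 0) →
    (∀ m ∈ s, ∀ m' ∈ s, (a m - a m').natAbs < G → g m = g m') →
    ∑ m ∈ s, g m * c m = 0 := by
  classical
  intro n
  induction n with
  | zero =>
    intro s hs g _ _
    rw [Finset.card_eq_zero.1 (Nat.le_zero.1 hs)]; simp
  | succ n ih =>
    intro s hs g hsp hg
    rcases s.eq_empty_or_nonempty with rfl | hne
    · simp
    obtain ⟨m1, hm1, hmax⟩ := s.exists_max_image a hne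
    have hfull : ∑ m ∈ s, c m = 0 := by
      have := hsp (a m1) fun m hm => Or.inl (hmax m hm)
      rwa [Finset.filter_true_of_mem hmax] at this
    have h1 : ∑ m ∈ s, g m * c m = ∑ m ∈ s, (g m - g m1) * c m := by
      simp only [sub_mul, Finset.sum_sub_distrib]
      rw [← Finset.mul_sum, hfull]; ring
    rw [h1]
    rcases (s.filter fun m => g m ≠ g m1).eq_empty_or_nonempty with hU | hU
    · refine Finset.sum_eq_zero fun m hm => ?_
      have : g m = g m1 := by
        by_contra h
        exact Finset.notMem_empty m (hU ▸ Finset.mem_filter.2 ⟨hm, h⟩)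
      rw [this]; ring
    obtain ⟨u, hu, humax⟩ := Finset.exists_max_image _ a hU
    obtain ⟨hus, hug⟩ := Finset.mem_filter.1 hu
    have hgap : ∀ m ∈ s, a u < a m → g m = g m1 ∧ a u + G ≤ a m := by
      intro m hm hlt
      have h2 : g m = g m1 := by
        by_contra h
        exact absurd (humax m (Finset.mem_filter.2 ⟨hm, h⟩)) (not_le.2 hlt)
      refine ⟨h2, ?_⟩
      by_contra h3
      apply hug
      rw [← h2]
      exact hg u hus m hm (by omega)
    have hult : a u < a m1 := by
      refine lt_of_le_of_ne (hmax u hus) fun h => hug (hg u hus m1 hm1 ?_)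
      simpa [h] using hG
    rw [← Finset.sum_filter_add_sum_filter_not s (fun m => a m ≤ a u),
      Finset.sum_eq_zero (s := s.filter fun m => ¬ a m ≤ a u), add_zero]
    · apply ih
      · have : (s.filter fun m => a m ≤ a u).card < s.card :=
          Finset.card_lt_card (Finset.filter_ssubset.2 ⟨m1, hm1, by simpa using hult⟩)
        omega
      · intro t ht
        rcases lt_or_ge t (a u) with htu | htu
        · have htu' := (ht u (Finset.mem_filter.2 ⟨hus, le_rfl⟩)).resolve_left (not_le.2 htu)
          rw [Finset.filter_filter]
          rw [← hsp t fun m hm => ?_]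
          · refine Finset.sum_congr ?_ fun _ _ => rfl
            ext m
            simp only [Finset.mem_filter, and_congr_right_iff]
            intro _
            exact ⟨fun h => h.2, fun h => ⟨h.trans htu.le, h⟩⟩
          · rcases le_or_gt (a m) (a u) with h | h
            · exact ht m (Finset.mem_filter.2 ⟨hm, h⟩)
            · right; omega
        · rw [Finset.filter_filter, ← hsp (a u) fun m hm => ?_]
          · refine Finset.sum_congr ?_ fun _ _ => rfl
            ext m
            simp only [Finset.mem_filter, and_congr_right_iff]
            intro _
            exact ⟨fun h => h.1, fun h => ⟨h, h.trans htu⟩⟩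
          · rcases le_or_gt (a m) (a u) with h | h
            · exact Or.inl h
            · exact Or.inr (hgap m hm h).2
      · intro m hm m' hm' h
        rw [hg m (Finset.mem_filter.1 hm).1 m' (Finset.mem_filter.1 hm').1 h]
    · intro m hm
      obtain ⟨hm, h⟩ := Finset.mem_filter.1 hm
      rw [(hgap m hm (not_le.1 h)).1]; ring

theorem height_lemma (fam : Finset (L →₀ ℤ)) : ∃ C : ℕ, 0 < C ∧
    ∀ (E : Type) [Field E] [NumberField E] (χ ζ : AddChar L E) (a : L →ₗ[ℤ] ℤ) (ξ : E),
      IsTors ζ → ξ ≠ 0 → (∀ m, χ m = ζ m * ξ ^ (a m)) → Kills fam χ → ¬ Degen fam χ →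
      C ≤ sz a → sz a * logHeight₁ ξ ≤ C * finrank ℚ E := by
  classical
  let Δ0 : Finset L := fam.biUnion fun f => (f.support ×ˢ f.support).image fun x => x.1 - x.2
  choose C hC0 hC using bound_of_span (L := L)
  let C0 := Δ0.powerset.sup C
  have hC0pos : 0 < C0 := (hC0 ∅).trans_le
    (Finset.le_sup (f := C) (Finset.mem_powerset.2 (Finset.empty_subset _)))
  let Λ : ℝ := Real.log ((∑ f ∈ fam, l1 f) + 1 : ℕ)
  have hΛ : 0 ≤ Λ := Real.log_natCast_nonneg _
  refine ⟨max (2 * C0) ⌈4 * C0 * Λ⌉₊, lt_max_of_lt_left (by omega), ?_⟩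
  intro E _ _ χ ζ a ξ hζ hξ hχ hk hdeg hsz
  have key : ∀ G : ℕ, 0 < G → G * logHeight₁ ξ ≤ finrank ℚ E * Λ ∨ sz a ≤ C0 * G := by
    intro G hG
    by_contra! hcon
    obtain ⟨hcon1, hcon2⟩ := hcon
    let Δ := Δ0.filter fun d => (a d).natAbs < G
    have hΔ : Δ ∈ Δ0.powerset := Finset.mem_powerset.2 (Finset.filter_subset _ _)
    have hCΔ : C Δ ≤ C0 := Finset.le_sup (f := C) hΔ
    rcases hC Δ a G (fun d hd => (Finset.mem_filter.1 hd).2.le) with ⟨w, hw, hwΔ⟩ | h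
    · refine hdeg ⟨w, hw, fun f hf e => ?_⟩
      have hpart : ev χ (part w e f) =
          ∑ m ∈ f.support, (if w m = e then (1 : E) else 0) * ((f m : E) * χ m) := by
        rw [ev_eq_sum]
        simp only [ite_mul, one_mul, zero_mul]
        rw [← Finset.sum_filter]
        refine Finset.sum_congr ?_ fun m hm => ?_
        · ext m; simp [part, and_comm]
        · rw [part_apply, if_pos (Finset.mem_filter.1 hm).2]
      rw [hpart]
      refine cluster_sum a (fun m => (f m : E) * χ m) G hG _ f.support le_rfl _ ?_ ?_
      · intro t ht
        by_contra hne
        have h1 := split_height f χ ζ a ξ hζ hξ hχ t G ht (hk f hf) hne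
        have h2 : Real.log (l1 f) ≤ Λ := by
          rcases Nat.eq_zero_or_pos (l1 f) with h0 | h0
          · rw [h0]; simpa using hΛ
          · refine Real.log_le_log (by exact_mod_cast h0) ?_
            exact_mod_cast (Finset.single_le_sum (f := l1) (fun _ _ => Nat.zero_le _) hf).trans
              (Nat.le_succ _)
        have h3 : (finrank ℚ E : ℝ) * Real.log (l1 f) ≤ finrank ℚ E * Λ := by gcongr
        linarith
      · intro m hm m' hm' h
        have : w (m - m') = 0 := hwΔ _ (Finset.mem_filter.2 ⟨Finset.mem_biUnion.2 ⟨f, hf,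
          Finset.mem_image.2 ⟨(m, m'), Finset.mk_mem_product hm hm', rfl⟩⟩, by rwa [map_sub]⟩)
        rw [map_sub, sub_eq_zero] at this
        simp only [this]
    · exact absurd (h.trans (Nat.mul_le_mul_right _ hCΔ)) (not_le.2 hcon2)
  have hsz1 : 2 * C0 ≤ sz a := (le_max_left _ _).trans hsz
  set G := sz a / (2 * C0) with hGdef
  have hG : 0 < G := Nat.div_pos hsz1 (by omega)
  have hG1 : 2 * C0 * G ≤ sz a := Nat.mul_div_le _ _
  have hG2 : sz a ≤ 4 * C0 * G := by
    have := Nat.lt_mul_div_succ (sz a) (show 0 < 2 * C0 by omega)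
    rw [← hGdef] at this
    nlinarith
  have h1 := (key G hG).resolve_right (by
    have : 0 < C0 * G := Nat.mul_pos hC0pos hG
    have : 2 * C0 * G = C0 * G + C0 * G := by ring
    omega)
  have hh : 0 ≤ logHeight₁ ξ := zero_le_logHeight₁ ξ
  calc (sz a : ℝ) * logHeight₁ ξ ≤ (4 * C0 * G : ℕ) * logHeight₁ ξ := by gcongr
    _ = 4 * C0 * (G * logHeight₁ ξ) := by push_cast; ring
    _ ≤ 4 * C0 * (finrank ℚ E * Λ) := by gcongr
    _ = (4 * C0 * Λ) * finrank ℚ E := by ring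
    _ ≤ _ := by
      gcongr
      exact (Nat.le_ceil _).trans (by exact_mod_cast le_max_right _ _)

end

end BZ

namespace BZ

open Polynomial

section
variable {F : Type*} [Field F]

theorem det_functional (a b : ℕ) (lam : Fin a → F[X] →ₗ[F] F) (mu : Fin b → F[X] →ₗ[F] F)
    (g : F[X]) (hg : g.Monic) (hga : g.natDegree = a) (h : ∀ r l, lam r (g * X ^ l) = 0) :
    (Matrix.of fun r c : Fin a ⊕ Fin b =>
      (Sum.elim lam mu r) (X ^ (finSumFinEquiv c : ℕ))).det =
    (Matrix.of fun r c : Fin a => lam r (X ^ (c : ℕ))).det *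
    (Matrix.of fun r c : Fin b => mu r (g * X ^ (c : ℕ))).det := by
  classical
  let pol : Fin (a + b) → F[X] := fun j => if (j : ℕ) < a then X ^ (j : ℕ) else g * X ^ (j - a : ℕ)
  have hmon : ∀ j, (pol j).Monic := fun j => by
    dsimp only [pol]; split_ifs
    · exact monic_X_pow _
    · exact hg.mul (monic_X_pow _)
  have hdeg : ∀ j, (pol j).natDegree = j := fun j => by
    dsimp only [pol]; split_ifs with hj
    · exact natDegree_X_pow _
    · rw [hg.natDegree_mul (monic_X_pow _), natDegree_X_pow, hga]; omega
  have hU := Matrix.det_matrixOfPolynomials pol hdeg hmon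
  set U := (Matrix.of fun i j : Fin (a + b) => (pol j).coeff i) with hUdef
  let U' : Matrix (Fin a ⊕ Fin b) (Fin a ⊕ Fin b) F := U.submatrix finSumFinEquiv finSumFinEquiv
  have hU' : U'.det = 1 := by rw [Matrix.det_submatrix_equiv_self, hU]
  rw [← mul_one (Matrix.det _), ← hU', ← Matrix.det_mul]
  have hexp : ∀ j : Fin (a + b), pol j = ∑ l : Fin (a + b), (pol j).coeff l • X ^ (l : ℕ) := by
    intro j
    conv_lhs => rw [as_sum_range' (pol j) (a + b) (by rw [hdeg]; exact j.2)]
    rw [Finset.sum_range]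
    refine Finset.sum_congr rfl fun l _ => ?_
    rw [smul_X_eq_monomial]
  have hprod : (Matrix.of fun r c : Fin a ⊕ Fin b =>
      (Sum.elim lam mu r) (X ^ (finSumFinEquiv c : ℕ))) * U' =
      Matrix.of fun r c => (Sum.elim lam mu r) (pol (finSumFinEquiv c)) := by
    ext r c
    rw [Matrix.mul_apply, Matrix.of_apply, hexp, map_sum,
      ← Equiv.sum_comp (finSumFinEquiv : Fin a ⊕ Fin b ≃ _)]
    refine Finset.sum_congr rfl fun l _ => ?_
    rw [map_smul, smul_eq_mul, mul_comm]
    rfl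
  rw [hprod]
  rw [← Matrix.fromBlocks_toBlocks (Matrix.of fun r c => (Sum.elim lam mu r) (pol (finSumFinEquiv c)))]
  have h12 : (Matrix.of fun r c => (Sum.elim lam mu r) (pol (finSumFinEquiv c))).toBlocks₁₂ = 0 := by
    ext r c
    simp [Matrix.toBlocks₁₂, pol, h]
  rw [h12, Matrix.det_fromBlocks_zero₁₂]
  congr 2
  · ext r c
    simp [Matrix.toBlocks₁₁, pol]
  · ext r c
    simp [Matrix.toBlocks₂₂, pol]

theorem hasseDeriv_zero_dvd (p : F[X]) (x : F) (T : ℕ) (h : ∀ s < T, (hasseDeriv s p).eval x = 0) :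
    (X - C x) ^ T ∣ p := by
  rw [X_sub_C_pow_dvd_iff, X_pow_dvd_iff]
  intro s hs
  rw [← taylor_apply, taylor_coeff, h s hs]

theorem dvd_hasseDeriv_zero (p : F[X]) (x : F) (T : ℕ) (h : (X - C x) ^ T ∣ p) (s : ℕ) (hs : s < T) :
    (hasseDeriv s p).eval x = 0 := by
  rw [X_sub_C_pow_dvd_iff, X_pow_dvd_iff] at h
  rw [← taylor_coeff, taylor_apply, h s hs]

theorem eval_hasseDeriv_X_pow (s l : ℕ) (x : F) :
    (hasseDeriv s (X ^ l : F[X])).eval x = (l.choose s : F) * x ^ (l - s) := by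
  rw [← monomial_one_right_eq_X_pow, hasseDeriv_monomial, eval_monomial, mul_one]

/-- The confluent Vandermonde determinant does not vanish. -/
theorem confluent_ne_zero {ι : Type*} [Fintype ι] (x : ι → F) (hx : Function.Injective x)
    (T a : ℕ) (e : Fin a ≃ ι × Fin T) :
    (Matrix.of fun r c : Fin a =>
      (hasseDeriv ((e r).2 : ℕ) (X ^ (c : ℕ) : F[X])).eval (x (e r).1)).det ≠ 0 := by
  classical
  intro hdet
  obtain ⟨v, hv0, hv⟩ := Matrix.exists_mulVec_eq_zero_iff.2 hdet
  let p : F[X] := ∑ c : Fin a, v c • X ^ (c : ℕ)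
  have hp : ∀ i s, s < T → (hasseDeriv s p).eval (x i) = 0 := by
    intro i s hs
    have := congrFun hv (e.symm (i, ⟨s, hs⟩))
    simp only [Matrix.mulVec, dotProduct, Matrix.of_apply, Equiv.apply_symm_apply,
      Pi.zero_apply] at this
    rw [← this]
    simp only [p, map_sum, map_smul, eval_finsetSum, eval_smul, smul_eq_mul]
    exact Finset.sum_congr rfl fun _ _ => mul_comm _ _
  have hdvd : ∏ i, (X - C (x i)) ^ T ∣ p := by
    refine Finset.prod_dvd_of_coprime ?_ fun i _ => hasseDeriv_zero_dvd p _ T (hp i)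
    intro i _ j _ hij
    exact (isCoprime_X_sub_C_of_isUnit_sub
      (sub_ne_zero.2 fun h => hij (hx h)).isUnit).pow
  have hpdeg : p.degree < a := by
    refine (degree_sum_le _ _).trans_lt ((Finset.sup_lt_iff (WithBot.bot_lt_coe a)).2 fun c _ => ?_)
    refine (degree_smul_le _ _).trans_lt ?_
    rw [degree_X_pow]
    exact WithBot.coe_lt_coe.2 (by exact_mod_cast c.2)
  have hdeg : (∏ i, (X - C (x i)) ^ T : F[X]).natDegree = a := by
    rw [natDegree_prod_of_monic _ _ fun i _ => (monic_X_sub_C _).pow _]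
    simp only [natDegree_pow, natDegree_X_sub_C, mul_one, Finset.sum_const, Finset.card_univ,
      smul_eq_mul]
    have := Fintype.card_congr e
    simpa using this.symm
  have hp0 : p = 0 := by
    by_contra hp0
    have h1 := natDegree_le_of_dvd hdvd hp0
    rw [hdeg] at h1
    rw [degree_eq_natDegree hp0] at hpdeg
    exact absurd (by exact_mod_cast hpdeg) (not_lt.2 h1)
  apply hv0
  ext c
  have := congrArg (fun q => q.coeff (c : ℕ)) hp0
  simp only [p, finsetSum_coeff, coeff_smul, coeff_X_pow, smul_eq_mul, mul_ite, mul_one,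
    mul_zero, coeff_zero] at this
  rw [Pi.zero_apply, ← this, Finset.sum_eq_single c]
  · simp
  · intro b _ hb
    rw [if_neg]
    exact fun h => hb (Fin.ext h.symm)
  · simp

end

theorem det_fin_le {K : Type*} [Field K] [NumberField K] (v : NumberField.FinitePlace K) {n : Type*}
    [Fintype n] [DecidableEq n] (A : Matrix n n K) (R : n → ℝ) (hR : ∀ i, 0 ≤ R i)
    (h : ∀ i j, v (A i j) ≤ R i) : v A.det ≤ ∏ i, R i := by
  rw [← Matrix.det_transpose, Matrix.det_apply]
  refine fin_sum_le v _ _ _ (Finset.prod_nonneg fun i _ => hR i) fun σ _ => ?_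
  rw [Units.smul_def, zsmul_eq_mul, map_mul, map_prod]
  calc _ ≤ 1 * ∏ i, R i := by
        refine mul_le_mul (fin_intCast_le v _) (Finset.prod_le_prod (fun i _ => apply_nonneg v _)
          fun i _ => h _ _) (Finset.prod_nonneg fun i _ => apply_nonneg v _) zero_le_one
    _ = _ := one_mul _

theorem det_arch_le {K : Type*} [Field K] [NumberField K] (v : NumberField.InfinitePlace K)
    {n : Type*} [Fintype n] [DecidableEq n] (A : Matrix n n K) (R : n → ℝ)
    (h : ∀ i j, v (A i j) ≤ R i) : v A.det ≤ (Fintype.card n).factorial * ∏ i, R i := by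
  rw [← Matrix.det_transpose, Matrix.det_apply]
  refine (arch_sum_le v _ _).trans ?_
  rw [← Fintype.card_perm, ← nsmul_eq_mul]
  refine Finset.sum_le_card_nsmul _ _ _ fun σ _ => ?_
  rw [Units.smul_def, zsmul_eq_mul, map_mul, map_prod, arch_intCast]
  have : |(((Equiv.Perm.sign σ : ℤˣ) : ℤ) : ℝ)| = 1 := by
    rcases Int.units_eq_one_or (Equiv.Perm.sign σ) with h | h <;> simp [h]
  rw [this, one_mul]
  exact Finset.prod_le_prod (fun i _ => apply_nonneg v _) fun i _ => h _ _

end BZ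

namespace BZ

open NumberField

section
variable {E : Type*} [Field E] [NumberField E]

theorem frob_int (σ : E →ₐ[ℚ] E) {p : ℕ} (hp : p.Prime) {ζ : E} (hζi : IsIntegral ℤ ζ)
    (hζ : σ ζ = ζ ^ p) (x : E) (hx : x ∈ Algebra.adjoin ℤ {ζ}) :
    IsIntegral ℤ x ∧ ∃ r, IsIntegral ℤ r ∧ σ x = x ^ p + p * r := by
  have hpi : IsIntegral ℤ (p : E) := by
    have := isIntegral_algebraMap (R := ℤ) (A := E) (x := p); simpa using this
  induction hx using Algebra.adjoin_induction with
  | mem x hx =>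
    rw [Set.mem_singleton_iff] at hx
    subst hx
    exact ⟨hζi, 0, isIntegral_zero, by simp [hζ]⟩
  | algebraMap n =>
    refine ⟨isIntegral_algebraMap, ?_⟩
    obtain ⟨r, hr⟩ := int_pow_prime (R := ℤ) hp n
    refine ⟨-(r : E), (isIntegral_algebraMap (R := ℤ) (x := r)).neg, ?_⟩
    have : ((n : ℤ) : E) ^ p = n + p * r := by exact_mod_cast congrArg (Int.cast : ℤ → E) hr
    simp only [algebraMap_int_eq, eq_intCast, map_intCast]
    rw [this]; ring
  | add x y _ _ hx hy =>
    obtain ⟨hxi, r, hr, hxr⟩ := hx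
    obtain ⟨hyi, s, hs, hys⟩ := hy
    refine ⟨hxi.add hyi, ?_⟩
    obtain ⟨q, hq⟩ := exists_add_pow_prime_eq hp (⟨x, hxi⟩ : 𝓞 E) ⟨y, hyi⟩
    have hq' := congrArg (algebraMap (𝓞 E) E) hq
    change (x + y) ^ p = x ^ p + y ^ p + p * x * y * q at hq'
    refine ⟨r + s - x * y * q, (hr.add hs).sub ((hxi.mul hyi).mul q.2), ?_⟩
    rw [map_add, hxr, hys, hq']; ring
  | mul x y _ _ hx hy =>
    obtain ⟨hxi, r, hr, hxr⟩ := hx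
    obtain ⟨hyi, s, hs, hys⟩ := hy
    refine ⟨hxi.mul hyi, r * y ^ p + x ^ p * s + p * r * s,
      ((hr.mul (hyi.pow p)).add ((hxi.pow p).mul hs)).add ((hpi.mul hr).mul hs), ?_⟩
    rw [map_mul, hxr, hys]; ring

theorem frob_field (σ : E →ₐ[ℚ] E) {p : ℕ} (hp : p.Prime) {M : ℕ} (hM : 0 < M) {ζ : E}
    (hζM : IsPrimitiveRoot ζ M) (hζ : σ ζ = ζ ^ p) (v : FinitePlace E) (hv : v (p : E) < 1) (γ : E)
    (hγ : γ ∈ IntermediateField.adjoin ℚ {ζ}) (hγ1 : v γ ≤ 1) :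
    v (σ γ - γ ^ p) ≤ v (p : E) := by
  have hne : NeZero M := ⟨hM.ne'⟩
  have hζi : IsIntegral ℤ ζ := hζM.isIntegral hM
  let k := IntermediateField.adjoin ℚ {ζ}
  let ζk : k := ⟨ζ, IntermediateField.mem_adjoin_simple_self ℚ ζ⟩
  have hζk : IsPrimitiveRoot ζk M := by
    refine IsPrimitiveRoot.of_map_of_injective (f := algebraMap k E) ?_ (algebraMap k E).injective
    exact hζM
  have : IsCyclotomicExtension {M} ℚ k :=
    hζM.intermediateField_adjoin_isCyclotomicExtension ℚ
  have hic := IsCyclotomicExtension.Rat.isIntegralClosure_adjoin_singleton hζk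
  have hOk : ∀ y : 𝓞 k, IsIntegral ℤ ((y : k) : E) ∧
      ∃ r, IsIntegral ℤ r ∧ σ ((y : k) : E) = ((y : k) : E) ^ p + p * r := by
    intro y
    obtain ⟨z, hz⟩ := hic.isIntegral_iff.1 y.2
    refine frob_int σ hp hζi hζ _ ?_
    have h1 : (y : k) ∈ Algebra.adjoin ℤ {ζk} := by
      rw [show (y : k) = algebraMap _ k z from hz.symm]; exact z.2
    have h2 := (Subalgebra.mem_map (f := IsScalarTower.toAlgHom ℤ k E)).2 ⟨_, h1, rfl⟩
    rw [AlgHom.map_adjoin, Set.image_singleton] at h2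
    exact h2
  have hvO : ∀ y : 𝓞 k, v ((y : k) : E) ≤ 1 := fun y => fin_le_one v _ (hOk y).1
  obtain ⟨α, β, hβ, hγe⟩ := IsFractionRing.div_surjective (A := 𝓞 k) (⟨γ, hγ⟩ : k)
  have hβ0 : β ≠ 0 := nonZeroDivisors.ne_zero hβ
  have hβE : ((β : k) : E) ≠ 0 := by
    intro h; apply hβ0
    have h' : (β : k) = 0 := Subtype.ext h
    exact_mod_cast h'
  have hγE : γ * ((β : k) : E) = ((α : k) : E) := by
    have := congrArg (algebraMap k E) hγe
    rw [map_div₀, div_eq_iff (by exact hβE)] at this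
    exact this.symm
  let J : Ideal (𝓞 k) := Ideal.span {α} ⊔ Ideal.span {β}
  have hJ : J ∣ Ideal.span {β} := Ideal.dvd_iff_le.2 le_sup_right
  obtain ⟨J', hJ'⟩ := hJ
  have hβm : β ∈ J * J' := hJ' ▸ Ideal.mem_span_singleton_self β
  obtain ⟨x, hxJ, hx1⟩ : ∃ x ∈ J', v ((x : k) : E) = 1 := by
    rw [Ideal.sup_mul] at hβm
    obtain ⟨y1, hy1, y2, hy2, hy⟩ := Submodule.mem_sup.1 hβm
    obtain ⟨x1, hx1, rfl⟩ := Ideal.mem_span_singleton_mul.1 hy1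
    obtain ⟨x2, hx2, rfl⟩ := Ideal.mem_span_singleton_mul.1 hy2
    by_contra! hcon
    have l1 : v ((x1 : k) : E) < 1 := lt_of_le_of_ne (hvO _) (hcon _ hx1)
    have l2 : v ((x2 : k) : E) < 1 := lt_of_le_of_ne (hvO _) (hcon _ hx2)
    have hb : 0 < v ((β : k) : E) := lt_of_le_of_ne (apply_nonneg v _)
      fun h => hβE ((map_eq_zero v).1 h.symm)
    have he : γ * ((x1 : k) : E) * ((β : k) : E) + ((x2 : k) : E) * ((β : k) : E) =
        ((β : k) : E) := by
      have := congrArg (fun z : 𝓞 k => ((z : k) : E)) hy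
      simp only [map_add, map_mul] at this
      calc _ = ((α : k) : E) * ((x1 : k) : E) + ((β : k) : E) * ((x2 : k) : E) := by
            rw [← hγE]; ring
        _ = _ := this
    have he' : γ * ((x1 : k) : E) + ((x2 : k) : E) = 1 := by
      apply mul_right_cancel₀ hβE
      rw [add_mul, he, one_mul]
    have h3 : v (γ * ((x1 : k) : E)) < 1 := by
      rw [map_mul]
      calc _ ≤ 1 * v ((x1 : k) : E) := by gcongr
        _ < 1 := by rwa [one_mul]
    have h4 := v.add_le (γ * ((x1 : k) : E)) ((x2 : k) : E)
    rw [he', map_one] at h4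
    exact absurd h4 (not_le.2 (max_lt h3 l2))
  obtain ⟨y, hy⟩ : ∃ y : 𝓞 k, x * α = β * y := by
    have h1 : α * x ∈ J * J' := Ideal.mul_mem_mul (Ideal.mem_sup_left
      (Ideal.mem_span_singleton_self α)) hxJ
    rw [← hJ'] at h1
    obtain ⟨y, hy⟩ := Ideal.mem_span_singleton.1 h1
    exact ⟨y, by rw [← hy]; ring⟩
  have hyE : γ * ((x : k) : E) = ((y : k) : E) := by
    have := congrArg (fun z : 𝓞 k => ((z : k) : E)) hy
    simp only [map_mul] at this
    have h2 : ((x : k) : E) * ((α : k) : E) = ((β : k) : E) * ((y : k) : E) := this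
    apply mul_right_cancel₀ hβE
    rw [mul_right_comm, hγE, mul_comm, h2]; ring
  obtain ⟨hxi, r, hr, hxr⟩ := hOk x
  obtain ⟨hyi, s, hs, hys⟩ := hOk y
  set X := ((x : k) : E)
  set Y := ((y : k) : E)
  have hX0 : X ≠ 0 := by intro h; rw [h, map_zero] at hx1; exact zero_ne_one hx1
  have hsX0 : σ X ≠ 0 := by rwa [Ne, map_eq_zero]
  have hsX : v (σ X) = 1 := by
    refine le_antisymm (fin_le_one v _ (hxi.map (σ.restrictScalars ℤ))) ?_
    have h5 : X ^ p = σ X + -(p * r) := by rw [hxr]; ring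
    have h6 := v.add_le (σ X) (-(p * r))
    rw [← h5, map_pow, hx1, one_pow] at h6
    by_contra! h7
    refine absurd h6 (not_le.2 (max_lt h7 ?_))
    rw [← v.norm_embedding_eq, map_neg, norm_neg, v.norm_embedding_eq, map_mul]
    calc _ ≤ v (p : E) * 1 := by gcongr; exact fin_le_one v _ hr
      _ < 1 := by rwa [mul_one]
  have hγY : γ = Y / X := by rw [← hyE]; field_simp
  have hfin : (σ γ - γ ^ p) = p * ((s * X ^ p - Y ^ p * r) / (σ X * X ^ p)) := by
    rw [hγY, map_div₀, hys]
    have h9 : X ^ p + p * r ≠ 0 := hxr ▸ hsX0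
    rw [hxr, div_pow, mul_div_assoc', div_sub_div _ _ h9 (pow_ne_zero p hX0)]
    congr 1
    ring
  rw [hfin, map_mul, map_div₀, map_mul, map_pow, hsX, hx1, one_pow, mul_one, div_one]
  calc _ ≤ v (p : E) * 1 := by
        gcongr
        exact fin_le_one v _ ((hs.mul (hxi.pow p)).sub ((hyi.pow p).mul hr))
    _ = _ := mul_one _

end

end BZ

namespace BZ

open NumberField Polynomial

section
variable {E : Type*} [Field E] [NumberField E]

theorem fin_sub_le (v : FinitePlace E) {x y : E} {B : ℝ} (hx : v x ≤ B) (hy : v y ≤ B) :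
    v (x - y) ≤ B := by
  have h := v.add_le x (-y)
  have hn : v (-y) = v y := by
    rw [← v.norm_embedding_eq, map_neg, norm_neg, v.norm_embedding_eq]
  rw [← sub_eq_add_neg, hn] at h
  exact h.trans (max_le hx hy)

/-- The valuation ring of a finite place. -/
def finRing (v : FinitePlace E) : Subring E where
  carrier := {x | v x ≤ 1}
  mul_mem' {x y} hx hy := by
    change v (x * y) ≤ 1
    rw [map_mul]; exact mul_le_one₀ hx (apply_nonneg v _) hy
  one_mem' := by simp
  add_mem' {x y} hx hy := (v.add_le x y).trans (max_le hx hy)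
  zero_mem' := by simp
  neg_mem' {x} hx := by
    have := fin_sub_le v (x := 0) (y := x) (B := 1) (by simp) hx
    simpa using this

theorem coeff_prod_le {ι : Type*} (v : FinitePlace E) (s : Finset ι) (x : ι → E) (j : ℕ) :
    v ((∏ i ∈ s, (X - C (x i))).coeff j) ≤ ∏ i ∈ s, max 1 (v (x i)) := by
  classical
  induction s using Finset.induction_on generalizing j with
  | empty =>
    rw [Finset.prod_empty, Finset.prod_empty, coeff_one]
    split_ifs <;> simp
  | insert a s ha ih =>
    have hP : 0 ≤ ∏ i ∈ s, max 1 (v (x i)) :=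
      Finset.prod_nonneg fun i _ => zero_le_one.trans (le_max_left _ _)
    rw [Finset.prod_insert ha, Finset.prod_insert ha, sub_mul, coeff_sub, coeff_C_mul]
    refine fin_sub_le v ?_ ?_
    · cases j with
      | zero => rw [mul_coeff_zero]; simp; positivity
      | succ j =>
        rw [coeff_X_mul]
        exact (ih j).trans (le_mul_of_one_le_left hP (le_max_left _ _))
    · rw [map_mul]
      exact mul_le_mul (le_max_right _ _) (ih j) (apply_nonneg v _)
        (zero_le_one.trans (le_max_left _ _))

theorem key_nonarch (σ : E →ₐ[ℚ] E) {p : ℕ} (hp : p.Prime) {M : ℕ} (hM : 0 < M) {ζ : E}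
    (hζM : IsPrimitiveRoot ζ M) (hζ : σ ζ = ζ ^ p) (v : FinitePlace E) (g : E[X]) (D : ℕ)
    (hD : g.natDegree ≤ D) (hg0 : g ≠ 0) (hgk : ∀ j, g.coeff j ∈ IntermediateField.adjoin ℚ {ζ})
    (B : ℝ) (hB : ∀ j, v (σ (g.coeff j)) ≤ B) (η : E) (hη : g.eval η = 0) :
    v ((g.map (σ : E →+* E)).eval (η ^ p)) ≤ v (p : E) * B * max 1 (v η) ^ (p * D) := by
  have hB0 : 0 ≤ B := (apply_nonneg v _).trans (hB 0)
  have hm1 : 1 ≤ max 1 (v η) := le_max_left _ _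
  have hm0 : 0 ≤ max 1 (v η) := zero_le_one.trans hm1
  have hpow : ∀ j, j ≤ D → v η ^ j ≤ max 1 (v η) ^ D := fun j hj =>
    (pow_le_pow_left₀ (apply_nonneg v _) (le_max_right _ _) j).trans (pow_le_pow_right₀ hm1 hj)
  have heval : (g.map (σ : E →+* E)).eval (η ^ p) =
      ∑ j ∈ Finset.range (D + 1), σ (g.coeff j) * (η ^ j) ^ p := by
    rw [eval_eq_sum_range' (n := D + 1) (by
      exact (natDegree_map_le).trans_lt (Nat.lt_succ_of_le hD))]
    refine Finset.sum_congr rfl fun j _ => ?_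
    rw [coeff_map, ← pow_mul, ← pow_mul, mul_comm j p]; rfl
  have hp1 : v (p : E) ≤ 1 := by simpa using fin_intCast_le v (p : ℤ)
  rcases hp1.eq_or_lt with h1 | h1
  · rw [h1, one_mul, heval]
    refine fin_sum_le v _ _ _ (by positivity) fun j hj => ?_
    rw [map_mul, map_pow, map_pow]
    refine mul_le_mul (hB j) ?_ (by have := apply_nonneg v η; positivity) hB0
    rw [mul_comm p D, pow_mul]
    exact pow_le_pow_left₀ (by have := apply_nonneg v η; positivity)
      (hpow j (Nat.lt_succ_iff.1 (Finset.mem_range.1 hj))) _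
  obtain ⟨j0, hj0, hmax⟩ := (Finset.range (D + 1)).exists_max_image (fun j => v (g.coeff j))
    ⟨0, by simp⟩
  have hγ0 : g.coeff j0 ≠ 0 := by
    intro h
    apply hg0
    ext j
    rcases lt_or_ge j (D + 1) with hj | hj
    · have := hmax j (Finset.mem_range.2 hj)
      rw [h, map_zero] at this
      simpa using le_antisymm this (apply_nonneg v _)
    · rw [coeff_eq_zero_of_natDegree_lt (by omega), coeff_zero]
  set γ0 := g.coeff j0 with hγ0def
  have hvγ0 : 0 < v γ0 := lt_of_le_of_ne (apply_nonneg v _) fun h => hγ0 ((map_eq_zero v).1 h.symm)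
  let γ : ℕ → E := fun j => g.coeff j / γ0
  have hγk : ∀ j, γ j ∈ IntermediateField.adjoin ℚ {ζ} := fun j => div_mem (hgk j) (hgk j0)
  have hγ1 : ∀ j ∈ Finset.range (D + 1), v (γ j) ≤ 1 := fun j hj => by
    simp only [γ]
    rw [map_div₀, div_le_one hvγ0]; exact hmax j hj
  obtain ⟨κ, hκ⟩ : ∃ κ : E, v κ = max 1 (v η) ^ D := by
    rcases le_total 1 (v η) with h | h
    · exact ⟨η ^ D, by rw [map_pow, max_eq_right h]⟩
    · exact ⟨1, by rw [map_one, max_eq_left h, one_pow]⟩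
  have hvκ : 0 < v κ := by rw [hκ]; positivity
  have hκ0 : κ ≠ 0 := by intro h; rw [h, map_zero] at hvκ; exact lt_irrefl _ hvκ
  have hηκ : ∀ j ∈ Finset.range (D + 1), v (η ^ j / κ) ≤ 1 := fun j hj => by
    rw [map_div₀, div_le_one hvκ, hκ, map_pow]
    exact hpow j (Nat.lt_succ_iff.1 (Finset.mem_range.1 hj))
  have hx1 : ∀ j ∈ Finset.range (D + 1), v (γ j * (η ^ j / κ)) ≤ 1 := fun j hj => by
    rw [map_mul]; exact mul_le_one₀ (hγ1 j hj) (apply_nonneg v _) (hηκ j hj)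
  have hsum0 : ∑ j ∈ Finset.range (D + 1), γ j * (η ^ j / κ) = 0 := by
    have : ∑ j ∈ Finset.range (D + 1), γ j * (η ^ j / κ) = g.eval η / (γ0 * κ) := by
      rw [eval_eq_sum_range' (n := D + 1) (Nat.lt_succ_of_le hD), Finset.sum_div]
      refine Finset.sum_congr rfl fun j _ => ?_
      simp only [γ]; field_simp
    rw [this, hη, zero_div]
  have hpsum : v (∑ j ∈ Finset.range (D + 1), (γ j * (η ^ j / κ)) ^ p) ≤ v (p : E) := by
    obtain ⟨r, hr⟩ := sum_pow_prime (R := finRing v) hp (Finset.range (D + 1)).attach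
      (fun j => ⟨γ j * (η ^ (j : ℕ) / κ), hx1 j j.2⟩)
    have hr' := congrArg (finRing v).subtype hr
    simp only [map_pow, map_sum, map_add, map_mul, map_natCast, Subring.subtype_apply] at hr'
    rw [Finset.sum_attach _ (fun j => γ j * (η ^ j / κ)), hsum0, zero_pow hp.ne_zero,
      Finset.sum_attach _ (fun j => (γ j * (η ^ j / κ)) ^ p)] at hr'
    have h2 : ∑ j ∈ Finset.range (D + 1), (γ j * (η ^ j / κ)) ^ p = 0 - p * (r : E) := by
      rw [hr']; ring
    rw [h2]
    refine fin_sub_le v (by simp) ?_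
    rw [map_mul]
    exact mul_le_of_le_one_right (apply_nonneg v _) r.2
  have hfsum : v (∑ j ∈ Finset.range (D + 1), (σ (γ j) - γ j ^ p) * (η ^ j / κ) ^ p) ≤ v (p : E) := by
    refine fin_sum_le v _ _ _ (apply_nonneg v _) fun j hj => ?_
    rw [map_mul, map_pow]
    calc _ ≤ v (p : E) * 1 := mul_le_mul (frob_field σ hp hM hζM hζ v h1 _ (hγk j) (hγ1 j hj))
          (pow_le_one₀ (apply_nonneg v _) (hηκ j hj)) (by
            have := apply_nonneg v (η ^ j / κ); positivity) (apply_nonneg v _)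
      _ = _ := mul_one _
  have hσγ0 : σ γ0 ≠ 0 := by rwa [Ne, map_eq_zero]
  have htot : (g.map (σ : E →+* E)).eval (η ^ p) = σ γ0 * κ ^ p *
      (∑ j ∈ Finset.range (D + 1), (σ (γ j) - γ j ^ p) * (η ^ j / κ) ^ p +
        ∑ j ∈ Finset.range (D + 1), (γ j * (η ^ j / κ)) ^ p) := by
    rw [heval, ← Finset.sum_add_distrib, Finset.mul_sum]
    refine Finset.sum_congr rfl fun j _ => ?_
    simp only [γ]
    rw [mul_pow, ← add_mul, sub_add_cancel, map_div₀, div_pow]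
    have hκp : κ ^ p ≠ 0 := pow_ne_zero p hκ0
    field_simp
  rw [htot, map_mul, map_mul, map_pow, hκ]
  calc v (σ γ0) * (max 1 (v η) ^ D) ^ p * _ ≤ B * (max 1 (v η) ^ D) ^ p * v (p : E) :=
        mul_le_mul (mul_le_mul_of_nonneg_right (hB j0) (by positivity))
          ((v.add_le _ _).trans (max_le hfsum hpsum)) (apply_nonneg v _) (by positivity)
    _ = _ := by rw [← pow_mul, mul_comm D p]; ring

end

end BZ

namespace BZ

open NumberField Polynomial Height Module

section
variable {E : Type*} [Field E] [NumberField E]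

theorem pow_conj_torsion {ξ : E} (hξ : ξ ≠ 0) (g g' : E ≃ₐ[ℚ] E) {p q : ℕ} (hp : 0 < p) (hq : 0 < q)
    (hpq : p ≠ q) (h : (g ξ) ^ p = (g' ξ) ^ q) : ∃ n, 0 < n ∧ ξ ^ n = 1 := by
  let ρ : E ≃ₐ[ℚ] E := g⁻¹ * g'
  have h1 : ξ ^ p = (ρ ξ) ^ q := by
    have := congrArg (g⁻¹ : E ≃ₐ[ℚ] E) h
    rw [map_pow, map_pow] at this
    rw [← AlgEquiv.mul_apply, inv_mul_cancel, AlgEquiv.one_apply] at this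
    exact this
  have h2 : ∀ r : ℕ, ξ ^ (p ^ r) = ((ρ ^ r) ξ) ^ (q ^ r) := by
    intro r
    induction r with
    | zero => simp
    | succ r ih =>
      rw [pow_succ, pow_mul, ih, ← pow_mul, mul_comm, pow_mul, ← map_pow, h1, map_pow,
        ← AlgEquiv.mul_apply, ← pow_succ, ← pow_mul]
      congr 1
      ring
  have h3 := h2 (Nat.card (E ≃ₐ[ℚ] E))
  rw [pow_card_eq_one'] at h3
  have hc : Nat.card (E ≃ₐ[ℚ] E) ≠ 0 := Nat.card_pos.ne'
  rw [AlgEquiv.one_apply] at h3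
  have aux : ∀ m n : ℕ, m < n → ξ ^ m = ξ ^ n → ∃ n, 0 < n ∧ ξ ^ n = 1 := by
    intro m n hmn h
    refine ⟨n - m, by omega, ?_⟩
    apply mul_left_cancel₀ (pow_ne_zero m hξ)
    rw [← pow_add, mul_one, h]; congr 1; omega
  rcases lt_or_gt_of_ne hpq with h4 | h4
  · exact aux _ _ (Nat.pow_lt_pow_left h4 hc) h3
  · exact aux _ _ (Nat.pow_lt_pow_left h4 hc) h3.symm

theorem mem_adjoin_of_fixed [IsGalois ℚ E] {ζ c : E} (h : ∀ τ : E ≃ₐ[ℚ] E, τ ζ = ζ → τ c = c) :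
    c ∈ IntermediateField.adjoin ℚ {ζ} := by
  rw [← IsGalois.fixedField_fixingSubgroup (IntermediateField.adjoin ℚ {ζ}),
    IntermediateField.mem_fixedField_iff]
  intro τ hτ
  refine h τ ?_
  rw [IntermediateField.mem_fixingSubgroup_iff] at hτ
  exact hτ ζ (IntermediateField.mem_adjoin_simple_self ℚ ζ)

theorem exists_frob [IsGalois ℚ E] {M : ℕ} (hM : 0 < M) {ζ : E} (hζ : IsPrimitiveRoot ζ M) {p : ℕ}
    (hp : p.Coprime M) : ∃ σ : E ≃ₐ[ℚ] E, σ ζ = ζ ^ p := by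
  have h1 := minpoly ℚ ζ
  have hc : IsConjRoot ℚ (ζ ^ p) ζ := by
    rw [IsConjRoot, ← Polynomial.cyclotomic_eq_minpoly_rat hζ hM,
      ← Polynomial.cyclotomic_eq_minpoly_rat (hζ.pow_of_coprime p hp) hM]
  obtain ⟨σ, hσ⟩ := isConjRoot_iff_exists_algEquiv.1 hc
  exact ⟨σ, hσ⟩

open Classical in
/-- The orbit of `ξ` under the Galois group relative to the field generated by `ζ`. -/
noncomputable def orb (ζ ξ : E) : Finset E :=
  (Finset.univ.filter fun τ : E ≃ₐ[ℚ] E => τ ζ = ζ).image fun τ => τ ξ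

theorem mem_orb {ζ ξ x : E} : x ∈ orb ζ ξ ↔ ∃ τ : E ≃ₐ[ℚ] E, τ ζ = ζ ∧ τ ξ = x := by
  simp [orb]

theorem orb_poly_fixed (ζ ξ : E) (τ : E ≃ₐ[ℚ] E) (hτ : τ ζ = ζ) :
    (∏ x ∈ orb ζ ξ, (X - C x)).map (τ : E →+* E) = ∏ x ∈ orb ζ ξ, (X - C x) := by
  rw [Polynomial.map_prod]
  simp only [Polynomial.map_sub, map_X, map_C]
  refine Finset.prod_bij (fun x _ => τ x) ?_ ?_ ?_ ?_
  · intro x hx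
    obtain ⟨ρ, hρ, rfl⟩ := mem_orb.1 hx
    exact mem_orb.2 ⟨τ * ρ, by rw [AlgEquiv.mul_apply, hρ, hτ], rfl⟩
  · intro x _ y _ h; exact τ.injective h
  · intro x hx
    obtain ⟨ρ, hρ, rfl⟩ := mem_orb.1 hx
    refine ⟨τ⁻¹ (ρ ξ), mem_orb.2 ⟨τ⁻¹ * ρ, ?_, rfl⟩, ?_⟩
    · rw [AlgEquiv.mul_apply, hρ]
      conv_lhs => rw [← hτ]
      rw [← AlgEquiv.mul_apply, inv_mul_cancel, AlgEquiv.one_apply]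
    · rw [← AlgEquiv.mul_apply, mul_inv_cancel, AlgEquiv.one_apply]
  · intro x _; rfl

theorem conj_fixes {M : ℕ} (hM : 0 < M) {ζ : E} (hζ : IsPrimitiveRoot ζ M) (σ τ : E ≃ₐ[ℚ] E)
    (hτ : τ ζ = ζ) : τ (σ.symm ζ) = σ.symm ζ := by
  have : NeZero M := ⟨hM.ne'⟩
  obtain ⟨i, _, hi⟩ := hζ.eq_pow_of_pow_eq_one (ξ := σ.symm ζ) (by
    rw [← map_pow, hζ.pow_eq_one, map_one])
  rw [← hi, map_pow, hτ]

end

end BZ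

namespace BZ

open NumberField Polynomial Height Module

section
variable {E : Type*} [Field E] [NumberField E]

theorem dob_core [IsGalois ℚ E] {M : ℕ} (hM : 0 < M) {ζ ξ : E} (hζ : IsPrimitiveRoot ζ M)
    (hξ : ξ ≠ 0) (hntor : ∀ n, 0 < n → ξ ^ n ≠ 1) (S : Finset ℕ)
    (hS : ∀ p ∈ S, p.Prime ∧ p.Coprime M ∧
      ∀ τ : E ≃ₐ[ℚ] E, τ ζ = ζ → (τ ξ) ^ p = ξ ^ p → τ ξ = ξ)
    (T : ℕ) (ε : ℝ) (hε : ∀ σ : E ≃ₐ[ℚ] E, logHeight₁ (σ ξ) ≤ finrank ℚ E * ε)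
    (N : ℕ) (hN : N = (orb ζ ξ).card * (T + S.card)) :
    T * ∑ p ∈ S, Real.log p ≤ (T + S.card + T ^ 2) * Real.log N + N * (T + ∑ p ∈ S, (p : ℝ)) * ε := by
  classical
  set O := orb ζ ξ with hO
  have hOpos : 0 < O.card := Finset.card_pos.2 ⟨ξ, mem_orb.2 ⟨1, rfl, rfl⟩⟩
  have hfrob : ∀ p : {p // p ∈ S}, ∃ σ : E ≃ₐ[ℚ] E, σ ζ = ζ ^ (p : ℕ) := fun p =>
    exists_frob hM hζ (hS p p.2).2.1
  choose σ hσ using hfrob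
  let KT := {p // p ∈ S} × {x // x ∈ O}
  let OT := {x // x ∈ O}
  let f : E[X] := ∏ x ∈ O, (X - C x)
  have hfmon : f.Monic := monic_prod_of_monic _ _ fun x _ => monic_X_sub_C x
  have hfdeg : f.natDegree = O.card := by
    simp only [f]
    rw [natDegree_prod_of_monic _ _ fun x _ => monic_X_sub_C x]; simp
  let η : KT → E := fun k => (σ k.1).symm k.2
  let β : KT → E := fun k => η k ^ (k.1 : ℕ)
  have horb : ∀ k : KT, ∃ τ : E ≃ₐ[ℚ] E, τ ζ = ζ ∧ η k = ((σ k.1)⁻¹ * τ) ξ := by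
    intro k
    obtain ⟨τ, hτ, h⟩ := mem_orb.1 k.2.2
    refine ⟨τ, hτ, ?_⟩
    simp only [η]; rw [← h]; rfl
  have hprime : ∀ p : {p // p ∈ S}, (p : ℕ).Prime := fun p => (hS p p.2).1
  have hβinj : Function.Injective β := by
    intro k k' h
    obtain ⟨τ, hτ, hk⟩ := horb k
    obtain ⟨τ', hτ', hk'⟩ := horb k'
    simp only [β] at h
    have hp : k.1 = k'.1 := by
      by_contra hne
      rw [hk, hk'] at h
      obtain ⟨n, hn, hn'⟩ := pow_conj_torsion hξ _ _ (hprime _).pos (hprime _).pos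
        (fun h => hne (Subtype.ext h)) h
      exact hntor n hn hn'
    refine Prod.ext hp (Subtype.ext ?_)
    rw [← hp] at h
    have h2 : (k.2 : E) ^ (k.1 : ℕ) = (k'.2 : E) ^ (k.1 : ℕ) := by
      have := congrArg (σ k.1) h
      simp only [η, map_pow, ← hp, AlgEquiv.apply_symm_apply] at this
      exact this
    obtain ⟨τ, hτ, hk⟩ := mem_orb.1 k.2.2
    obtain ⟨τ', hτ', hk'⟩ := mem_orb.1 k'.2.2
    rw [← hk, ← hk'] at h2 ⊢
    have h3 := congrArg (τ⁻¹ : E ≃ₐ[ℚ] E) h2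
    rw [map_pow, map_pow, ← AlgEquiv.mul_apply, ← AlgEquiv.mul_apply, inv_mul_cancel,
      AlgEquiv.one_apply] at h3
    have h4 := (hS k.1 k.1.2).2.2 (τ⁻¹ * τ') (by
      rw [AlgEquiv.mul_apply, hτ']
      conv_lhs => rw [← hτ]
      rw [← AlgEquiv.mul_apply, inv_mul_cancel, AlgEquiv.one_apply]) h3.symm
    have h5 := congrArg τ h4
    rw [← AlgEquiv.mul_apply, mul_inv_cancel_left] at h5
    exact h5.symm
  have hfβ : ∀ k, f.eval (β k) ≠ 0 := by
    intro k h
    simp only [f] at h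
    rw [eval_prod, Finset.prod_eq_zero_iff] at h
    obtain ⟨x, hx, hx0⟩ := h
    rw [eval_sub, eval_X, eval_C, sub_eq_zero] at hx0
    obtain ⟨τ', hτ', rfl⟩ := mem_orb.1 hx
    obtain ⟨τ, hτ, hk⟩ := horb k
    simp only [β] at hx0
    rw [hk, ← pow_one (τ' ξ)] at hx0
    obtain ⟨n, hn, hn'⟩ := pow_conj_torsion hξ _ _ (hprime _).pos one_pos (hprime k.1).ne_one hx0
    exact hntor n hn hn'
  let a := O.card * T
  let b := S.card * O.card
  have hab : a + b = N := by simp only [a, b, hN]; ring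
  have hcardOT : Fintype.card OT = O.card := Fintype.card_coe O
  have hcardKT : Fintype.card KT = b := by simp [KT, b]
  let e1 : Fin a ≃ OT × Fin T := (Fintype.equivFinOfCardEq (by simp [a, OT])).symm
  let e2 : Fin b ≃ KT := (Fintype.equivFinOfCardEq hcardKT).symm
  let lam : Fin a → E[X] →ₗ[E] E := fun r => leval ((e1 r).1 : E) ∘ₗ hasseDeriv ((e1 r).2 : ℕ)
  let mu : Fin b → E[X] →ₗ[E] E := fun r => leval (β (e2 r))
  let W : Matrix (Fin a ⊕ Fin b) (Fin a ⊕ Fin b) E :=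
    Matrix.of fun r c => (Sum.elim lam mu r) (X ^ (finSumFinEquiv c : ℕ))
  have hlam : ∀ r (l : ℕ), lam r (X ^ l) =
      (l.choose (e1 r).2 : E) * ((e1 r).1 : E) ^ (l - (e1 r).2) := fun r l =>
    eval_hasseDeriv_X_pow _ _ _
  have hmu : ∀ r (l : ℕ), mu r (X ^ l) = β (e2 r) ^ l := fun r l => by simp [mu, leval]
  let B1 : Matrix (Fin a) (Fin a) E := Matrix.of fun r c => lam r (X ^ (c : ℕ))
  let B2 : Matrix (Fin b) (Fin b) E := Matrix.vandermonde fun r => β (e2 r)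
  have hdet : W.det = B1.det * ((∏ r, f.eval (β (e2 r)) ^ T) * B2.det) := by
    have h1 := det_functional a b lam mu (f ^ T) (hfmon.pow T) (by
      rw [hfmon.natDegree_pow, hfdeg, mul_comm]) (fun r l => by
        refine dvd_hasseDeriv_zero _ _ T ?_ _ (e1 r).2.2
        refine Dvd.dvd.mul_right (pow_dvd_pow_of_dvd ?_ T) _
        exact Finset.dvd_prod_of_mem (fun x => X - C x) (e1 r).1.2)
    rw [h1, ← Matrix.det_mul_column]
    congr 2
    ext r c
    simp [mu, leval, Matrix.vandermonde, B2]
  have hV0 : W.det ≠ 0 := by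
    rw [hdet]
    refine mul_ne_zero ?_ (mul_ne_zero (Finset.prod_ne_zero_iff.2 fun r _ =>
      pow_ne_zero _ (hfβ _)) ?_)
    · exact confluent_ne_zero (fun x : OT => (x : E)) Subtype.val_injective T a e1
    · rw [Matrix.det_vandermonde_ne_zero_iff]
      exact hβinj.comp e2.injective
  let y : OT ⊕ KT → E := Sum.elim (fun x => (x : E)) η
  let nn : OT ⊕ KT → ℤ := Sum.elim (fun _ => ((T * N : ℕ) : ℤ)) (fun k => (((k.1 : ℕ) * N : ℕ) : ℤ))
  let z : ℕ := ∏ p : {p // p ∈ S}, (p : ℕ) ^ (T * O.card)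
  have hz : z ≠ 0 := Finset.prod_ne_zero_iff.2 fun p _ => pow_ne_zero _ (hprime p).ne_zero
  have hm : ∀ t : ℝ, 0 ≤ max 1 t := fun t => zero_le_one.trans (le_max_left _ _)
  have hCpos : 0 < N.factorial * (N ^ T) ^ a := by
    rcases Nat.eq_zero_or_pos T with rfl | hT
    · simp [Nat.factorial_pos]
    · have : 0 < N := by rw [hN]; exact Nat.mul_pos hOpos (by omega)
      positivity
  have hprod : ∀ t : E → ℝ, ∏ i, max 1 (t (y i)) ^ nn i =
      (∏ x : OT, max 1 (t (x : E)) ^ (T * N)) * ∏ k : KT, max 1 (t (η k)) ^ ((k.1 : ℕ) * N) := by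
    intro t
    rw [Fintype.prod_sum_type]
    simp only [y, nn, Sum.elim_inl, Sum.elim_inr, zpow_natCast]
  have hpf := product_formula_ineq hV0 z hz ((N.factorial * (N ^ T) ^ a : ℕ) : ℝ) (by exact_mod_cast hCpos)
    Finset.univ y nn ?_ ?_
  · have hNpos : O.card * (T + S.card) = 0 ∨ 0 < N := by omega
    rcases hNpos with h0 | hNpos
    · have hTS : T + S.card = 0 := by
        rcases Nat.mul_eq_zero.1 h0 with h | h
        · omega
        · exact h
      have hT0 : T = 0 := by omega
      have hS0 : S = ∅ := Finset.card_eq_zero.1 (by omega)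
      have : N = 0 := by rw [hN, hTS, mul_zero]
      simp [hT0, hS0, this]
    have hd : (0 : ℝ) < finrank ℚ E := by exact_mod_cast finrank_pos
    have hD : (0 : ℝ) < O.card := by exact_mod_cast hOpos
    have hlz : Real.log z = T * O.card * ∑ p ∈ S, Real.log p := by
      simp only [z]
      rw [Nat.cast_prod, Real.log_prod fun p _ => by
        exact_mod_cast pow_ne_zero _ (hprime p).ne_zero, ← Finset.sum_coe_sort S, Finset.mul_sum]
      refine Finset.sum_congr rfl fun p _ => ?_
      rw [Nat.cast_pow, Real.log_pow]; push_cast; ring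
    have hsum : ∑ i, (nn i : ℝ) * logHeight₁ (y i) ≤
        O.card * (N * (T + ∑ p ∈ S, (p : ℝ)) * (finrank ℚ E * ε)) := by
      rw [Fintype.sum_sum_type]
      simp only [nn, y, Sum.elim_inl, Sum.elim_inr]
      have h1 : ∀ x : OT, (((T * N : ℕ) : ℤ) : ℝ) * logHeight₁ (x : E) ≤
          (T * N : ℕ) * (finrank ℚ E * ε) := by
        intro x
        obtain ⟨τ, hτ, h⟩ := mem_orb.1 x.2
        rw [Int.cast_natCast, ← h]
        exact mul_le_mul_of_nonneg_left (hε τ) (Nat.cast_nonneg _)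
      have h2 : ∀ k : KT, ((((k.1 : ℕ) * N : ℕ) : ℤ) : ℝ) * logHeight₁ (η k) ≤
          ((k.1 : ℕ) : ℝ) * (N * (finrank ℚ E * ε)) := by
        intro k
        obtain ⟨τ, hτ, h⟩ := horb k
        rw [Int.cast_natCast, h]
        refine (mul_le_mul_of_nonneg_left (hε _) (Nat.cast_nonneg _)).trans (le_of_eq ?_)
        push_cast; ring
      refine (add_le_add (Finset.sum_le_sum fun x _ => h1 x)
        (Finset.sum_le_sum fun k _ => h2 k)).trans (le_of_eq ?_)
      rw [Finset.sum_const, Finset.card_univ, hcardOT, Fintype.sum_prod_type]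
      simp only [Finset.sum_const, Finset.card_univ]
      rw [hcardOT, ← Finset.smul_sum, ← Finset.sum_mul, Finset.sum_coe_sort S (fun p => (p : ℝ))]
      simp only [nsmul_eq_mul]
      push_cast
      ring
    have hlC : Real.log ((N.factorial * (N ^ T) ^ a : ℕ) : ℝ) ≤
        O.card * ((T + S.card + T ^ 2) * Real.log N) := by
      have h1 : Real.log ((N.factorial * (N ^ T) ^ a : ℕ) : ℝ) ≤
          Real.log ((N ^ N * (N ^ T) ^ a : ℕ) : ℝ) := by
        refine Real.log_le_log (by exact_mod_cast hCpos) ?_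
        exact_mod_cast Nat.mul_le_mul_right _ (Nat.factorial_le_pow N)
      refine h1.trans (le_of_eq ?_)
      rw [← pow_mul, ← pow_add, Nat.cast_pow, Real.log_pow, ← mul_assoc, ← mul_assoc]
      have h2 : ((N + T * O.card * T : ℕ) : ℝ) = O.card * (T + S.card + T ^ 2) := by
        rw [hN]
        push_cast
        ring
      rw [h2]
    rw [hlz] at hpf
    have hfin : (finrank ℚ E * O.card : ℝ) * (T * ∑ p ∈ S, Real.log p) ≤
        (finrank ℚ E * O.card : ℝ) * ((T + S.card + T ^ 2) * Real.log N +
          N * (T + ∑ p ∈ S, (p : ℝ)) * ε) := by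
      have h3 := mul_le_mul_of_nonneg_left hlC hd.le
      calc _ = finrank ℚ E * (T * O.card * ∑ p ∈ S, Real.log p) := by ring
        _ ≤ _ := hpf
        _ ≤ _ := add_le_add h3 hsum
        _ = _ := by ring
    exact le_of_mul_le_mul_left hfin (by positivity)
  · intro v
    rw [hprod]
    let R : Fin a ⊕ Fin b → ℝ := Sum.elim (fun r => N ^ T * max 1 (v ((e1 r).1 : E)) ^ N)
      (fun r => max 1 (v (η (e2 r))) ^ (((e2 r).1 : ℕ) * N))
    have h1 := det_arch_le v W R ?_
    · rw [Fintype.card_sum, Fintype.card_fin, Fintype.card_fin, hab, Fintype.prod_sum_type] at h1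
      refine h1.trans (le_of_eq ?_)
      simp only [R, Sum.elim_inl, Sum.elim_inr]
      rw [e1.prod_comp (fun w => (N : ℝ) ^ T * max 1 (v (w.1 : E)) ^ N),
        e2.prod_comp (fun k => max 1 (v (η k)) ^ ((k.1 : ℕ) * N)), Finset.prod_mul_distrib,
        Finset.prod_const, Finset.card_univ, ← Fintype.card_congr e1, Fintype.card_fin,
        Fintype.prod_prod_type (f := fun w : OT × Fin T => max 1 (v (w.1 : E)) ^ N)]
      simp only [Finset.prod_const, Finset.card_univ, Fintype.card_fin, ← pow_mul, mul_comm N T]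
      push_cast
      ring
    · rintro (r | r) c
      · have hc : (finSumFinEquiv c : ℕ) < N := hab ▸ (finSumFinEquiv c).2
        simp only [W, R, Matrix.of_apply, Sum.elim_inl]
        rw [hlam, map_mul, map_pow, arch_natCast]
        refine mul_le_mul ?_ ?_ (by have := apply_nonneg v ((e1 r).1 : E); positivity) (by positivity)
        · have hN1 : 1 ≤ N := by omega
          exact_mod_cast (Nat.choose_le_pow _ _).trans ((Nat.pow_le_pow_left hc.le _).trans
            (Nat.pow_le_pow_right hN1 (e1 r).2.2.le))
        · exact (pow_le_pow_left₀ (apply_nonneg v _) (le_max_right _ _) _).trans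
            (pow_le_pow_right₀ (le_max_left _ _) (by omega))
      · have hc : (finSumFinEquiv c : ℕ) < N := hab ▸ (finSumFinEquiv c).2
        simp only [W, R, Matrix.of_apply, Sum.elim_inr]
        rw [hmu, map_pow]
        simp only [β]
        rw [map_pow, ← pow_mul]
        exact (pow_le_pow_left₀ (apply_nonneg v _) (le_max_right _ _) _).trans
            (pow_le_pow_right₀ (le_max_left _ _) (Nat.mul_le_mul_left _ hc.le))
  · intro v
    rw [hprod, hdet, map_mul, map_mul, map_prod]
    have hB : 0 ≤ ∏ x ∈ O, max 1 (v x) := Finset.prod_nonneg fun x _ => hm _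
    have b1 : v B1.det ≤ ∏ x : OT, max 1 (v (x : E)) ^ (T * a) := by
      refine (det_fin_le v B1 (fun r => max 1 (v ((e1 r).1 : E)) ^ a) (fun r => pow_nonneg (hm _) _)
        fun r c => ?_).trans (le_of_eq ?_)
      · simp only [B1, Matrix.of_apply]
        rw [hlam, map_mul, map_pow]
        calc _ ≤ 1 * max 1 (v ((e1 r).1 : E)) ^ a := by
              have hch : v (((c : ℕ).choose (e1 r).2 : ℕ) : E) ≤ 1 := by
                have := fin_intCast_le v (((c : ℕ).choose (e1 r).2 : ℕ) : ℤ)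
                rwa [Int.cast_natCast] at this
              refine mul_le_mul hch ?_
                (by have := apply_nonneg v ((e1 r).1 : E); positivity) zero_le_one
              exact (pow_le_pow_left₀ (apply_nonneg v _) (le_max_right _ _) _).trans
                (pow_le_pow_right₀ (le_max_left _ _) (by omega))
          _ = _ := one_mul _
      · rw [e1.prod_comp (fun w => max 1 (v (w.1 : E)) ^ a), Fintype.prod_prod_type]
        simp only [Finset.prod_const, Finset.card_univ, Fintype.card_fin, ← pow_mul, mul_comm a T]
    have b2 : v B2.det ≤ ∏ k : KT, max 1 (v (η k)) ^ ((k.1 : ℕ) * b) := by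
      refine (det_fin_le v B2 (fun r => max 1 (v (η (e2 r))) ^ (((e2 r).1 : ℕ) * b))
        (fun r => pow_nonneg (hm _) _) fun r c => ?_).trans (le_of_eq ?_)
      · simp only [B2, Matrix.vandermonde_apply, β]
        rw [map_pow, map_pow, ← pow_mul]
        exact (pow_le_pow_left₀ (apply_nonneg v _) (le_max_right _ _) _).trans
                (pow_le_pow_right₀ (le_max_left _ _) (Nat.mul_le_mul_left _ c.2.le))
      · exact e2.prod_comp (fun k => max 1 (v (η k)) ^ ((k.1 : ℕ) * b))
    have b3 : ∀ k : KT, v (f.eval (β k)) ≤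
        v ((k.1 : ℕ) : E) * (∏ x ∈ O, max 1 (v x)) * max 1 (v (η k)) ^ ((k.1 : ℕ) * O.card) := by
      intro k
      let s := (σ k.1).symm
      have hfg : (f.map (s : E →+* E)).map (((σ k.1 : E ≃ₐ[ℚ] E) : E →ₐ[ℚ] E) : E →+* E) = f := by
        rw [Polynomial.map_map]
        have : ((((σ k.1 : E ≃ₐ[ℚ] E) : E →ₐ[ℚ] E) : E →+* E)).comp (s : E →+* E) =
            RingHom.id E := by
          ext x; simp [s]
        rw [this, Polynomial.map_id]
      have h1 := key_nonarch ((σ k.1 : E ≃ₐ[ℚ] E) : E →ₐ[ℚ] E) (hprime k.1) hM hζ (hσ k.1) v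
        (f.map (s : E →+* E)) O.card ((natDegree_map_le).trans hfdeg.le)
        (hfmon.map _).ne_zero ?_ (∏ x ∈ O, max 1 (v x)) ?_ (η k) ?_
      · rw [hfg] at h1
        exact h1
      · intro j
        refine mem_adjoin_of_fixed fun τ hτ => ?_
        rw [coeff_map]
        have h2 : ((σ k.1) * τ * s) ζ = ζ := by
          change (σ k.1) (τ (s ζ)) = ζ
          rw [conj_fixes hM hζ _ _ hτ]; simp
        have h3 := congrArg (fun q => q.coeff j) (orb_poly_fixed ζ ξ _ h2)
        simp only [coeff_map] at h3
        change (σ k.1) (τ (s (f.coeff j))) = f.coeff j at h3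
        have h4 := congrArg s h3
        simp only [s, AlgEquiv.symm_apply_apply] at h4
        exact h4
      · intro j
        have : ((σ k.1 : E ≃ₐ[ℚ] E) : E →ₐ[ℚ] E) ((f.map (s : E →+* E)).coeff j) = f.coeff j := by
          rw [coeff_map]; simp [s]
        rw [this]
        exact coeff_prod_le v O (fun x => x) j
      · rw [show η k = s (k.2 : E) from rfl, eval_map]
        have h5 : f.eval (k.2 : E) = 0 := by
          simp only [f]
          rw [eval_prod]
          exact Finset.prod_eq_zero k.2.2 (by simp)
        have h6 := hom_eval₂ f (RingHom.id E) (s : E →+* E) (k.2 : E)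
        rw [RingHom.comp_id] at h6
        change eval₂ (s : E →+* E) ((s : E →+* E) (k.2 : E)) f = 0
        rw [← h6]
        change (s : E →+* E) (f.eval (k.2 : E)) = 0
        rw [h5, map_zero]
    have b4 : ∏ r, v (f.eval (β (e2 r)) ^ T) ≤ v (z : E) * (∏ x : OT, max 1 (v (x : E)) ^ (T * b)) *
        ∏ k : KT, max 1 (v (η k)) ^ ((k.1 : ℕ) * a) := by
      rw [e2.prod_comp (fun k => v (f.eval (β k) ^ T))]
      calc _ ≤ ∏ k : KT, (v ((k.1 : ℕ) : E) * (∏ x ∈ O, max 1 (v x)) *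
            max 1 (v (η k)) ^ ((k.1 : ℕ) * O.card)) ^ T :=
            Finset.prod_le_prod (fun k _ => apply_nonneg v _) fun k _ => by
              rw [map_pow]; exact pow_le_pow_left₀ (apply_nonneg v _) (b3 k) T
        _ = _ := by
            simp only [mul_pow, Finset.prod_mul_distrib]
            congr 1
            · congr 1
              · rw [Fintype.prod_prod_type]
                simp only [Finset.prod_const, Finset.card_univ, hcardOT, z]
                rw [Nat.cast_prod, map_prod]
                refine Finset.prod_congr rfl fun p _ => ?_
                rw [Nat.cast_pow, map_pow, pow_mul, Fintype.card_coe]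
              · rw [Finset.prod_const, Finset.card_univ, hcardKT, ← pow_mul,
                  Finset.prod_coe_sort O (fun x => max 1 (v x) ^ (T * b)), Finset.prod_pow]
            · refine Finset.prod_congr rfl fun k _ => ?_
              rw [← pow_mul, mul_assoc]
    calc _ ≤ (∏ x : OT, max 1 (v (x : E)) ^ (T * a)) *
          ((v (z : E) * (∏ x : OT, max 1 (v (x : E)) ^ (T * b)) *
            ∏ k : KT, max 1 (v (η k)) ^ ((k.1 : ℕ) * a)) *
            ∏ k : KT, max 1 (v (η k)) ^ ((k.1 : ℕ) * b)) := by
          have p1 : 0 ≤ ∏ x : OT, max 1 (v (x : E)) ^ (T * a) :=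
            Finset.prod_nonneg fun x _ => pow_nonneg (hm _) _
          have p2 : 0 ≤ (v (z : E) * (∏ x : OT, max 1 (v (x : E)) ^ (T * b)) *
            ∏ k : KT, max 1 (v (η k)) ^ ((k.1 : ℕ) * a)) :=
            mul_nonneg (mul_nonneg (apply_nonneg v _) (Finset.prod_nonneg fun x _ =>
              pow_nonneg (hm _) _)) (Finset.prod_nonneg fun x _ => pow_nonneg (hm _) _)
          refine mul_le_mul b1 (mul_le_mul b4 b2 (apply_nonneg v _) p2)
            (mul_nonneg (Finset.prod_nonneg fun r _ => apply_nonneg v _) (apply_nonneg v _)) p1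
      _ = _ := by
          have q1 : ∀ x : OT, max 1 (v (x : E)) ^ (T * N) =
              max 1 (v (x : E)) ^ (T * a) * max 1 (v (x : E)) ^ (T * b) := fun x => by
            rw [← pow_add, ← mul_add, hab]
          have q2 : ∀ k : KT, max 1 (v (η k)) ^ ((k.1 : ℕ) * N) =
              max 1 (v (η k)) ^ ((k.1 : ℕ) * a) * max 1 (v (η k)) ^ ((k.1 : ℕ) * b) := fun k => by
            rw [← pow_add, ← mul_add, hab]
          simp only [q1, q2, Finset.prod_mul_distrib]
          ring

end

end BZ

namespace BZ

open NumberField Polynomial Height Module Filter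

theorem eventually_primeCounting : ∀ᶠ P : ℕ in atTop, 2 * P ≤ (P ^ 2).primeCounting := by
  have h1 : ∀ᶠ x : ℝ in atTop, ‖Real.log x‖ ≤ (1 / 100) * ‖x‖ :=
    Real.isLittleO_log_id_atTop.def (by norm_num)
  filter_upwards [tendsto_natCast_atTop_atTop.eventually h1, eventually_ge_atTop 2] with P hP hP2
  have hPr : (2 : ℝ) ≤ P := by exact_mod_cast hP2
  have hl : 0 < Real.log P := Real.log_pos (by linarith)
  rw [Real.norm_of_nonneg hl.le, Real.norm_of_nonneg (by positivity)] at hP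
  have h := Chebyshev.pi_ge (P ^ 2)
  rw [Nat.cast_pow, Real.log_pow] at h
  have h2 : Real.log ((P : ℝ) ^ 2 + 1) ≤ 3 * Real.log P := by
    rw [show (3 : ℝ) * Real.log P = ((3 : ℕ) : ℝ) * Real.log P by norm_num, ← Real.log_pow]
    refine Real.log_le_log (by positivity) ?_
    nlinarith [mul_pos (show (0 : ℝ) < P by linarith) (show (0 : ℝ) < P by linarith)]
  have h3 := Real.log_two_gt_d9
  have h4 : (2 : ℝ) * P ≤ (P ^ 2 * Real.log 2 - Real.log (P ^ 2 + 1)) / (((2 : ℕ) : ℝ) * Real.log P) := by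
    rw [le_div_iff₀ (by positivity)]
    push_cast
    nlinarith [mul_pos (show (0 : ℝ) < P by linarith) (show (0 : ℝ) < P by linarith)]
  exact_mod_cast h4.trans h

section
variable {E : Type*} [Field E] [NumberField E]

open Classical in
theorem bad_primes {ζ ξ : E} (hξ : ξ ≠ 0) (B : Finset ℕ)
    (hB : ∀ p ∈ B, p.Prime ∧ ∃ τ : E ≃ₐ[ℚ] E, τ ζ = ζ ∧ (τ ξ) ^ p = ξ ^ p ∧ τ ξ ≠ ξ) :
    2 ^ B.card ≤ (orb ζ ξ).card := by
  suffices h : 2 ^ B.card * ((orb ζ ξ).image fun x => x ^ (∏ p ∈ B, p)).card ≤ (orb ζ ξ).card by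
    refine le_trans (Nat.le_mul_of_pos_right _ ?_) h
    exact Finset.card_pos.2 ⟨_, Finset.mem_image_of_mem _ (mem_orb.2 ⟨1, rfl, rfl⟩)⟩
  induction B using Finset.induction_on with
  | empty => simp
  | insert p B hp ih =>
    rw [Finset.card_insert_of_notMem hp, Finset.prod_insert hp, pow_succ, mul_assoc]
    refine le_trans (Nat.mul_le_mul_left _ ?_) (ih fun q hq => hB q (Finset.mem_insert_of_mem hq))
    set m := ∏ q ∈ B, q with hm
    obtain ⟨hpp, τ, hτ, hτp, hτn⟩ := hB p (Finset.mem_insert_self _ _)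
    have hpm : p.Coprime m := by
      refine Nat.Coprime.prod_right fun q hq => (Nat.coprime_primes hpp
        (hB q (Finset.mem_insert_of_mem hq)).1).2 ?_
      rintro rfl; exact hp hq
    refine Finset.mul_card_image_le_card_of_maps_to (f := fun x => x ^ p) ?_ 2 ?_
    · intro x hx
      obtain ⟨y, hy, rfl⟩ := Finset.mem_image.1 hx
      refine Finset.mem_image.2 ⟨y, hy, ?_⟩
      rw [← pow_mul, mul_comm]
    · intro x hx
      obtain ⟨y, hy, rfl⟩ := Finset.mem_image.1 hx
      obtain ⟨ρ, hρ, rfl⟩ := mem_orb.1 hy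
      have hρτ : ((ρ * τ : E ≃ₐ[ℚ] E) ξ) ^ p = (ρ ξ) ^ p := by
        rw [AlgEquiv.mul_apply, ← map_pow, hτp, map_pow]
      have hne : ((ρ * τ : E ≃ₐ[ℚ] E) ξ) ^ m ≠ (ρ ξ) ^ m := by
        intro h
        apply hτn
        apply ρ.injective
        rw [← AlgEquiv.mul_apply]
        have h0 : ρ ξ ≠ 0 := by simpa using hξ
        have h1 : ((ρ * τ : E ≃ₐ[ℚ] E) ξ / ρ ξ) ^ p = 1 := by
          rw [div_pow, hρτ, div_self (pow_ne_zero _ h0)]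
        have h2 : ((ρ * τ : E ≃ₐ[ℚ] E) ξ / ρ ξ) ^ m = 1 := by
          rw [div_pow, h, div_self (pow_ne_zero _ h0)]
        have h3 : ((ρ * τ : E ≃ₐ[ℚ] E) ξ / ρ ξ) ^ (p.gcd m) = 1 := by
          rw [pow_gcd_eq_one]; exact ⟨h1, h2⟩
        rw [hpm.gcd_eq_one, pow_one, div_eq_one_iff_eq h0] at h3
        exact h3
      have : ({(ρ ξ) ^ m, ((ρ * τ : E ≃ₐ[ℚ] E) ξ) ^ m} : Finset E).card = 2 :=
        Finset.card_pair hne.symm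
      rw [← this]
      refine Finset.card_le_card ?_
      intro x hx
      rw [Finset.mem_insert, Finset.mem_singleton] at hx
      rw [Finset.mem_filter]
      rcases hx with rfl | rfl
      · exact ⟨Finset.mem_image_of_mem _ hy, by rw [← pow_mul, mul_comm, pow_mul]⟩
      · refine ⟨Finset.mem_image_of_mem _ (mem_orb.2 ⟨ρ * τ, ?_, rfl⟩), ?_⟩
        · rw [AlgEquiv.mul_apply, hτ, hρ]
        · rw [← pow_mul, mul_comm, pow_mul, hρτ, ← pow_mul]

theorem good_primes {M : ℕ} (hM : 0 < M) {ζ ξ : E} (hξ : ξ ≠ 0) {P s : ℕ}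
    (hP : 2 * P ≤ (P ^ 2).primeCounting) (hs : s + Nat.log 2 M + Nat.log 2 (orb ζ ξ).card ≤ P) :
    ∃ S : Finset ℕ, S.card = s ∧ ∀ p ∈ S, P < p ∧ p ≤ P ^ 2 ∧ p.Prime ∧ p.Coprime M ∧
      ∀ τ : E ≃ₐ[ℚ] E, τ ζ = ζ → (τ ξ) ^ p = ξ ^ p → τ ξ = ξ := by
  classical
  let Q := (Finset.range (P ^ 2 + 1)).filter Nat.Prime
  have hQ : 2 * P ≤ Q.card := by
    rwa [Nat.primeCounting, Nat.primeCounting', Nat.count_eq_card_filter_range] at hP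
  let B1 := M.primeFactors
  have hB1 : B1.card ≤ Nat.log 2 M := by
    refine Nat.le_log_of_pow_le (by norm_num) ?_
    calc 2 ^ B1.card = ∏ p ∈ B1, 2 := by simp
      _ ≤ ∏ p ∈ B1, p := Finset.prod_le_prod' fun p hp => (Nat.prime_of_mem_primeFactors hp).two_le
      _ ≤ M := Nat.le_of_dvd hM (Nat.prod_primeFactors_dvd M)
  let B2 := Q.filter fun p => ∃ τ : E ≃ₐ[ℚ] E, τ ζ = ζ ∧ (τ ξ) ^ p = ξ ^ p ∧ τ ξ ≠ ξ
  have hB2 : B2.card ≤ Nat.log 2 (orb ζ ξ).card := by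
    refine Nat.le_log_of_pow_le (by norm_num) (bad_primes hξ _ ?_)
    intro p hp
    rw [Finset.mem_filter] at hp
    exact ⟨(Finset.mem_filter.1 hp.1).2, hp.2⟩
  let B3 := Finset.Icc 1 P
  have hB3 : B3.card = P := by simp [B3]
  have hcard : s ≤ (Q \ (B1 ∪ B2 ∪ B3)).card := by
    have h1 := Finset.le_card_sdiff (B1 ∪ B2 ∪ B3) Q
    have h2 := Finset.card_union_le (B1 ∪ B2) B3
    have h3 := Finset.card_union_le B1 B2
    omega
  obtain ⟨S, hS, hSc⟩ := Finset.exists_subset_card_eq hcard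
  refine ⟨S, hSc, fun p hp => ?_⟩
  have h := Finset.mem_sdiff.1 (hS hp)
  simp only [Finset.mem_union, not_or] at h
  obtain ⟨hq, ⟨h1, h2⟩, h3⟩ := h
  obtain ⟨hq1, hpp⟩ := Finset.mem_filter.1 hq
  refine ⟨?_, Nat.lt_succ_iff.1 (Finset.mem_range.1 hq1), hpp, ?_, ?_⟩
  · by_contra hc
    exact h3 (Finset.mem_Icc.2 ⟨hpp.one_lt.le, by omega⟩)
  · refine hpp.coprime_iff_not_dvd.2 fun hd => h1 ?_
    exact Nat.mem_primeFactors.2 ⟨hpp, hd, hM.ne'⟩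
  · intro τ hτ hτp
    by_contra hne
    exact h2 (Finset.mem_filter.2 ⟨hq, τ, hτ, hτp, hne⟩)
end

theorem eventually_log_le (a b : ℝ) : ∀ᶠ P : ℕ in atTop, a * Real.log P + b ≤ P := by
  have h1 : (fun x : ℝ => a * Real.log x + b) =o[atTop] (fun x : ℝ => x) := by
    refine Asymptotics.IsLittleO.add (Real.isLittleO_log_id_atTop.const_mul_left a) ?_
    exact Asymptotics.isLittleO_const_id_atTop b
  have h2 : ∀ᶠ x : ℝ in atTop, ‖a * Real.log x + b‖ ≤ 1 * ‖x‖ := h1.def one_pos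
  filter_upwards [tendsto_natCast_atTop_atTop.eventually h2] with P hP
  rw [one_mul, Real.norm_of_nonneg (Nat.cast_nonneg P)] at hP
  exact (le_abs_self _).trans hP

set_option maxHeartbeats 1000000 in
theorem dobrowolski (C N k : ℕ) (hC : 1 ≤ C) (hN : 1 ≤ N) : ∃ A₀ : ℕ, ∀ (E : Type) [Field E] [NumberField E]
    [IsGalois ℚ E] (M : ℕ) (ζ ξ : E) (A : ℕ), 0 < M → IsPrimitiveRoot ζ M → ξ ≠ 0 →
    (∀ n, 0 < n → ξ ^ n ≠ 1) → 0 < A → M ≤ C * A ^ k → (orb ζ ξ).card ^ N ≤ C * A ^ (N - 1) →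
    (∀ σ : E ≃ₐ[ℚ] E, A * logHeight₁ (σ ξ) ≤ C * finrank ℚ E) → A ≤ A₀ := by
  set T := 8 * N with hT
  set s := T ^ 2 with hs
  obtain ⟨P₀, hP₀⟩ := eventually_atTop.1 (eventually_primeCounting.and ((eventually_log_le
    ((k * (2 * N) + 2 * N) / Real.log 2)
    (s + (Real.log C + k * (2 * N) * Real.log 2 + (Real.log C + 2 * N * Real.log 2)) / Real.log 2)).and
    (((tendsto_natCast_atTop_atTop (R := ℝ)).eventually
    ((Real.tendsto_log_atTop).eventually_gt_atTop
      (((T + s + T ^ 2) * Real.log (C * 2 ^ (2 * N) * (T + s)) + C ^ 2 * (T + s) ^ 2)))).and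
      (eventually_ge_atTop 2))))
  refine ⟨(P₀ + 1) ^ (2 * N), ?_⟩
  intro E _ _ _ M ζ ξ A hM hζ hξ hntor hA hMA hD hh
  by_contra hlt
  push Not at hlt
  -- choose P
  obtain ⟨P, hPA, hAP⟩ : ∃ P, P ^ (2 * N) ≤ A ∧ A < (P + 1) ^ (2 * N) := by
    have hex : ∃ n, A < (n + 1) ^ (2 * N) := ⟨A, by
      calc A < A + 1 := by omega
        _ ≤ (A + 1) ^ (2 * N) := Nat.le_self_pow (by omega) _⟩
    classical
    refine ⟨Nat.find hex, ?_, Nat.find_spec hex⟩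
    rcases Nat.eq_zero_or_pos (Nat.find hex) with h | h
    · rw [h, zero_pow (by omega)]; omega
    · have := Nat.find_min hex (m := Nat.find hex - 1) (by omega)
      rw [Nat.sub_add_cancel h] at this
      omega
  have hPP : P₀ ≤ P := by
    have := hlt.trans hAP
    have := lt_of_pow_lt_pow_left₀ _ (Nat.zero_le _) this
    omega
  obtain ⟨hp1, hp2, hp3, hp4⟩ := hP₀ P hPP
  set D := (orb ζ ξ).card with hDdef
  have hDpos : 0 < D := Finset.card_pos.2 ⟨ξ, mem_orb.2 ⟨1, rfl, rfl⟩⟩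
  have hPr : (2 : ℝ) ≤ P := by exact_mod_cast hp4
  have hlP : 0 < Real.log P := Real.log_pos (by linarith)
  have hl2 : 0 < Real.log 2 := Real.log_pos (by norm_num)
  have hCr : (1 : ℝ) ≤ C := by exact_mod_cast hC
  have hlC : 0 ≤ Real.log C := Real.log_nonneg hCr
  have hAr : (0 : ℝ) < A := by exact_mod_cast hA
  have hNr : (1 : ℝ) ≤ N := by exact_mod_cast hN
  have hlA : Real.log A ≤ 2 * N * (Real.log 2 + Real.log P) := by
    rw [← Real.log_mul (by norm_num) (by linarith),
      show (2 * N : ℝ) = ((2 * N : ℕ) : ℝ) by push_cast; ring, ← Real.log_pow]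
    refine Real.log_le_log hAr ?_
    have : A ≤ (2 * P) ^ (2 * N) := hAP.le.trans (Nat.pow_le_pow_left (by omega) _)
    exact_mod_cast this
  have hDCA : D ≤ C * A := by
    have h1 : D ^ N ≤ (C * A) ^ N := by
      refine hD.trans ?_
      rw [mul_pow]
      exact Nat.mul_le_mul (Nat.le_self_pow (by omega) _) (Nat.pow_le_pow_right hA (by omega))
    exact (Nat.pow_le_pow_iff_left (by omega)).1 h1
  have hDP : D * P ^ 2 ≤ C * A := by
    have h1 : (D * P ^ 2) ^ N ≤ (C * A) ^ N := by
      rw [mul_pow, ← pow_mul, mul_pow]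
      calc _ ≤ C * A ^ (N - 1) * A := Nat.mul_le_mul hD hPA
        _ = C * A ^ N := by rw [mul_assoc, ← pow_succ, Nat.sub_add_cancel hN]
        _ ≤ _ := Nat.mul_le_mul_right _ (Nat.le_self_pow (by omega) _)
    exact (Nat.pow_le_pow_iff_left (by omega)).1 h1
  have hlogD : Real.log D ≤ Real.log C + Real.log A := by
    rw [← Real.log_mul (by linarith) hAr.ne']
    exact Real.log_le_log (by exact_mod_cast hDpos) (by exact_mod_cast hDCA)
  have hlogM : Real.log M ≤ Real.log C + k * Real.log A := by
    rw [← Real.log_pow, ← Real.log_mul (by linarith) (by positivity)]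
    exact Real.log_le_log (by exact_mod_cast hM) (by exact_mod_cast hMA)
  have hnl : ∀ n : ℕ, 0 < n → (Nat.log 2 n : ℝ) ≤ Real.log n / Real.log 2 := fun n hn => by
    rw [le_div_iff₀ hl2, ← Real.log_pow]
    exact Real.log_le_log (by positivity) (by exact_mod_cast Nat.pow_log_le_self 2 hn.ne')
  have hk : (k : ℝ) * Real.log A ≤ k * (2 * N * (Real.log 2 + Real.log P)) :=
    mul_le_mul_of_nonneg_left hlA (Nat.cast_nonneg k)
  have hsP : s + Nat.log 2 M + Nat.log 2 D ≤ P := by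
    have : (s + Nat.log 2 M + Nat.log 2 D : ℝ) ≤ P := by
      refine le_trans ?_ hp2
      calc (s + Nat.log 2 M + Nat.log 2 D : ℝ) ≤ s + Real.log M / Real.log 2 + Real.log D / Real.log 2 :=
            add_le_add (add_le_add le_rfl (hnl M hM)) (hnl D hDpos)
        _ = s + (Real.log M + Real.log D) / Real.log 2 := by ring
        _ ≤ s + (Real.log C + k * (2 * N * (Real.log 2 + Real.log P)) +
            (Real.log C + 2 * N * (Real.log 2 + Real.log P))) / Real.log 2 := by
            gcongr <;> linarith
        _ = _ := by
            field_simp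
            ring
    exact_mod_cast this
  obtain ⟨S, hSc, hS⟩ := good_primes hM hξ hp1 hsP
  have hmain := dob_core hM hζ hξ hntor S (fun p hp => (hS p hp).2.2) T (C / A) (fun σ => by
    rw [mul_div_assoc', le_div_iff₀ hAr]
    have := hh σ
    linarith) _ rfl
  rw [hSc, ← hDdef] at hmain
  have hsum1 : (s : ℝ) * Real.log P ≤ ∑ p ∈ S, Real.log p := by
    rw [← hSc, ← nsmul_eq_mul]
    refine Finset.card_nsmul_le_sum _ _ _ fun p hp => ?_
    exact Real.log_le_log (by linarith) (by exact_mod_cast (hS p hp).1.le)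
  have hsum2 : ∑ p ∈ S, (p : ℝ) ≤ s * P ^ 2 := by
    rw [← hSc, ← nsmul_eq_mul]
    refine Finset.sum_le_card_nsmul _ _ _ fun p hp => ?_
    exact_mod_cast (hS p hp).2.1
  have hTr : (8 : ℝ) * N = T := by rw [hT]; push_cast; ring
  have hsr : (s : ℝ) = T ^ 2 := by rw [hs]; push_cast; ring
  have hT8 : (8 : ℝ) ≤ T := by linarith
  have hlogN : Real.log ((D * (T + s) : ℕ) : ℝ) ≤
      Real.log (C * 2 ^ (2 * N) * (T + s)) + 2 * N * Real.log P := by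
    have hTs : (0 : ℝ) < T + s := by positivity
    push_cast
    rw [Real.log_mul (by positivity) hTs.ne', Real.log_mul (by positivity) hTs.ne',
      Real.log_mul (by positivity) (by positivity), Real.log_pow]
    push_cast
    linarith
  have herr : ((D * (T + s) : ℕ) : ℝ) * (T + ∑ p ∈ S, (p : ℝ)) * (C / A) ≤ C ^ 2 * (T + s) ^ 2 := by
    rw [mul_div_assoc', div_le_iff₀ hAr]
    have hDP' : (D : ℝ) * P ^ 2 ≤ C * A := by exact_mod_cast hDP
    have h1 : (T + ∑ p ∈ S, (p : ℝ)) ≤ (T + s) * P ^ 2 := by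
      have : (T : ℝ) ≤ T * P ^ 2 :=
        le_mul_of_one_le_right (by positivity) (one_le_pow₀ (by linarith))
      linarith
    have hTs : (0 : ℝ) ≤ T + s := by positivity
    push_cast
    calc (D * (T + s) : ℝ) * (T + ∑ p ∈ S, (p : ℝ)) * C ≤ (D * (T + s)) * ((T + s) * P ^ 2) * C := by gcongr
      _ = (T + s) ^ 2 * C * (D * P ^ 2) := by ring
      _ ≤ (T + s) ^ 2 * C * (C * A) := by gcongr
      _ = _ := by ring
  have hTT : (0 : ℝ) ≤ T + s + T ^ 2 := by positivity
  have hfin : (T : ℝ) * (s * Real.log P) ≤ (T + s + T ^ 2) *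
      (Real.log (C * 2 ^ (2 * N) * (T + s)) + 2 * N * Real.log P) + C ^ 2 * (T + s) ^ 2 :=
    (mul_le_mul_of_nonneg_left hsum1 (by positivity)).trans (hmain.trans (add_le_add
      (mul_le_mul_of_nonneg_left hlogN hTT) herr))
  have hcoef : Real.log P ≤ (T * s - (T + s + T ^ 2) * (2 * N)) * Real.log P := by
    have : (1 : ℝ) ≤ T * s - (T + s + T ^ 2) * (2 * N) := by
      have h4 : (2 * N : ℝ) = T / 4 := by linarith
      rw [h4, hsr]
      have h5 : (T : ℝ) * T ^ 2 - (T + T ^ 2 + T ^ 2) * (T / 4) = T ^ 2 * (T / 2 - 1 / 4) := by ring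
      rw [h5]
      have h6 : (1 : ℝ) ≤ T ^ 2 := one_le_pow₀ (by linarith)
      exact one_le_mul_of_one_le_of_one_le h6 (by linarith)
    exact le_mul_of_one_le_left hlP.le this
  clear_value T s
  clear hh hmain hsum1 hsum2 hk hlA hlogM hlogD hnl hp2 herr hlogN hP₀ hTr hsr
  rw [mul_add] at hfin
  linarith

end BZ

namespace BZ
open Module MvPolynomial

/-- Plane polynomials of bounded bidegree. -/
noncomputable def bideg (A B : ℕ) : Submodule ℂ (MvPolynomial (Fin 2) ℂ) :=
  restrictSupport ℂ {m | m 0 ≤ A ∧ m 1 ≤ B}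

theorem mem_bideg {A B : ℕ} {p : MvPolynomial (Fin 2) ℂ} :
    p ∈ bideg A B ↔ p.degreeOf 0 ≤ A ∧ p.degreeOf 1 ≤ B := by
  rw [bideg, mem_restrictSupport_iff, degreeOf_le_iff, degreeOf_le_iff]
  exact ⟨fun h => ⟨fun m hm => (h hm).1, fun m hm => (h hm).2⟩, fun h m hm => ⟨h.1 m hm, h.2 m hm⟩⟩

/-- Exponents of bounded bidegree. -/
noncomputable def bidegEquiv (A B : ℕ) :
    ({m | m 0 ≤ A ∧ m 1 ≤ B} : Set (Fin 2 →₀ ℕ)) ≃ Fin (A + 1) × Fin (B + 1) where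
  toFun m := (⟨m.1 0, Nat.lt_succ_of_le m.2.1⟩, ⟨m.1 1, Nat.lt_succ_of_le m.2.2⟩)
  invFun x := ⟨Finsupp.equivFunOnFinite.symm ![x.1, x.2], by
    simpa using ⟨Nat.le_of_lt_succ x.1.2, Nat.le_of_lt_succ x.2.2⟩⟩
  left_inv m := by
    ext i
    fin_cases i <;> rfl
  right_inv x := rfl

instance (A B : ℕ) : Finite ({m | m 0 ≤ A ∧ m 1 ≤ B} : Set (Fin 2 →₀ ℕ)) :=
  Finite.of_equiv _ (bidegEquiv A B).symm

instance (A B : ℕ) : FiniteDimensional ℂ (bideg A B) :=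
  Module.Finite.of_basis (basisRestrictSupport ℂ _)

theorem finrank_bideg (A B : ℕ) : finrank ℂ (bideg A B) = (A + 1) * (B + 1) := by
  rw [bideg, finrank_eq_nat_card_basis (basisRestrictSupport ℂ _), Nat.card_congr (bidegEquiv A B)]
  simp

/-- Multiplication by a fixed polynomial on polynomials of bounded bidegree. -/
noncomputable def bidegMul (h : MvPolynomial (Fin 2) ℂ) {A B A' B' : ℕ}
    (h0 : h.degreeOf 0 + A ≤ A') (h1 : h.degreeOf 1 + B ≤ B') : bideg A B →ₗ[ℂ] bideg A' B' :=
  (LinearMap.mulLeft ℂ h).restrict (fun p hp => by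
    rw [mem_bideg] at hp ⊢
    have := degreeOf_mul_le 0 h p
    have := degreeOf_mul_le 1 h p
    simp only [LinearMap.mulLeft_apply]
    omega)

theorem exists_interpolation (Z : Finset (Fin 2 → ℂ)) (z : Fin 2 → ℂ) :
    ∃ p ∈ bideg Z.card Z.card, eval z p ≠ 0 ∧ ∀ x ∈ Z, x ≠ z → eval x p = 0 := by
  classical
  induction Z using Finset.induction_on with
  | empty => exact ⟨1, by rw [mem_bideg]; simp, by simp, by simp⟩
  | insert a Z ha ih =>
    obtain ⟨p, hp, hpz, hp0⟩ := ih
    rw [mem_bideg] at hp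
    rw [Finset.card_insert_of_notMem ha]
    by_cases haz : a = z
    · refine ⟨p, ?_, hpz, ?_⟩
      · rw [mem_bideg]; omega
      · intro x hx hxz
        rcases Finset.mem_insert.1 hx with rfl | hx
        · exact absurd haz hxz
        · exact hp0 x hx hxz
    · obtain ⟨i, hi⟩ := Function.ne_iff.1 haz
      refine ⟨p * (X i - C (a i)), ?_, ?_, ?_⟩
      · have hd : ∀ j, (X i - C (a i) : MvPolynomial (Fin 2) ℂ).degreeOf j ≤ 1 := by
          intro j
          rw [sub_eq_add_neg, ← map_neg]
          refine (degreeOf_add_le _ _ _).trans (max_le ?_ (by simp))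
          by_cases hij : j = i
          · subst hij; simp
          · simp [degreeOf_X_of_ne hij]
        rw [mem_bideg]
        have := degreeOf_mul_le 0 p (X i - C (a i))
        have := degreeOf_mul_le 1 p (X i - C (a i))
        have := hd 0
        have := hd 1
        omega
      · rw [map_mul]
        refine mul_ne_zero hpz ?_
        simp only [map_sub, eval_X, eval_C]
        exact sub_ne_zero.2 (Ne.symm hi)
      · intro x hx hxz
        rw [map_mul]
        rcases Finset.mem_insert.1 hx with rfl | hx
        · simp
        · rw [hp0 x hx hxz, zero_mul]

theorem bezout_coprime (g p : MvPolynomial (Fin 2) ℂ) (hg : g ≠ 0) (hp : p ≠ 0)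
    (hgp : IsRelPrime g p) (Z : Finset (Fin 2 → ℂ)) (hZ : ∀ z ∈ Z, eval z g = 0 ∧ eval z p = 0) :
    Z.card ≤ g.degreeOf 0 * p.degreeOf 1 + g.degreeOf 1 * p.degreeOf 0 := by
  classical
  set e0 := g.degreeOf 0 with he0
  set e1 := g.degreeOf 1 with he1
  set d0 := p.degreeOf 0 with hd0
  set d1 := p.degreeOf 1 with hd1
  set n := Z.card with hn
  let A := e0 + d0 + n
  let B := e1 + d1 + n
  let Φ : (bideg (d0 + n) (d1 + n) × bideg (e0 + n) (e1 + n)) →ₗ[ℂ] bideg A B :=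
    LinearMap.coprod (bidegMul g (by simp only [A]; omega) (by simp only [B]; omega))
      (bidegMul p (by simp only [A]; omega) (by simp only [B]; omega))
  let Ψ : bideg n n →ₗ[ℂ] (bideg (d0 + n) (d1 + n) × bideg (e0 + n) (e1 + n)) :=
    LinearMap.prod (bidegMul p (by omega) (by omega)) (-(bidegMul g (by omega) (by omega)))
  have hΦ : ∀ x, (Φ x : MvPolynomial (Fin 2) ℂ) = g * x.1 + p * x.2 := fun x => rfl
  have hker : LinearMap.ker Φ ≤ LinearMap.range Ψ := by
    intro x hx
    have h1 : g * (x.1 : MvPolynomial (Fin 2) ℂ) + p * x.2 = 0 := by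
      rw [← hΦ, LinearMap.mem_ker.1 hx]; rfl
    have h2 : p ∣ g * (x.1 : MvPolynomial (Fin 2) ℂ) := ⟨-x.2, by linear_combination h1⟩
    obtain ⟨c, hc⟩ := hgp.symm.dvd_of_dvd_mul_left h2
    have h3 : (x.2 : MvPolynomial (Fin 2) ℂ) = -(g * c) := by
      apply mul_left_cancel₀ hp
      rw [hc] at h1
      linear_combination h1
    have hcm : c ∈ bideg n n := by
      by_cases hc0 : c = 0
      · rw [hc0]; exact zero_mem _
      have h4 := mem_bideg.1 x.1.2
      rw [hc, degreeOf_mul_eq hp hc0, degreeOf_mul_eq hp hc0] at h4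
      rw [mem_bideg]
      omega
    refine ⟨⟨c, hcm⟩, ?_⟩
    refine Prod.ext (Subtype.ext hc.symm) (Subtype.ext ?_)
    rw [h3]; rfl
  let evZ : bideg A B →ₗ[ℂ] (Z → ℂ) :=
    LinearMap.pi fun z => (aeval (R := ℂ) (z : Fin 2 → ℂ)).toLinearMap.comp (bideg A B).subtype
  have hev : ∀ x z, evZ x z = eval (z : Fin 2 → ℂ) (x : MvPolynomial (Fin 2) ℂ) := fun x z => rfl
  have hsurj : LinearMap.range evZ = ⊤ := by
    rw [eq_top_iff, ← (Pi.basisFun ℂ Z).span_eq, Submodule.span_le]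
    rintro _ ⟨z, rfl⟩
    obtain ⟨q, hq, hqz, hq0⟩ := exists_interpolation Z z
    have hq' : q ∈ bideg A B := by
      rw [mem_bideg] at hq ⊢
      simp only [A, B]
      omega
    refine ⟨(eval (z : Fin 2 → ℂ) q)⁻¹ • ⟨q, hq'⟩, ?_⟩
    ext x
    rw [map_smul, Pi.smul_apply, hev, Pi.basisFun_apply]
    by_cases hxz : x = z
    · subst hxz
      simp [hqz]
    · rw [Pi.single_eq_of_ne hxz, hq0 x x.2 (fun h => hxz (Subtype.ext h)), smul_zero]
  have hle : LinearMap.range Φ ≤ LinearMap.ker evZ := by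
    rintro _ ⟨x, rfl⟩
    rw [LinearMap.mem_ker]
    ext z
    rw [hev, hΦ]
    simp [(hZ z z.2).1, (hZ z z.2).2]
  have r1 := LinearMap.finrank_range_add_finrank_ker Φ
  have r2 := LinearMap.finrank_range_add_finrank_ker evZ
  have r3 := Submodule.finrank_mono hle
  have r4 := (Submodule.finrank_mono hker).trans (LinearMap.finrank_range_le Ψ)
  rw [hsurj, finrank_top, finrank_pi, Fintype.card_coe, finrank_bideg] at r2
  rw [finrank_prod, finrank_bideg, finrank_bideg] at r1
  rw [finrank_bideg] at r4
  simp only [A, B] at r2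
  nlinarith

/-- A finite set of plane points lying on a curve, none of whose components contains all the
curves of a family cutting out the set, has cardinality bounded by the bidegrees. -/
theorem bezout (d0 d1 : ℕ) (fam : Set (MvPolynomial (Fin 2) ℂ))
    (hfam : ∀ q ∈ fam, q.degreeOf 0 ≤ d0 ∧ q.degreeOf 1 ≤ d1) (p : MvPolynomial (Fin 2) ℂ)
    (hp : p ≠ 0) : ∀ (Z : Finset (Fin 2 → ℂ)), (∀ z ∈ Z, ∀ q ∈ fam, eval z q = 0) →
    (∀ z ∈ Z, eval z p = 0) → (∀ z ∈ Z, ∀ g, Irreducible g → eval z g = 0 → ∃ q ∈ fam, ¬ g ∣ q) →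
    Z.card ≤ p.degreeOf 0 * d1 + p.degreeOf 1 * d0 := by
  classical
  induction p using WfDvdMonoid.induction_on_irreducible with
  | zero => exact absurd rfl hp
  | unit u hu =>
    intro Z _ hZp _
    have : Z = ∅ := by
      rw [Finset.eq_empty_iff_forall_notMem]
      intro z hz
      exact (hu.map (eval z)).ne_zero (hZp z hz)
    simp [this]
  | mul a g ha hg ih =>
    intro Z hZ hZp hirr
    rw [degreeOf_mul_eq hg.ne_zero ha, degreeOf_mul_eq hg.ne_zero ha]
    have h1 := ih ha (Z.filter fun z => eval z a = 0) (fun z hz => hZ z (Finset.mem_filter.1 hz).1)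
      (fun z hz => (Finset.mem_filter.1 hz).2) (fun z hz => hirr z (Finset.mem_filter.1 hz).1)
    have h2 : (Z.filter fun z => eval z g = 0).card ≤ g.degreeOf 0 * d1 + g.degreeOf 1 * d0 := by
      by_cases hne : (Z.filter fun z => eval z g = 0) = ∅
      · simp [hne]
      obtain ⟨z, hz⟩ := Finset.nonempty_iff_ne_empty.2 hne
      rw [Finset.mem_filter] at hz
      obtain ⟨q, hq, hgq⟩ := hirr z hz.1 g hg hz.2
      have hq0 : q ≠ 0 := by
        rintro rfl
        exact hgq (dvd_zero _)
      refine (bezout_coprime g q hg.ne_zero hq0 (hg.isRelPrime_iff_not_dvd.2 hgq) _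
        (fun z hz => ⟨(Finset.mem_filter.1 hz).2, hZ z (Finset.mem_filter.1 hz).1 q hq⟩)).trans ?_
      obtain ⟨h3, h4⟩ := hfam q hq
      gcongr
    have h3 : Z ⊆ (Z.filter fun z => eval z a = 0) ∪ Z.filter fun z => eval z g = 0 := by
      intro z hz
      have := hZp z hz
      rw [map_mul, mul_eq_zero] at this
      rw [Finset.mem_union, Finset.mem_filter, Finset.mem_filter]
      tauto
    have h4 := (Finset.card_le_card h3).trans (Finset.card_union_le _ _)
    nlinarith
end BZ

namespace BZ
open Polynomial

/-- A derivation vanishing on a subalgebra vanishes on every element algebraic over it. -/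
theorem deriv_eq_zero_of_isAlgebraic {k F : Type*} [Field k] [Field F] [CharZero F] [Algebra k F]
    (δ : Derivation k F F) (A : Subalgebra k F) (hA : ∀ a ∈ A, δ a = 0) {x : F}
    (hx : IsAlgebraic A x) : δ x = 0 := by
  let δ' : Derivation A F F := Derivation.mk'
    { toFun := δ
      map_add' := δ.map_add
      map_smul' := by
        rintro ⟨a, ha⟩ y
        simp [Subalgebra.smul_def, hA a ha] }
    (by intro a b; simp)
  have hδ : ∀ y, δ' y = δ y := fun y => rfl
  have : CharZero A := ⟨fun m n h => by
    have := congrArg (fun a : A => (a : F)) h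
    simpa using this⟩
  have key : ∀ n : ℕ, ∀ p : A[X], p ≠ 0 → p.natDegree ≤ n → aeval x p = 0 → δ x = 0 := by
    intro n
    induction n with
    | zero =>
      intro p hp hn h
      rw [Nat.le_zero, natDegree_eq_zero] at hn
      obtain ⟨a, rfl⟩ := hn
      rw [aeval_C] at h
      exact absurd (by
        have : a = 0 := Subtype.ext (by simpa using h)
        rw [this, C_0]) hp
    | succ n ih =>
      intro p hp hn h
      by_cases hd : p.natDegree = 0
      · rw [natDegree_eq_zero] at hd
        obtain ⟨a, rfl⟩ := hd
        rw [aeval_C] at h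
        exact absurd (by
          have : a = 0 := Subtype.ext (by simpa using h)
          rw [this, C_0]) hp
      have h1 := δ'.map_aeval p x
      rw [h, map_zero, hδ] at h1
      rcases smul_eq_zero.1 h1.symm with h2 | h2
      · refine ih (derivative p) ?_ ?_ h2
        · intro h3
          exact hd (natDegree_eq_zero_of_derivative_eq_zero h3)
        · have := natDegree_derivative_lt hd
          omega
      · exact h2
  obtain ⟨p, hp, h⟩ := hx
  exact key _ p hp le_rfl h

/-- If `F` is algebraic over `k(t)` with `t` transcendental, the derivation `t d/dt` of `k[t]`
extends to `F`. -/
theorem exists_derivation {k F : Type*} [Field k] [Field F] [CharZero F] [Algebra k F] (t : F)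
    (ht : Transcendental k t) (halg : ∀ x : F, IsAlgebraic (Algebra.adjoin k {t}) x) :
    ∃ δ : Derivation k F F, δ t = t := by
  let : Algebra k[X] F := (aeval t : k[X] →ₐ[k] F).toRingHom.toAlgebra
  have hmap : ∀ p : k[X], algebraMap k[X] F p = aeval t p := fun p => rfl
  have : IsScalarTower k k[X] F := IsScalarTower.of_algebraMap_eq (fun a => by
    rw [hmap]; simp)
  have hinj : Function.Injective (algebraMap k[X] F) := by
    rw [injective_iff_map_eq_zero]
    intro p hp
    rw [hmap] at hp
    by_contra h
    exact ht ⟨p, h, hp⟩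
  have : FaithfulSMul k[X] F := (faithfulSMul_iff_algebraMap_injective _ _).2 hinj
  let K := FractionRing k[X]
  let : Algebra K F := FractionRing.liftAlgebra k[X] F
  have : IsScalarTower k[X] K F := FractionRing.isScalarTower_liftAlgebra k[X] F
  have : CharZero K := by
    refine ⟨fun m n h => ?_⟩
    have := congrArg (algebraMap K F) h
    rw [map_natCast, map_natCast] at this
    exact_mod_cast this
  have : Algebra.IsAlgebraic k[X] F := by
    refine ⟨fun x => ?_⟩
    obtain ⟨p, hp, h⟩ := halg x
    have hA : ∀ a : Algebra.adjoin k {t}, ∃ q : k[X], aeval t q = (a : F) := by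
      rintro ⟨a, ha⟩
      rw [Algebra.adjoin_singleton_eq_range_aeval] at ha
      exact ha
    choose f hf using hA
    have hfi : ∀ a, a ≠ 0 → f a ≠ 0 := by
      intro a ha h0
      apply ha
      apply Subtype.ext
      rw [← hf a, h0]; simp
    refine ⟨∑ i ∈ p.support, monomial i (f (p.coeff i)), ?_, ?_⟩
    · obtain ⟨i, hi⟩ := Polynomial.support_nonempty.2 hp
      intro h0
      have h1 := congrArg (fun q => Polynomial.coeff q i) h0
      simp only [finsetSum_coeff, coeff_monomial, coeff_zero] at h1
      rw [Finset.sum_ite_eq' , if_pos hi] at h1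
      exact hfi _ (mem_support_iff.1 hi) h1
    · rw [map_sum, ← h, aeval_def x p, eval₂_eq_sum, Polynomial.sum]
      refine Finset.sum_congr rfl fun i hi => ?_
      rw [aeval_monomial, hmap, hf]
      rfl
  have : Algebra.IsAlgebraic K F := by
    refine ⟨fun x => ?_⟩
    exact (IsFractionRing.isAlgebraic_iff k[X] K F).1 (Algebra.IsAlgebraic.isAlgebraic x)
  have : Algebra.FormallyEtale k[X] K :=
    Algebra.FormallyEtale.of_isLocalization (nonZeroDivisors k[X])
  have : Algebra.FormallyEtale K F := Algebra.FormallyEtale.of_isSeparable K F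
  have : Algebra.FormallyEtale k[X] F := Algebra.FormallyEtale.comp k[X] K F
  let d : Derivation k k[X] F := Polynomial.mkDerivation k t
  let l := (LinearMap.liftBaseChange F d.liftKaehlerDifferential).comp
    (KaehlerDifferential.tensorKaehlerEquivOfFormallyEtale k k[X] F).symm.toLinearMap
  refine ⟨l.compDer (KaehlerDifferential.D k F), ?_⟩
  have hX : algebraMap k[X] F X = t := by rw [hmap]; simp
  have h1 := KaehlerDifferential.tensorKaehlerEquivOfFormallyEtale_symm_D_algebraMap k k[X] F X
  rw [hX] at h1
  have : (l.compDer (KaehlerDifferential.D k F)) t = l (KaehlerDifferential.D k F t) := rfl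
  rw [this]
  change (LinearMap.liftBaseChange F d.liftKaehlerDifferential)
    ((KaehlerDifferential.tensorKaehlerEquivOfFormallyEtale k k[X] F).symm
      (KaehlerDifferential.D k F t)) = t
  rw [h1]
  simp [d, Derivation.liftKaehlerDifferential_comp_D]
end BZ

namespace BZ
open Polynomial

section dlog
variable {k F : Type*} [Field k] [Field F] [Algebra k F] (δ : Derivation k F F)

theorem dlog_mul {x y : F} (hx : x ≠ 0) (hy : y ≠ 0) :
    δ (x * y) / (x * y) = δ x / x + δ y / y := by
  rw [Derivation.leibniz, smul_eq_mul, smul_eq_mul]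
  field_simp
  ring

theorem dlog_prod {ι : Type*} (s : Finset ι) (f : ι → F) (hf : ∀ i, f i ≠ 0) :
    δ (∏ i ∈ s, f i) / (∏ i ∈ s, f i) = ∑ i ∈ s, δ (f i) / f i := by
  classical
  induction s using Finset.induction_on with
  | empty => simp
  | insert a s ha ih =>
    rw [Finset.prod_insert ha, Finset.sum_insert ha,
      dlog_mul δ (hf a) (Finset.prod_ne_zero_iff.2 fun i _ => hf i), ih]

theorem dlog_pow {x : F} (hx : x ≠ 0) (n : ℕ) : δ (x ^ n) / x ^ n = n * (δ x / x) := by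
  induction n with
  | zero => simp
  | succ n ih =>
    rw [pow_succ, dlog_mul δ (pow_ne_zero _ hx) hx, ih]
    push_cast; ring

theorem dlog_inv {x : F} (hx : x ≠ 0) : δ x⁻¹ / x⁻¹ = -(δ x / x) := by
  have h := dlog_mul δ hx (inv_ne_zero hx)
  rw [mul_inv_cancel₀ hx, Derivation.map_one_eq_zero, zero_div] at h
  rw [eq_neg_iff_add_eq_zero, add_comm, ← h]

theorem dlog_zpow {x : F} (hx : x ≠ 0) (n : ℤ) : δ (x ^ n) / x ^ n = n * (δ x / x) := by
  rcases n with n | n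
  · simpa using dlog_pow δ hx n
  · rw [zpow_negSucc, dlog_inv δ (pow_ne_zero _ hx), dlog_pow δ hx]
    push_cast; ring

end dlog

section res
variable {k F : Type*} [Field k] [Field F] [Algebra k F]

/-- `x` lies in the local ring of `k(t)` at `t = 0` and has value `n` there. -/
def HasValue (t x : F) (n : k) : Prop :=
  ∃ p q : k[X], q.eval 0 ≠ 0 ∧ x * aeval t q = algebraMap k F n * aeval t q + t * aeval t p

variable {t : F}

theorem HasValue.add {x y : F} {m n : k} (hx : HasValue t x m) (hy : HasValue t y n) :
    HasValue t (x + y) (m + n) := by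
  obtain ⟨p, q, hq, h⟩ := hx
  obtain ⟨p', q', hq', h'⟩ := hy
  refine ⟨p * q' + p' * q, q * q', by rw [eval_mul]; exact mul_ne_zero hq hq', ?_⟩
  simp only [map_add, map_mul]
  linear_combination (aeval t q') * h + (aeval t q) * h'

theorem HasValue.const_mul {x : F} {m : k} (a : k) (hx : HasValue t x m) :
    HasValue t (algebraMap k F a * x) (a * m) := by
  obtain ⟨p, q, hq, h⟩ := hx
  refine ⟨C a * p, q, hq, ?_⟩
  simp only [map_mul, aeval_C]
  linear_combination (algebraMap k F a) * h

theorem HasValue.zero : HasValue t (0 : F) (0 : k) := ⟨0, 1, by simp, by simp⟩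

theorem HasValue.sum {ι : Type*} (s : Finset ι) {x : ι → F} {m : ι → k}
    (h : ∀ i, HasValue t (x i) (m i)) : HasValue t (∑ i ∈ s, x i) (∑ i ∈ s, m i) := by
  classical
  induction s using Finset.induction_on with
  | empty => simpa using HasValue.zero
  | insert a s ha ih =>
    rw [Finset.sum_insert ha, Finset.sum_insert ha]
    exact (h a).add ih

theorem HasValue.eq_zero (ht : Transcendental k t) {m : k} (h : HasValue t (0 : F) m) :
    m = 0 := by
  obtain ⟨p, q, hq, h⟩ := h
  have h0 : C m * q + X * p = 0 := by
    by_contra hne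
    refine ht ⟨_, hne, ?_⟩
    simp only [map_add, map_mul, aeval_C, aeval_X]
    rw [← h, zero_mul]
  have := congrArg (eval 0) h0
  simpa [hq] using this

theorem HasValue.unique (ht : Transcendental k t) {x : F} {m n : k} (h : HasValue t x m)
    (h' : HasValue t x n) : m = n := by
  have := h.add (h'.const_mul (-1))
  rw [map_neg, map_one, neg_one_mul, add_neg_cancel] at this
  have := this.eq_zero ht
  linear_combination this

theorem hasValue_dlog_poly (δ : Derivation k F F) (ht : Transcendental k t) (hδ : δ t = t)
    {p : k[X]} (hp : p ≠ 0) :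
    ∃ n : ℤ, HasValue t (δ (aeval t p) / aeval t p) (n : k) := by
  have ht0 : t ≠ 0 := by
    rintro rfl
    exact ht (isAlgebraic_zero)
  obtain ⟨p1, hp1, hnd⟩ := exists_eq_pow_rootMultiplicity_mul_and_not_dvd p hp 0
  rw [C_0, sub_zero] at hp1 hnd
  rw [X_dvd_iff, coeff_zero_eq_eval_zero] at hnd
  have hp1t : aeval t p1 ≠ 0 := by
    intro h0
    exact ht ⟨p1, by rintro rfl; simp at hnd, h0⟩
  refine ⟨(rootMultiplicity 0 p : ℕ), derivative p1, p1, hnd, ?_⟩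
  conv_lhs => rw [hp1]
  rw [map_mul, map_pow, aeval_X, dlog_mul δ (pow_ne_zero _ ht0) hp1t, dlog_pow δ ht0, hδ,
    div_self ht0, Derivation.map_aeval, hδ, smul_eq_mul]
  have h2 : algebraMap k F (((rootMultiplicity 0 p : ℕ) : ℤ) : k) = (rootMultiplicity 0 p : F) := by
    simp
  rw [h2]
  field_simp

open IntermediateField in
theorem hasValue_dlog (δ : Derivation k F F) (ht : Transcendental k t) (hδ : δ t = t)
    {x : F} (hx0 : x ≠ 0) (hx : x ∈ k⟮t⟯) :
    ∃ n : ℤ, HasValue t (δ x / x) (n : k) := by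
  obtain ⟨r, s, rfl⟩ := (mem_adjoin_simple_iff k x).1 hx
  have hr : aeval t r ≠ 0 := fun h => hx0 (by rw [h, zero_div])
  have hs : aeval t s ≠ 0 := fun h => hx0 (by rw [h, div_zero])
  obtain ⟨m, hm⟩ := hasValue_dlog_poly δ ht hδ (p := r) (by rintro rfl; simp at hr)
  obtain ⟨n, hn⟩ := hasValue_dlog_poly δ ht hδ (p := s) (by rintro rfl; simp at hs)
  refine ⟨m - n, ?_⟩
  have := hm.add (hn.const_mul (-1))
  rw [div_eq_mul_inv (aeval t r), dlog_mul δ hr (inv_ne_zero hs), dlog_inv δ hs]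
  convert this using 1
  · simp
  · push_cast; ring
end res

end BZ

namespace BZ
open Polynomial IntermediateField

theorem derivation_comm {k F : Type*} [Field k] [Field F] [CharZero F] [Algebra k F]
    {t : F} (halg : ∀ x : F, IsAlgebraic (Algebra.adjoin k {t}) x) (δ : Derivation k F F)
    (hδ : δ t = t) (σ : F ≃ₐ[k] F) (hσ : σ t = t) (x : F) : δ (σ x) = σ (δ x) := by
  let δ' : Derivation k F F := Derivation.mk'
    (σ.symm.toLinearMap ∘ₗ δ.toLinearMap ∘ₗ σ.toLinearMap) (by intro a b; simp)
  have hδ' : ∀ y, δ' y = σ.symm (δ (σ y)) := fun y => rfl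
  have hD : ∀ y ∈ Algebra.adjoin k {t}, (δ' - δ) y = 0 := by
    intro y hy
    have h1 : Set.EqOn δ' δ {t} := by
      intro z hz
      rw [Set.mem_singleton_iff] at hz
      subst hz
      rw [hδ', hσ, hδ, AlgEquiv.symm_apply_eq, hσ]
    rw [Derivation.sub_apply, Derivation.eqOn_adjoin h1 hy, sub_self]
  have := deriv_eq_zero_of_isAlgebraic (δ' - δ) _ hD (halg x)
  rw [Derivation.sub_apply, hδ', sub_eq_zero, AlgEquiv.symm_apply_eq] at this
  exact this

theorem residue_core {k F : Type*} [Field k] [Field F] [CharZero F] [IsAlgClosed F] [Algebra k F]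
    {t : F} (ht : Transcendental k t) (halg : ∀ x : F, IsAlgebraic (Algebra.adjoin k {t}) x)
    {m : ℕ} (c : Fin m → F) (hc : ∀ j, c j ≠ 0) (β : Fin m → k) (b : Fin m → ℤ)
    (hb : ∏ j, c j ^ b j = t)
    (h : ∀ δ : Derivation k F F, ∑ j, algebraMap k F (β j) * (δ (c j) / c j) = 0) :
    ∃ n : Fin m → ℤ, ∑ j, β j * (n j : k) = 0 ∧ ∑ j, b j * n j ≠ 0 := by
  have ht0 : t ≠ 0 := by
    rintro rfl
    exact ht isAlgebraic_zero
  have : CharZero k := ⟨fun x y hxy => by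
    have := congrArg (algebraMap k F) hxy
    simpa using this⟩
  obtain ⟨δ, hδ⟩ := exists_derivation t ht halg
  let K := k⟮t⟯
  have hle : Algebra.adjoin k {t} ≤ K.toSubalgebra := algebra_adjoin_le_adjoin k {t}
  have : Algebra.IsAlgebraic K F := ⟨fun x => (halg x).tower_top_of_subalgebra_le hle⟩
  have : IsAlgClosure K F := ⟨inferInstance, inferInstance⟩
  have : IsGalois K F := { }
  let E := FiniteGaloisIntermediateField.adjoin K (Set.range c)
  have hcE : ∀ j, c j ∈ E.toIntermediateField := fun j =>
    FiniteGaloisIntermediateField.subset_adjoin K (Set.range c) ⟨j, rfl⟩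
  let cE : Fin m → E := fun j => ⟨c j, hcE j⟩
  let G := E ≃ₐ[K] E
  have hl : ∀ τ : G, ∃ σ : F ≃ₐ[K] F, ∀ x : E, σ x = ((τ x : E) : F) := by
    intro τ
    refine ⟨τ.liftNormal F, fun x => ?_⟩
    exact AlgEquiv.liftNormal_commutes τ F x
  choose σ hσ using hl
  have hcomm : ∀ τ x, δ (σ τ x) = σ τ (δ x) := by
    intro τ x
    refine derivation_comm halg δ hδ ((σ τ).restrictScalars k) ?_ x
    exact (σ τ).commutes (⟨t, mem_adjoin_simple_self k t⟩ : K)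
  let N : Fin m → F := fun j => ∏ τ : G, σ τ (c j)
  have hN0 : ∀ j, N j ≠ 0 := fun j => Finset.prod_ne_zero_iff.2 fun τ _ => by simp [hc j]
  have hNK : ∀ j, N j ∈ K := by
    intro j
    have h1 := Algebra.norm_eq_prod_automorphisms K (cE j)
    have h2 : N j = ((∏ τ : G, τ (cE j) : E) : F) := by
      simp only [N]
      refine Eq.trans ?_ (map_prod (algebraMap E F) _ _).symm
      exact Finset.prod_congr rfl fun τ _ => hσ τ (cE j)
    rw [h2, ← h1]
    exact (Algebra.norm K (cE j)).2
  have hdl : ∀ j, δ (N j) / N j = ∑ τ : G, σ τ (δ (c j) / c j) := by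
    intro j
    simp only [N]
    rw [dlog_prod δ _ _ (fun τ => by simp [hc j])]
    refine Finset.sum_congr rfl fun τ _ => ?_
    rw [hcomm, map_div₀]
  have hsum : ∀ a : Fin m → k, ∑ j, algebraMap k F (a j) * (δ (N j) / N j) =
      ∑ τ : G, σ τ (∑ j, algebraMap k F (a j) * (δ (c j) / c j)) := by
    intro a
    simp only [hdl, Finset.mul_sum, map_sum, map_mul]
    rw [Finset.sum_comm]
    refine Finset.sum_congr rfl fun τ _ => Finset.sum_congr rfl fun j _ => ?_
    congr 1
    exact ((σ τ).commutes (algebraMap k K (a j))).symm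
  choose n hn using fun j => hasValue_dlog δ ht hδ (hN0 j) (hNK j)
  refine ⟨n, ?_, ?_⟩
  · have h1 := HasValue.sum Finset.univ fun j => (hn j).const_mul (β j)
    rw [hsum, h δ] at h1
    simp only [map_zero, Finset.sum_const_zero] at h1
    exact h1.eq_zero ht
  · have h1 := HasValue.sum Finset.univ fun j => (hn j).const_mul ((b j : ℤ) : k)
    have h2 : ∑ j, algebraMap k F ((b j : ℤ) : k) * (δ (c j) / c j) = 1 := by
      have h3 : δ t / t = 1 := by rw [hδ, div_self ht0]
      rw [← h3, show δ t / t = δ (∏ j, c j ^ b j) / ∏ j, c j ^ b j by rw [hb],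
        dlog_prod δ _ _ (fun j => zpow_ne_zero _ (hc j))]
      refine Finset.sum_congr rfl fun j _ => ?_
      rw [dlog_zpow δ (hc j), map_intCast]
    rw [hsum, h2] at h1
    simp only [map_one, Finset.sum_const, Finset.card_univ, nsmul_eq_mul, mul_one] at h1
    have h3 : HasValue t ((Fintype.card G : ℕ) : F) ((Fintype.card G : ℕ) : k) :=
      ⟨0, 1, by simp, by simp⟩
    have h4 := h1.unique ht h3
    have h5 : ∑ j, b j * n j = (Fintype.card G : ℤ) := by exact_mod_cast h4
    rw [h5]
    exact_mod_cast Fintype.card_ne_zero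

end BZ

namespace BZ
open Polynomial IntermediateField

theorem isAlgebraic_adjoin_of_diff {C F : Type*} [Field C] [Field F] [Algebra C F] {t : F}
    {s : Set F} (k : IntermediateField C F) (hk : s \ {t} ⊆ k) {x : F}
    (hx : IsAlgebraic (Algebra.adjoin C s) x) : IsAlgebraic (Algebra.adjoin k {t}) x := by
  have hle : Algebra.adjoin C s ≤ (Algebra.adjoin k {t}).restrictScalars C := by
    rw [Algebra.adjoin_le_iff]
    intro y hy
    change y ∈ Algebra.adjoin k {t}
    by_cases hyt : y = t
    · exact Algebra.subset_adjoin (Set.mem_singleton_iff.2 hyt)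
    · exact (Algebra.adjoin k {t}).algebraMap_mem ⟨y, hk ⟨hy, hyt⟩⟩
  have h3 : IsAlgebraic (Algebra.adjoin k {t}) (RingHom.id F x) := by
    refine hx.ringHom_of_comp_eq (R := Algebra.adjoin C s) (S := Algebra.adjoin k {t})
      (Subalgebra.inclusion hle).toRingHom (RingHom.id F) ?_ ?_
    · exact Subalgebra.inclusion_injective hle
    · rfl
  exact h3

open scoped algebraAdjoinAdjoin in
/-- Any transcendental element is the last member of a transcendence basis. -/
theorem exists_field_below {C F : Type*} [Field C] [Field F] [Algebra C F] {t : F}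
    (ht : Transcendental C t) : ∃ k : IntermediateField C F, Transcendental k t ∧
      ∀ x : F, IsAlgebraic (Algebra.adjoin k {t}) x := by
  obtain ⟨s, hs, hb⟩ := exists_isTranscendenceBasis_superset (R := C) (s := {t})
    (by
      refine (algebraicIndependent_singleton_iff (⟨t, rfl⟩ : ({t} : Set F))).2 ?_
      exact ht)
  have hts : t ∈ s := hs rfl
  refine ⟨IntermediateField.adjoin C (s \ {t}), ?_, ?_⟩
  · have h1 := hb.1.transcendental_adjoin (s := {i | (i : F) ≠ t}) (i := ⟨t, hts⟩) (by simp)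
    have h2 : (Subtype.val '' {i : s | (i : F) ≠ t}) = s \ {t} := by
      ext x; constructor
      · rintro ⟨⟨y, hy⟩, h, rfl⟩
        exact ⟨hy, h⟩
      · rintro ⟨hx, h⟩
        exact ⟨⟨x, hx⟩, h, rfl⟩
    rw [h2] at h1
    intro h3
    exact h1 ((IsFractionRing.isAlgebraic_iff (Algebra.adjoin C (s \ {t}))
      (IntermediateField.adjoin C (s \ {t})) F).2 h3)
  · intro x
    have h1 := hb.isAlgebraic
    rw [Subtype.range_coe] at h1
    have h2 := h1.isAlgebraic x
    exact isAlgebraic_adjoin_of_diff _ (subset_adjoin _ _) h2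

theorem residue_lemma {C F : Type*} [Field C] [Field F] [CharZero F] [IsAlgClosed F]
    [Algebra C F] {m : ℕ} (c : Fin m → F) (hc : ∀ j, c j ≠ 0) (β : Fin m → C) (hβ : β ≠ 0)
    (hind : ∀ b : Fin m → ℤ, b ≠ 0 → Transcendental C (∏ j, c j ^ b j)) :
    ∃ δ : Derivation C F F, ∑ j, algebraMap C F (β j) * (δ (c j) / c j) ≠ 0 := by
  by_contra! h
  have : CharZero C := ⟨fun x y hxy => by
    have := congrArg (algebraMap C F) hxy
    simpa using this⟩
  obtain ⟨j0, hj0⟩ := Function.ne_iff.1 hβ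
  obtain ⟨φ, hφ⟩ := Module.Projective.exists_dual_ne_zero ℚ (x := β j0) hj0
  let d : ℕ := ∏ j, (φ (β j)).den
  have hd : d ≠ 0 := Finset.prod_ne_zero_iff.2 fun j _ => (φ (β j)).den_ne_zero
  have hb : ∀ j, ∃ b : ℤ, (b : ℚ) = d * φ (β j) := by
    intro j
    obtain ⟨e, he⟩ := Finset.dvd_prod_of_mem (fun j => (φ (β j)).den) (Finset.mem_univ j)
    refine ⟨e * (φ (β j)).num, ?_⟩
    have h1 : (d : ℚ) = (φ (β j)).den * e := by exact_mod_cast he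
    rw [h1]
    push_cast
    have := Rat.mul_den_eq_num (φ (β j))
    linear_combination -(e : ℚ) * this
  choose b hb using hb
  have hb0 : b ≠ 0 := by
    intro h0
    have := hb j0
    rw [h0] at this
    simp [hd] at this
    exact hφ this
  have ht := hind b hb0
  set t := ∏ j, c j ^ b j with htdef
  obtain ⟨k, hk1, hk2⟩ := exists_field_below ht
  obtain ⟨n, hn1, hn2⟩ := residue_core hk1 hk2 c hc (fun j => algebraMap C k (β j)) b htdef.symm
    (fun δ => h (δ.restrictScalars C))
  apply hn2
  have h1 : ∑ j, β j * (n j : C) = 0 := by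
    apply (algebraMap C k).injective
    rw [map_sum, map_zero, ← hn1]
    simp
  have h2 := congrArg φ h1
  rw [map_zero, map_sum] at h2
  have h3 : ∀ j, φ (β j * (n j : C)) = φ (β j) * n j := by
    intro j
    rw [mul_comm, ← zsmul_eq_mul, map_zsmul, zsmul_eq_mul, mul_comm]
  simp only [h3] at h2
  have h4 : ((∑ j, b j * n j : ℤ) : ℚ) = 0 := by
    push_cast
    simp only [hb]
    rw [← mul_zero (d : ℚ), ← h2, Finset.mul_sum]
    exact Finset.sum_congr rfl fun j _ => by ring
  exact_mod_cast h4

end BZ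

namespace BZ
open Polynomial

theorem deriv_eq_zero_of_isAlgebraic' {C F : Type*} [Field C] [Field F] [CharZero F]
    [Algebra C F] (D : Derivation C F F) {x : F} (hx : IsAlgebraic C x) : D x = 0 := by
  refine deriv_eq_zero_of_isAlgebraic D (⊥ : Subalgebra C F) ?_ ?_
  · intro a ha
    obtain ⟨b, rfl⟩ := Algebra.mem_bot.1 ha
    exact D.map_algebraMap b
  · refine hx.extendScalars (S := (⊥ : Subalgebra C F)) ?_
    exact FaithfulSMul.algebraMap_injective _ _

/-- The tuple of logarithmic derivatives, as a linear map in the derivation. -/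
noncomputable def dlogMap {C F : Type*} [Field C] [Field F] [Algebra C F] {k : ℕ}
    (c : Fin k → F) : Derivation C F F →ₗ[F] (Fin k → F) where
  toFun δ j := δ (c j) / c j
  map_add' := by intro a b; ext j; simp [add_div]
  map_smul' := by intro a b; ext j; simp [mul_div_assoc]

/-- Vectors orthogonal to all logarithmic derivatives and to `u` and `v`. -/
def AxVec {C F : Type*} [Field C] [Field F] [Algebra C F] {k : ℕ} (c : Fin k → F)
    (u v : Fin k → C) (x : Fin k → F) : Prop :=
  (∀ δ : Derivation C F F, ∑ j, x j * (δ (c j) / c j) = 0) ∧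
    ∑ j, x j * algebraMap C F (u j) = 0 ∧ ∑ j, x j * algebraMap C F (v j) = 0

theorem AxVec.smul {C F : Type*} [Field C] [Field F] [Algebra C F] {k : ℕ} {c : Fin k → F}
    {u v : Fin k → C} {x : Fin k → F} (h : AxVec c u v x) (a : F) :
    AxVec c u v (fun j => a * x j) := by
  refine ⟨fun δ => ?_, ?_, ?_⟩
  · simp only [mul_assoc, ← Finset.mul_sum, h.1 δ, mul_zero]
  · simp only [mul_assoc, ← Finset.mul_sum, h.2.1, mul_zero]
  · simp only [mul_assoc, ← Finset.mul_sum, h.2.2, mul_zero]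

theorem AxVec.deriv {C F : Type*} [Field C] [Field F] [Algebra C F] {k : ℕ} {c : Fin k → F}
    (hc : ∀ j, c j ≠ 0)
    {u v : Fin k → C} {x : Fin k → F} (h : AxVec c u v x) (D : Derivation C F F) (η1 η2 : F)
    (hD : ∀ j, D (c j) / c j = algebraMap C F (u j) * η1 + algebraMap C F (v j) * η2) :
    AxVec c u v (fun j => D (x j)) := by
  have hsum : ∀ a : Fin k → C, ∑ j, x j * algebraMap C F (a j) = 0 →
      ∑ j, D (x j) * algebraMap C F (a j) = 0 := by
    intro a ha
    have := congrArg D ha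
    rw [map_zero, map_sum] at this
    rw [← this]
    refine Finset.sum_congr rfl fun j _ => ?_
    rw [Derivation.leibniz, D.map_algebraMap]
    simp [mul_comm]
  refine ⟨fun δ => ?_, hsum u h.2.1, hsum v h.2.2⟩
  have h1 := congrArg D (h.1 δ)
  rw [map_zero, map_sum] at h1
  have h2 : ∀ j, D (δ (c j) / c j) = algebraMap C F (u j) * δ η1 + algebraMap C F (v j) * δ η2 +
      (⁅D, δ⁆ : Derivation C F F) (c j) / c j := by
    intro j
    have e1 : D (c j) = c j * (algebraMap C F (u j) * η1 + algebraMap C F (v j) * η2) := by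
      rw [← hD j, mul_div_cancel₀ _ (hc j)]
    have e2 := congrArg δ e1
    have e3 : δ (algebraMap C F (u j) * η1 + algebraMap C F (v j) * η2) =
        algebraMap C F (u j) * δ η1 + algebraMap C F (v j) * δ η2 := by
      rw [map_add, Derivation.leibniz, Derivation.leibniz, δ.map_algebraMap, δ.map_algebraMap]
      simp
    rw [Derivation.leibniz, e3, smul_eq_mul, smul_eq_mul] at e2
    set z := δ (c j) / c j with hz
    have e4 : δ (c j) = c j * z := by rw [hz, mul_div_cancel₀ _ (hc j)]
    have e5 := congrArg D e4
    rw [Derivation.leibniz, smul_eq_mul, smul_eq_mul, e1] at e5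
    rw [Derivation.commutator_apply, e2, e5, e4]
    field_simp [hc j]
    ring
  have h3 : ∀ j, D (x j * (δ (c j) / c j)) = D (x j) * (δ (c j) / c j) +
      (x j * algebraMap C F (u j)) * δ η1 + (x j * algebraMap C F (v j)) * δ η2 +
      x j * ((⁅D, δ⁆ : Derivation C F F) (c j) / c j) := by
    intro j
    rw [Derivation.leibniz, h2, smul_eq_mul, smul_eq_mul]
    ring
  simp only [h3, Finset.sum_add_distrib, ← Finset.sum_mul, h.2.1, h.2.2, h.1 ⁅D, δ⁆] at h1
  simpa using h1

theorem finrank_dlogMap_le {C F : Type*} [Field C] [Field F] [CharZero F] [Algebra C F] {k : ℕ}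
    (c : Fin k → F) (hc : ∀ j, c j ≠ 0) (J : Finset (Fin k))
    (halg : ∀ i, IsAlgebraic (Algebra.adjoin C (c '' J)) (c i)) :
    Module.finrank F (LinearMap.range (dlogMap (C := C) c)) ≤ J.card := by
  let π : (Fin k → F) →ₗ[F] (J → F) := LinearMap.funLeft F F Subtype.val
  let π' := π.domRestrict (LinearMap.range (dlogMap (C := C) c))
  have hinj : Function.Injective π' := by
    rw [injective_iff_map_eq_zero]
    rintro ⟨x, δ, rfl⟩ hx
    apply Subtype.ext
    have h1 : ∀ j ∈ J, δ (c j) = 0 := by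
      intro j hj
      have := congrFun hx ⟨j, hj⟩
      have : δ (c j) / c j = 0 := this
      rcases div_eq_zero_iff.1 this with h | h
      · exact h
      · exact absurd h (hc j)
    have h2 : ∀ a ∈ Algebra.adjoin C (c '' J), δ a = 0 := by
      intro a ha
      have : Set.EqOn δ (0 : Derivation C F F) (c '' J) := by
        rintro _ ⟨j, hj, rfl⟩
        simpa using h1 j hj
      simpa using Derivation.eqOn_adjoin this ha
    funext i
    change δ (c i) / c i = 0
    rw [deriv_eq_zero_of_isAlgebraic δ _ h2 (halg i), zero_div]
  have := LinearMap.finrank_le_finrank_of_injective hinj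
  simpa using this

theorem exists_axVec {C F : Type*} [Field C] [Field F] [CharZero F] [Algebra C F] {k : ℕ}
    (c : Fin k → F) (hc : ∀ j, c j ≠ 0) (J : Finset (Fin k)) (hJ : J.card + 1 < k)
    (halg : ∀ i, IsAlgebraic (Algebra.adjoin C (c '' J)) (c i))
    (u v : Fin k → C) (D : Derivation C F F) (η1 η2 : F) (hη : η1 ≠ 0 ∨ η2 ≠ 0)
    (hD : ∀ j, D (c j) / c j = algebraMap C F (u j) * η1 + algebraMap C F (v j) * η2) :
    ∃ x : Fin k → F, x ≠ 0 ∧ AxVec c u v x := by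
  have main : ∀ w : Fin k → F, ∃ x : Fin k → F, x ≠ 0 ∧
      (∀ δ : Derivation C F F, ∑ j, x j * (δ (c j) / c j) = 0) ∧ ∑ j, x j * w j = 0 := by
    intro w
    let V := LinearMap.range (dlogMap (C := C) c) ⊔ Submodule.span F {w}
    have hV : Module.finrank F V < Module.finrank F (Fin k → F) := by
      have h1 : Module.finrank F V ≤ _ := Submodule.finrank_add_le_finrank_add_finrank
        (LinearMap.range (dlogMap (C := C) c)) (Submodule.span F {w})
      have h2 := finrank_dlogMap_le (C := C) c hc J halg
      have h3 : Module.finrank F (Submodule.span F {w}) ≤ 1 := by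
        simpa using finrank_span_le_card ({w} : Set (Fin k → F))
      rw [Module.finrank_fin_fun]
      omega
    have hlt : V < ⊤ := lt_top_iff_ne_top.2 (by
      intro h
      rw [h, finrank_top] at hV
      exact lt_irrefl _ hV)
    obtain ⟨f, hf0, hf⟩ := Submodule.exists_le_ker_of_lt_top V hlt
    have hfe : ∀ y : Fin k → F, f y = ∑ j, f (Pi.single j 1) * y j := by
      intro y
      conv_lhs => rw [← Finset.univ_sum_single y]
      rw [map_sum]
      refine Finset.sum_congr rfl fun j _ => ?_
      rw [show Pi.single j (y j) = y j • (Pi.single j 1 : Fin k → F) by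
        rw [← Pi.single_smul, smul_eq_mul, mul_one], map_smul, smul_eq_mul, mul_comm]
    refine ⟨fun j => f (Pi.single j 1), ?_, ?_, ?_⟩
    · intro h0
      apply hf0
      ext y
      simp [congrFun h0 _]
    · intro δ
      have : f (dlogMap c δ) = 0 := hf (Submodule.mem_sup_left ⟨δ, rfl⟩)
      rw [hfe] at this
      exact this
    · have : f w = 0 := hf (Submodule.mem_sup_right (Submodule.mem_span_singleton_self w))
      rw [hfe] at this
      exact this
  have hx : ∀ x : Fin k → F, (∀ δ : Derivation C F F, ∑ j, x j * (δ (c j) / c j) = 0) →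
      (∑ j, x j * algebraMap C F (u j)) * η1 + (∑ j, x j * algebraMap C F (v j)) * η2 = 0 := by
    intro x h
    rw [← h D, Finset.sum_mul, Finset.sum_mul, ← Finset.sum_add_distrib]
    refine Finset.sum_congr rfl fun j _ => ?_
    rw [hD]; ring
  rcases hη with hη | hη
  · obtain ⟨x, hx0, h1, h2⟩ := main (fun j => algebraMap C F (v j))
    refine ⟨x, hx0, h1, ?_, h2⟩
    have := hx x h1
    rw [h2, zero_mul, add_zero] at this
    exact (mul_eq_zero.1 this).resolve_right hη
  · obtain ⟨x, hx0, h1, h2⟩ := main (fun j => algebraMap C F (u j))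
    refine ⟨x, hx0, h1, h2, ?_⟩
    have := hx x h1
    rw [h2, zero_mul, zero_add] at this
    exact (mul_eq_zero.1 this).resolve_right hη

theorem ax {C F : Type*} [Field C] [Field F] [CharZero F] [IsAlgClosed F] [Algebra C F]
    (D : Derivation C F F) (hC : ∀ x, D x = 0 → ∃ a, algebraMap C F a = x) {k : ℕ}
    (c : Fin k → F) (hc : ∀ j, c j ≠ 0) (u v : Fin k → C) (η1 η2 : F)
    (hD : ∀ j, D (c j) / c j = algebraMap C F (u j) * η1 + algebraMap C F (v j) * η2)
    (hind : ∀ b : Fin k → ℤ, b ≠ 0 → D (∏ j, c j ^ b j) ≠ 0) :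
    ∃ J : Finset (Fin k), k ≤ J.card + 1 ∧ AlgebraicIndepOn C c (J : Set (Fin k)) := by
  classical
  have hne : (Finset.univ.filter fun J : Finset (Fin k) =>
      AlgebraicIndepOn C c (J : Set (Fin k))).Nonempty := by
    refine ⟨∅, Finset.mem_filter.2 ⟨Finset.mem_univ _, ?_⟩⟩
    have : IsEmpty ((∅ : Finset (Fin k)) : Set (Fin k)) := by simp
    exact algebraicIndependent_empty_type_iff.2 (FaithfulSMul.algebraMap_injective C F)
  obtain ⟨J, hJ, hmax⟩ := Finset.exists_max_image _ Finset.card hne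
  rw [Finset.mem_filter] at hJ
  refine ⟨J, ?_, hJ.2⟩
  by_contra! hlt
  have halg : ∀ i, IsAlgebraic (Algebra.adjoin C (c '' J)) (c i) := by
    intro i
    by_contra htr
    have hi : i ∉ J := by
      intro hi
      exact htr (isAlgebraic_algebraMap
        (⟨_, Algebra.subset_adjoin ⟨i, hi, rfl⟩⟩ : Algebra.adjoin C (c '' J)))
    have h1 : AlgebraicIndepOn C c (insert i (J : Set (Fin k))) := AlgebraicIndepOn.insert hJ.2 htr
    rw [← Finset.coe_insert] at h1
    have := hmax (insert i J) (Finset.mem_filter.2 ⟨Finset.mem_univ _, h1⟩)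
    rw [Finset.card_insert_of_notMem hi] at this
    omega
  have hη : η1 ≠ 0 ∨ η2 ≠ 0 := by
    by_contra! h0
    let j0 : Fin k := ⟨0, by omega⟩
    refine hind (Pi.single j0 1) (by simp) ?_
    have h1 : ∏ j, c j ^ (Pi.single j0 1 : Fin k → ℤ) j = c j0 := by
      rw [Finset.prod_eq_single j0]
      · simp
      · intro b _ hb; simp [hb]
      · simp
    have h2 := hD j0
    rw [h0.1, h0.2, mul_zero, mul_zero, add_zero, div_eq_zero_iff] at h2
    rw [h1]
    exact h2.resolve_right (hc j0)
  obtain ⟨x0, hx0⟩ := exists_axVec c hc J hlt halg u v D η1 η2 hη hD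
  let supp : (Fin k → F) → Finset (Fin k) := fun x => Finset.univ.filter fun j => x j ≠ 0
  have hex : ∃ n, ∃ x : Fin k → F, x ≠ 0 ∧ AxVec c u v x ∧ (supp x).card = n :=
    ⟨_, x0, hx0.1, hx0.2, rfl⟩
  obtain ⟨x, hx1, hx2, hx3⟩ := Nat.find_spec hex
  obtain ⟨j0, hj0⟩ := Function.ne_iff.1 hx1
  have hj0' : x j0 ≠ 0 := hj0
  have hy := hx2.smul (x j0)⁻¹
  set y : Fin k → F := fun j => (x j0)⁻¹ * x j with hydef
  have hyj : y j0 = 1 := by simp [hydef, hj0']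
  have hDy := hy.deriv hc D η1 η2 hD
  have hDy0 : ∀ j, D (y j) = 0 := by
    by_contra! hne
    obtain ⟨j1, hj1⟩ := hne
    refine Nat.find_min hex (m := (supp fun j => D (y j)).card) ?_
      ⟨_, Function.ne_iff.2 ⟨j1, hj1⟩, hDy, rfl⟩
    rw [← hx3]
    apply Finset.card_lt_card
    rw [Finset.ssubset_iff_of_subset]
    · refine ⟨j0, by simp [supp, hj0'], ?_⟩
      simp [supp, hyj]
    · intro j hj
      simp only [supp, Finset.mem_filter, Finset.mem_univ, true_and] at hj ⊢
      intro h0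
      apply hj
      simp [hydef, h0]
  choose β hβ using fun j => hC (y j) (hDy0 j)
  obtain ⟨δ, hδ⟩ := residue_lemma c hc β
    (Function.ne_iff.2 ⟨j0, fun h => by
      have := hβ j0
      rw [h, hyj] at this
      simp at this⟩)
    (fun b hb halg' => hind b hb (deriv_eq_zero_of_isAlgebraic' D halg'))
  apply hδ
  simp only [hβ]
  exact hy.1 δ

end BZ

namespace BZ
open Module

/-- The field of constants of a derivation. -/
def constField {F : Type*} [Field F] (D : Derivation ℤ F F) : Subfield F where
  carrier := {x | D x = 0}
  mul_mem' := by
    intro a b ha hb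
    simp only [Set.mem_ofPred_eq] at *
    simp [ha, hb]
  one_mem' := by simp
  add_mem' := by
    intro a b ha hb
    simp only [Set.mem_ofPred_eq] at *
    simp [ha, hb]
  zero_mem' := by simp
  neg_mem' := by
    intro a ha
    simp only [Set.mem_ofPred_eq] at *
    simp [ha]
  inv_mem' := by
    intro a ha
    simp only [Set.mem_ofPred_eq] at *
    simp [Derivation.leibniz_inv, ha]

/-- A derivation is linear over its constants. -/
noncomputable def constDeriv {F : Type*} [Field F] (D : Derivation ℤ F F) :
    Derivation (constField D) F F :=
  Derivation.mk' { toFun := D, map_add' := map_add D, map_smul' := by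
                    intro r x
                    have : D (r : F) = 0 := r.2
                    simp [Subfield.smul_def, this] } (by
    intro a b
    simp)

@[simp] theorem constDeriv_apply {F : Type*} [Field F] (D : Derivation ℤ F F) (x : F) :
    constDeriv D x = D x := rfl

theorem char_dlog_add {L F : Type*} [AddCommGroup L] [Field F] (D : Derivation ℤ F F)
    (c : AddChar L F) (a b : L) : D (c (a + b)) / c (a + b) = D (c a) / c a + D (c b) / c b := by
  have ha := char_ne_zero c a
  have hb := char_ne_zero c b
  rw [AddChar.map_add_eq_mul, Derivation.leibniz]
  simp only [smul_eq_mul]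
  field_simp
  ring

/-- The logarithmic derivative of a character. -/
noncomputable def charDlog {L F : Type*} [AddCommGroup L] [Field F] (D : Derivation ℤ F F)
    (c : AddChar L F) : L →ₗ[ℤ] F :=
  (AddMonoidHom.mk' (fun m => D (c m) / c m) (char_dlog_add D c)).toIntLinearMap

theorem charDlog_apply {L F : Type*} [AddCommGroup L] [Field F] (D : Derivation ℤ F F)
    (c : AddChar L F) (m : L) : charDlog D c m = D (c m) / c m := rfl

theorem charDlog_eq_zero {L F : Type*} [AddCommGroup L] [Field F] (D : Derivation ℤ F F)
    (c : AddChar L F) (m : L) : charDlog D c m = 0 ↔ D (c m) = 0 := by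
  rw [charDlog_apply, div_eq_zero_iff, or_iff_left (char_ne_zero c m)]

theorem char_sum {L F ι : Type*} [AddCommGroup L] [Field F] (c : AddChar L F) (s : Finset ι)
    (b : ι → ℤ) (l : ι → L) : c (∑ j ∈ s, b j • l j) = ∏ j ∈ s, c (l j) ^ b j := by
  classical
  induction s using Finset.induction_on with
  | empty => simp
  | insert a s ha ih =>
    rw [Finset.sum_insert ha, Finset.prod_insert ha, AddChar.map_add_eq_mul, ih,
      AddChar.map_zsmul_eq_zpow]

/-- If the logarithmic derivatives of a character killed by a family of codimension two span a
plane over the constants, then the constant values satisfy an algebraic relation. -/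
theorem exists_const_relation {L : Type} [AddCommGroup L] [Free ℤ L] [Module.Finite ℤ L]
    {fam : Finset (L →₀ ℤ)} (hfam : Codim2 fam) {F : Type} [Field F] [CharZero F] [IsAlgClosed F]
    (D : Derivation ℤ F F) (c : AddChar L F) (hk : Kills fam c) (u v : L → F)
    (hu : ∀ m, D (u m) = 0) (hv : ∀ m, D (v m) = 0) (η1 η2 : F)
    (hD : ∀ m, D (c m) / c m = u m * η1 + v m * η2) :
    ∃ f1 : LinearMap.ker (charDlog D c) →₀ ℤ, f1 ≠ 0 ∧ ev (resChar _ c) f1 = 0 := by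
  classical
  set Lc := LinearMap.ker (charDlog D c) with hLc
  by_contra hcon
  push Not at hcon
  have : IsTorsionFree ℤ (L ⧸ Lc) := by
    refine IsTorsionFree.of_smul_eq_zero ?_
    intro r x h
    obtain ⟨m, rfl⟩ := Submodule.mkQ_surjective Lc x
    rw [← map_smul, Submodule.mkQ_apply, Submodule.Quotient.mk_eq_zero, hLc, LinearMap.mem_ker,
      map_smul, smul_eq_zero] at h
    rcases h with h | h
    · exact Or.inl h
    · right
      rw [Submodule.mkQ_apply, Submodule.Quotient.mk_eq_zero]
      exact h
  have : Free ℤ (L ⧸ Lc) := Module.free_of_finite_type_torsion_free'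
  have e := finBasis ℤ Lc
  have q := finBasis ℤ (L ⧸ Lc)
  have hrk : finrank ℤ (L ⧸ Lc) + finrank ℤ Lc = finrank ℤ L :=
    Submodule.finrank_quotient_add_finrank Lc
  have hl : ∀ j, ∃ l : L, Lc.mkQ l = q j := fun j => Submodule.mkQ_surjective Lc (q j)
  choose l hl using hl
  obtain ⟨J, hJ, hind⟩ := ax (C := constField D) (constDeriv D)
    (fun x hx => ⟨⟨x, hx⟩, rfl⟩) (fun j => c (l j)) (fun j => char_ne_zero c _)
    (fun j => ⟨u (l j), hu _⟩) (fun j => ⟨v (l j), hv _⟩) η1 η2 (fun j => hD (l j)) (by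
      intro b hb h0
      rw [← char_sum, constDeriv_apply, ← charDlog_eq_zero] at h0
      have h1 : ∑ j, b j • l j ∈ Lc := h0
      have h2 : Lc.mkQ (∑ j, b j • l j) = 0 := (Submodule.Quotient.mk_eq_zero _).2 h1
      rw [map_sum] at h2
      simp only [map_smul, hl] at h2
      exact hb (funext fun j => linearIndependent_iff'.1 q.linearIndependent _ _ h2 j
        (Finset.mem_univ j)))
  have hcmem : ∀ m : Lc, c m ∈ constField D := fun m =>
    (charDlog_eq_zero D c m).1 m.2
  have hai : AlgebraicIndependent ℤ
      (fun i => (⟨c (e i), hcmem (e i)⟩ : constField D)) := by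
    rw [algebraicIndependent_iff]
    intro p hp
    by_contra hp0
    have hinj : Function.Injective
        (fun α : (Fin (finrank ℤ Lc)) →₀ ℕ => ∑ i, (α i : ℤ) • e i) := by
      intro α β h
      ext i
      have := congrArg (fun x => e.repr x i) h
      simpa [Finsupp.single_apply] using this
    obtain ⟨α, hα⟩ := MvPolynomial.ne_zero_iff.1 hp0
    let g : (Fin (finrank ℤ Lc) →₀ ℕ) →₀ ℤ := Finsupp.onFinset p.support (fun α => p.coeff α)
      (fun a ha => MvPolynomial.mem_support_iff.2 ha)
    refine hcon (g.embDomain ⟨_, hinj⟩) (fun h0 => hα ?_) ?_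
    · have := congrArg (fun x => x (∑ i, (α i : ℤ) • e i)) h0
      have h2 := Finsupp.embDomain_apply_self ⟨_, hinj⟩ g α
      simp only [Function.Embedding.coeFn_mk] at h2
      rw [h2] at this
      exact this
    · have h3 := congrArg (fun x : constField D => (x : F)) hp
      simp only [MvPolynomial.aeval_def, MvPolynomial.eval₂_eq'] at h3
      rw [ev, Finsupp.sum_embDomain, Finsupp.onFinset_sum]
      · push_cast at h3
        rw [← h3]
        refine Finset.sum_congr rfl fun α _ => ?_
        simp only [Function.Embedding.coeFn_mk, char_sum, resChar_apply]
        simp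
      · simp
  have : Algebra.IsAlgebraic ℤ ℚ := IsLocalization.isAlgebraic ℚ (nonZeroDivisors ℤ)
  have hai2 := (Algebra.IsAlgebraic.algebraicIndependent_iff ℤ ℚ).1 hai
  have hsum := AlgebraicIndependent.sumElim_comp hai2 hind
  have := hfam F c hk (Fin (finrank ℤ Lc) ⊕ J) (Sum.elim (fun i => (e i : L)) (fun j => l j)) (by
    have h4 := hsum.comp _ (Equiv.sumComm (Fin (finrank ℤ Lc)) J).injective
    have h5 : (fun i => c (Sum.elim (fun i => (e i : L)) (fun j : J => l j) i)) =
        Sum.elim (fun j : J => c (l j)) (algebraMap (constField D) F ∘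
          fun i => ⟨c (e i), hcmem (e i)⟩) ∘ Equiv.sumComm (Fin (finrank ℤ Lc)) J := by
      ext i
      rcases i with i | i <;> rfl
    rw [h5]
    exact h4)
  simp only [Fintype.card_sum, Fintype.card_fin, Fintype.card_coe] at this
  omega
end BZ

namespace BZ
open Module Filter

section Ultra
variable {φ : Ultrafilter ℕ} {F : Type} [Field F]

instance germ_charZero [CharZero F] : CharZero (Germ (φ : Filter ℕ) F) := by
  refine ⟨fun a b h => ?_⟩
  rw [← Germ.natCast_def, ← Germ.natCast_def] at h
  exact Nat.cast_injective (Germ.const_inj.1 h)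

instance germ_isAlgClosed [IsAlgClosed F] : IsAlgClosed (Germ (φ : Filter ℕ) F) := by
  refine IsAlgClosed.of_exists_root _ fun p hp hirr => ?_
  have hlift : p ∈ Polynomial.lifts (Germ.coeRingHom (φ : Filter ℕ) (R := F)) := by
    rw [Polynomial.lifts_iff_coeff_lifts]
    intro n
    induction p.coeff n using Germ.inductionOn with
    | h f => exact ⟨f, rfl⟩
  obtain ⟨q, hq, hdeg, hmon⟩ := Polynomial.lifts_and_degree_eq_and_monic hlift hp
  have hroot : ∀ n, ∃ x : F, Polynomial.eval x (q.map (Pi.evalRingHom _ n)) = 0 := by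
    intro n
    refine IsAlgClosed.exists_root _ ?_
    rw [hmon.degree_map, hdeg]
    exact (Polynomial.degree_pos_of_irreducible hirr).ne'
  choose x hx using hroot
  refine ⟨Germ.coeRingHom (φ : Filter ℕ) x, ?_⟩
  rw [← hq, Polynomial.eval_map, Polynomial.eval₂_hom]
  have : Polynomial.eval x q = 0 := by
    ext n
    have h1 := hx n
    rw [Polynomial.eval_map] at h1
    have h2 := Polynomial.hom_eval₂ q (RingHom.id _) (Pi.evalRingHom (fun _ : ℕ => F) n) x
    rw [RingHom.comp_id] at h2
    rw [← Polynomial.eval₂_id]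
    exact h2.trans h1
  rw [this, map_zero]

/-- The derivation on an ultrapower. -/
noncomputable def germDeriv (φ : Ultrafilter ℕ) (D : Derivation ℤ F F) :
    Derivation ℤ (Germ (φ : Filter ℕ) F) (Germ (φ : Filter ℕ) F) :=
  Derivation.mk' (AddMonoidHom.toIntLinearMap (AddMonoidHom.mk' (Germ.map D) (by
    intro a b
    induction a using Germ.inductionOn with
    | h f =>
    induction b using Germ.inductionOn with
    | h g =>
    rw [← Germ.coe_add, Germ.map_coe, Germ.map_coe, Germ.map_coe, ← Germ.coe_add]
    congr 1
    ext n
    simp))) (by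
    intro a b
    induction a using Germ.inductionOn with
    | h f =>
    induction b using Germ.inductionOn with
    | h g =>
    simp only [AddMonoidHom.coe_toIntLinearMap, AddMonoidHom.mk'_apply, smul_eq_mul]
    rw [← Germ.coe_mul, Germ.map_coe, Germ.map_coe, Germ.map_coe, ← Germ.coe_mul, ← Germ.coe_mul,
      ← Germ.coe_add]
    congr 1
    ext n
    simp)

theorem germDeriv_coe (D : Derivation ℤ F F) (f : ℕ → F) :
    germDeriv φ D (f : Germ (φ : Filter ℕ) F) = ((fun n => D (f n) : ℕ → F) : Germ _ F) := rfl

/-- The ultraproduct of a sequence of characters. -/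
noncomputable def germChar {L : Type*} [AddCommGroup L] (φ : Ultrafilter ℕ) (c : ℕ → AddChar L F) :
    AddChar L (Germ (φ : Filter ℕ) F) where
  toFun m := ((fun n => c n m : ℕ → F) : Germ _ F)
  map_zero_eq_one' := by
    simp
    rfl
  map_add_eq_mul' a b := by
    simp only [AddChar.map_add_eq_mul]
    rfl

theorem germChar_apply {L : Type*} [AddCommGroup L] (c : ℕ → AddChar L F) (m : L) :
    germChar φ c m = ((fun n => c n m : ℕ → F) : Germ _ F) := rfl

theorem ev_germChar {L : Type*} [AddCommGroup L] (c : ℕ → AddChar L F) (f : L →₀ ℤ) :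
    ev (germChar φ c) f = ((fun n => ev (c n) f : ℕ → F) : Germ _ F) := by
  have : (fun n => ev (c n) f : ℕ → F) = ∑ m ∈ f.support, (f m : ℕ → F) * (fun n => c n m) := by
    ext n
    simp [ev_eq_sum]
  rw [this]
  change _ = Germ.coeRingHom (φ : Filter ℕ) _
  rw [map_sum, ev_eq_sum]
  refine Finset.sum_congr rfl fun m _ => ?_
  rw [map_mul, map_intCast]
  rfl
end Ultra

theorem dlog_relation_or {L : Type} [AddCommGroup L] [Free ℤ L] [Module.Finite ℤ L]
    {fam : Finset (L →₀ ℤ)} (hfam : Codim2 fam) {Ω : Type} [Field Ω] [CharZero Ω]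
    [IsAlgClosed Ω] [Algebra ℂ Ω] (D : Derivation ℂ Ω Ω) :
    ∃ S : Finset L, 0 ∉ S ∧ ∀ (ω : AddChar L ℂ) (u v : L →ₗ[ℤ] ℤ) (y z : Ω) (c : AddChar L Ω),
      IsTors ω → y ≠ 0 → z ≠ 0 → (∀ m, c m = algebraMap ℂ Ω (ω m) * y ^ (u m) * z ^ (v m)) →
      Kills fam c → (∃ i j : ℤ, (i ≠ 0 ∨ j ≠ 0) ∧ i * (D y / y) + j * (D z / z) = 0) ∨
        ∃ s ∈ S, ω s = 1 ∧ u s = 0 ∧ v s = 0 := by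
  classical
  by_contra hcon
  push Not at hcon
  have : Countable L := (finBasis ℤ L).equivFun.toEquiv.countable_iff.2 inferInstance
  obtain ⟨en, hen⟩ := exists_surjective_nat L
  have hcon' := fun n : ℕ => hcon (((Finset.range n).image en).erase 0) (by simp)
  choose ω u v y z c hω hy hz hc hk hrel hS using hcon'
  set φ := hyperfilter ℕ with hφ
  let D0 : Derivation ℤ Ω Ω := D.restrictScalars ℤ
  have hD0 : ∀ x, D0 x = D x := fun x => rfl
  have hdlog : ∀ n m, D (c n m) / c n m =
      (u n m : Ω) * (D (y n) / y n) + (v n m : Ω) * (D (z n) / z n) := by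
    intro n m
    have hω0 : algebraMap ℂ Ω (ω n m) ≠ 0 := by
      rw [ne_eq, map_eq_zero_iff _ (algebraMap ℂ Ω).injective]
      exact char_ne_zero _ _
    rw [hc, dlog_mul _ (mul_ne_zero hω0 (zpow_ne_zero _ (hy n))) (zpow_ne_zero _ (hz n)),
      dlog_mul _ hω0 (zpow_ne_zero _ (hy n)), dlog_zpow _ (hy n), dlog_zpow _ (hz n)]
    simp
  obtain ⟨Lc, hLc, f1, hf1, hev⟩ : ∃ Lc : Submodule ℤ L,
      Lc = LinearMap.ker (charDlog (germDeriv φ D0) (germChar φ c)) ∧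
      ∃ f1 : Lc →₀ ℤ, f1 ≠ 0 ∧ ev (resChar Lc (germChar φ c)) f1 = 0 := ⟨_, rfl,
    exists_const_relation hfam (germDeriv φ D0) (germChar φ c)
    (by
      intro f hf
      rw [ev_germChar]
      have : (fun n => ev (c n) f : ℕ → Ω) = 0 := funext fun n => hk n f hf
      rw [this]; rfl)
    (fun m => ((fun n => (u n m : Ω) : ℕ → Ω) : Germ _ Ω))
    (fun m => ((fun n => (v n m : Ω) : ℕ → Ω) : Germ _ Ω))
    (fun m => by
      rw [germDeriv_coe]
      simp only [hD0, Derivation.map_intCast]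
      rfl)
    (fun m => by
      rw [germDeriv_coe]
      simp only [hD0, Derivation.map_intCast]
      rfl)
    ((fun n => D (y n) / y n : ℕ → Ω) : Germ _ Ω) ((fun n => D (z n) / z n : ℕ → Ω) : Germ _ Ω)
    (fun m => by
      rw [germChar_apply, germDeriv_coe, ← Germ.coe_div, ← Germ.coe_mul, ← Germ.coe_mul,
        ← Germ.coe_add]
      congr 1
      ext n
      exact hdlog n m)⟩
  have hmem : ∀ m : Lc, ∀ᶠ n in (φ : Filter ℕ), u n m = 0 ∧ v n m = 0 := by
    intro m
    have h1 := (charDlog_eq_zero _ _ _).1 (LinearMap.mem_ker.1 (hLc.le m.2))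
    rw [germChar_apply, germDeriv_coe] at h1
    have h2 := Germ.coe_eq.1 (h1.trans Germ.coe_zero.symm)
    filter_upwards [h2] with n hn
    simp only [hD0, Pi.zero_apply] at hn
    have h3 := hdlog n m
    rw [hn, zero_div] at h3
    by_contra h4
    exact hrel n (u n m) (v n m) (by tauto) h3.symm
  have hfin : ∀ T : Finset Lc, ∀ᶠ n in (φ : Filter ℕ), ∀ m ∈ T, u n m = 0 ∧ v n m = 0 :=
    fun T => (Filter.eventually_all_finset T).2 fun m _ => hmem m
  obtain ⟨S1, hS1, hS1'⟩ := torsion_lemma hf1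
  have hin : ∀ᶠ n in (φ : Filter ℕ), ∀ s ∈ S1, (s : L) ∈ (Finset.range n).image en := by
    refine (Filter.eventually_all_finset S1).2 fun s _ => ?_
    obtain ⟨i, hi⟩ := hen s
    refine Nat.hyperfilter_le_atTop ?_
    filter_upwards [eventually_gt_atTop i] with n hn
    exact Finset.mem_image.2 ⟨i, Finset.mem_range.2 hn, hi⟩
  have hev' : ∀ᶠ n in (φ : Filter ℕ), ev (resChar Lc (c n)) f1 = 0 :=
    Germ.coe_eq.1 ((ev_germChar (φ := φ) (fun n => resChar Lc (c n)) f1).symm.trans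
      (hev.trans Germ.coe_zero.symm))
  obtain ⟨n, h1, h2, h3, h4⟩ := (hev'.and ((hfin f1.support).and ((hfin S1).and hin))).exists
  have h5 : ev (resChar Lc (ω n)) f1 = 0 := by
    apply (algebraMap ℂ Ω).injective
    rw [map_zero, ← h1, ev_eq_sum, ev_eq_sum, map_sum]
    refine Finset.sum_congr rfl fun m hm => ?_
    rw [map_mul, map_intCast, resChar_apply, resChar_apply, hc, (h2 m hm).1, (h2 m hm).2]
    simp
  obtain ⟨M, hM, hM'⟩ := hω n
  obtain ⟨s, hs, hs1⟩ := hS1' (resChar Lc (ω n)) ⟨M, hM, fun m => hM' m⟩ h5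
  refine hS n s (Finset.mem_erase.2 ⟨?_, h4 s hs⟩) hs1 (h3 s hs).1 (h3 s hs).2
  intro h0
  exact hS1 (by rwa [← (Subtype.ext h0 : s = 0)])
end BZ

namespace BZ
open Module Polynomial

theorem exists_eq_algebraMap_of_isAlgebraic {k F : Type*} [Field k] [IsAlgClosed k] [Field F]
    [Algebra k F] {x : F} (hx : IsAlgebraic k x) : ∃ a, algebraMap k F a = x :=
  minpoly.mem_range_of_degree_eq_one k x
    (IsAlgClosed.degree_eq_one_of_irreducible k (minpoly.irreducible hx.isIntegral))

/-- A function field in one variable embeds into any algebraically closed field containing a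
transcendental element, and a chosen transcendental element can be sent to that element. -/
theorem exists_algHom_of_trdeg_one {k F Ω : Type*} [Field k] [Field F] [Algebra k F] [Field Ω]
    [IsAlgClosed Ω] [Algebra k Ω] (t : Ω) (ht : Transcendental k t) (x : Fin 2 → F)
    (hgen : ∀ a : F, ∃ p q : MvPolynomial (Fin 2) k,
      a = MvPolynomial.aeval x p / MvPolynomial.aeval x q)
    (hdep : ¬ AlgebraicIndependent k x) (i : Fin 2) (hi : Transcendental k (x i)) :
    ∃ τ : F →ₐ[k] Ω, τ (x i) = t := by
  let : Algebra k[X] F := (aeval (x i) : k[X] →ₐ[k] F).toRingHom.toAlgebra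
  let : Algebra k[X] Ω := (aeval t : k[X] →ₐ[k] Ω).toRingHom.toAlgebra
  have hmapF : ∀ p : k[X], algebraMap k[X] F p = aeval (x i) p := fun p => rfl
  have hmapΩ : ∀ p : k[X], algebraMap k[X] Ω p = aeval t p := fun p => rfl
  have : IsScalarTower k k[X] F := IsScalarTower.of_algebraMap_eq (fun a => by
    rw [hmapF]; simp)
  have : IsScalarTower k k[X] Ω := IsScalarTower.of_algebraMap_eq (fun a => by
    rw [hmapΩ]; simp)
  have hinjF : Function.Injective (algebraMap k[X] F) := transcendental_iff_injective.1 hi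
  have hinjΩ : Function.Injective (algebraMap k[X] Ω) := transcendental_iff_injective.1 ht
  have : FaithfulSMul k[X] F := (faithfulSMul_iff_algebraMap_injective _ _).2 hinjF
  have : FaithfulSMul k[X] Ω := (faithfulSMul_iff_algebraMap_injective _ _).2 hinjΩ
  have hxi : IsAlgebraic k[X] (x i) := by
    have : x i = algebraMap k[X] F X := by rw [hmapF]; simp
    rw [this]
    exact isAlgebraic_algebraMap _
  have hother : ∀ j, IsAlgebraic k[X] (x j) := by
    intro j
    by_cases hij : j = i
    · rw [hij]; exact hxi
    by_contra htr
    apply hdep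
    have h1 : AlgebraicIndependent k (fun _ : Unit => x i) :=
      algebraicIndependent_unique_type_iff.2 hi
    have h2 : Transcendental (Algebra.adjoin k (Set.range fun _ : Unit => x i)) (x j) := by
      intro halg
      apply htr
      have hr : (aeval (x i) : k[X] →ₐ[k] F).range =
          Algebra.adjoin k (Set.range fun _ : Unit => x i) := by
        rw [Set.range_const, Algebra.adjoin_singleton_eq_range_aeval]
      rw [← hr] at halg
      refine IsAlgebraic.of_ringHom_of_comp_eq (aeval (x i) : k[X] →ₐ[k] F).rangeRestrict
        (RingHom.id F) (a := x j) halg (AlgHom.rangeRestrict_surjective _) Function.injective_id ?_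
      rfl
    have h3 := (AlgebraicIndependent.option_iff_transcendental h1 (x j)).2 h2
    have h4 := h3.comp (fun l : Fin 2 => if l = i then some () else none) (by
      intro a b hab
      simp only at hab
      split_ifs at hab <;> omega)
    convert h4 using 1
    ext l
    by_cases hl : l = i
    · simp [hl]
    · have : l = j := by omega
      simp [this, hij]
  have hpoly : ∀ p : MvPolynomial (Fin 2) k, IsAlgebraic k[X] (MvPolynomial.aeval x p) := by
    intro p
    induction p using MvPolynomial.induction_on with
    | C a =>
      rw [MvPolynomial.algHom_C, IsScalarTower.algebraMap_apply k k[X] F]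
      exact isAlgebraic_algebraMap _
    | add p q hp hq => rw [map_add]; exact hp.add hq
    | mul_X p j hp =>
      rw [map_mul, MvPolynomial.aeval_X]
      exact hp.mul (hother j)
  have : Algebra.IsAlgebraic k[X] F := ⟨fun a => by
    obtain ⟨p, q, rfl⟩ := hgen a
    rw [div_eq_mul_inv]
    exact (hpoly p).mul (hpoly q).inv⟩
  let τ : F →ₐ[k[X]] Ω := IsAlgClosed.lift
  refine ⟨τ.restrictScalars k, ?_⟩
  have : x i = algebraMap k[X] F X := by rw [hmapF]; simp
  rw [AlgHom.restrictScalars_apply, this, τ.commutes, hmapΩ, aeval_X]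

theorem exists_generic_point {Ω : Type*} [Field Ω] [IsAlgClosed Ω] [Algebra ℂ Ω] (t : Ω)
    (ht : Transcendental ℂ t) (g : MvPolynomial (Fin 2) ℂ) (hg : Irreducible g) :
    ∃ y : Fin 2 → Ω, (∃ i, y i = t) ∧ ∀ h, MvPolynomial.aeval y h = 0 ↔ g ∣ h := by
  let I : Ideal (MvPolynomial (Fin 2) ℂ) := Ideal.span {g}
  have : I.IsPrime := (Ideal.span_singleton_prime hg.ne_zero).2 hg.prime
  let R := MvPolynomial (Fin 2) ℂ ⧸ I
  let F := FractionRing R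
  let x : Fin 2 → F := fun i => algebraMap R F (Ideal.Quotient.mk I (MvPolynomial.X i))
  have hx : ∀ h, MvPolynomial.aeval x h = algebraMap R F (Ideal.Quotient.mk I h) := by
    intro h
    have : MvPolynomial.aeval x = (IsScalarTower.toAlgHom ℂ R F).comp
        (Ideal.Quotient.mkₐ ℂ I) := by
      apply MvPolynomial.algHom_ext
      intro i
      simp only [MvPolynomial.aeval_X, x]
      rfl
    rw [this]
    rfl
  have hx0 : ∀ h, MvPolynomial.aeval x h = 0 ↔ g ∣ h := by
    intro h
    rw [hx, map_eq_zero_iff _ (IsFractionRing.injective R F), Ideal.Quotient.eq_zero_iff_mem,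
      Ideal.mem_span_singleton]
  have hsome : ∃ i, Transcendental ℂ (x i) := by
    by_contra hcon
    push Not at hcon
    have h1 : ∀ i, ∃ a : ℂ, algebraMap ℂ F a = x i := fun i =>
      exists_eq_algebraMap_of_isAlgebraic (not_not.1 (hcon i))
    choose a ha using h1
    have h2 : ∀ i, g ∣ MvPolynomial.X i - MvPolynomial.C (a i) := fun i => by
      rw [← hx0]; simp [ha]
    have h3 : ∀ i j, i ≠ j → MvPolynomial.degreeOf j g = 0 := by
      intro i j hij
      obtain ⟨q, hq⟩ := h2 i
      have hne : MvPolynomial.X i - MvPolynomial.C (a i) ≠ 0 := by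
        intro h0
        have := congrArg (MvPolynomial.eval (fun _ => a i + 1)) h0
        simp at this
      have hq0 : q ≠ 0 := by
        rintro rfl
        simp [hne] at hq
      have := MvPolynomial.degreeOf_mul_eq (n := j) hg.ne_zero hq0
      rw [← hq] at this
      have h4 : MvPolynomial.degreeOf j (MvPolynomial.X i - MvPolynomial.C (a i)) ≤ 0 := by
        rw [sub_eq_add_neg, ← map_neg]
        refine (MvPolynomial.degreeOf_add_le _ _ _).trans ?_
        simp [MvPolynomial.degreeOf_X_of_ne (Ne.symm hij)]
      omega
    have h5 : g.totalDegree = 0 := by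
      rw [MvPolynomial.totalDegree_eq_zero_iff]
      intro m hm i
      have h6 := MvPolynomial.monomial_le_degreeOf i hm
      rw [h3 (i + 1) i (by fin_cases i <;> decide)] at h6
      omega
    rw [MvPolynomial.totalDegree_eq_zero_iff_eq_C] at h5
    apply hg.not_isUnit
    rw [h5]
    refine IsUnit.map _ (isUnit_iff_ne_zero.2 fun h0 => hg.ne_zero ?_)
    rw [h5, h0, map_zero]
  obtain ⟨i, hi⟩ := hsome
  have hgen : ∀ a : F, ∃ p q : MvPolynomial (Fin 2) ℂ,
      a = MvPolynomial.aeval x p / MvPolynomial.aeval x q := by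
    intro a
    obtain ⟨p, q, _, rfl⟩ := IsFractionRing.div_surjective (A := R) a
    obtain ⟨p, rfl⟩ := Ideal.Quotient.mk_surjective p
    obtain ⟨q, rfl⟩ := Ideal.Quotient.mk_surjective q
    exact ⟨p, q, by rw [hx, hx]⟩
  obtain ⟨τ, hτ⟩ := exists_algHom_of_trdeg_one t ht x hgen (fun h => hg.ne_zero
    (h (((hx0 g).2 dvd_rfl).trans (map_zero _).symm))) i hi
  refine ⟨fun j => τ (x j), ⟨i, hτ⟩, fun h => ?_⟩
  rw [← hx0, ← map_eq_zero_iff τ τ.injective]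
  have : (MvPolynomial.aeval fun j => τ (x j)) = τ.comp (MvPolynomial.aeval x) := by
    apply MvPolynomial.algHom_ext
    intro i
    simp
  rw [this, AlgHom.comp_apply]

/-- There is an algebraically closed differential field in which every irreducible plane curve
has a non-constant generic point. -/
theorem exists_diff_field : ∃ (Ω : Type) (_ : Field Ω) (_ : CharZero Ω) (_ : IsAlgClosed Ω)
    (_ : Algebra ℂ Ω) (D : Derivation ℂ Ω Ω), ∀ g : MvPolynomial (Fin 2) ℂ, Irreducible g →
      ∃ y : Fin 2 → Ω, (∃ i, D (y i) ≠ 0) ∧ ∀ h, MvPolynomial.aeval y h = 0 ↔ g ∣ h := by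
  let K := FractionRing ℂ[X]
  let Ω := AlgebraicClosure K
  let t : Ω := algebraMap ℂ[X] Ω X
  have hinj : Function.Injective (algebraMap ℂ[X] Ω) := by
    rw [IsScalarTower.algebraMap_eq ℂ[X] K Ω]
    exact (algebraMap K Ω).injective.comp (IsFractionRing.injective ℂ[X] K)
  have haev : ∀ p : ℂ[X], aeval t p = algebraMap ℂ[X] Ω p := by
    intro p
    have : (aeval t : ℂ[X] →ₐ[ℂ] Ω) = IsScalarTower.toAlgHom ℂ ℂ[X] Ω := by
      apply Polynomial.algHom_ext
      simp [t]
    rw [this]; simp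
  have ht : Transcendental ℂ t := by
    rw [transcendental_iff_injective]
    intro p q h
    rw [haev, haev] at h
    exact hinj h
  have halg : ∀ x : Ω, IsAlgebraic (Algebra.adjoin ℂ {t}) x := by
    intro x
    have h1 : Algebra.IsAlgebraic ℂ[X] Ω :=
      (IsFractionRing.comap_isAlgebraic_iff (A := ℂ[X]) (K := K) (C := Ω)).2 inferInstance
    have h2 := h1.isAlgebraic x
    refine IsAlgebraic.ringHom_of_comp_eq ((aeval t : ℂ[X] →ₐ[ℂ] Ω).codRestrict
        (Algebra.adjoin ℂ {t}) (fun p => Polynomial.aeval_mem_adjoin_singleton ℂ t))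
        (RingHom.id Ω) (a := x) h2 ?_ ?_
    · intro p q h
      have := congrArg Subtype.val h
      simp only [AlgHom.coe_codRestrict, haev] at this
      exact hinj this
    · refine RingHom.ext fun p => ?_
      exact haev p
  obtain ⟨D, hD⟩ := exists_derivation t ht halg
  refine ⟨Ω, inferInstance, inferInstance, inferInstance, inferInstance, D, fun g hg => ?_⟩
  obtain ⟨y, ⟨i, hi⟩, hy⟩ := exists_generic_point t ht g hg
  refine ⟨y, ⟨i, ?_⟩, hy⟩
  rw [hi, hD]
  intro h0
  rw [h0] at ht
  exact ht (isAlgebraic_zero)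
end BZ

namespace BZ
open Module

section
variable {L : Type} [AddCommGroup L] {K : Type*} [Field K] [Algebra ℂ K]

/-- The restriction of a two-parameter family of characters to a point. -/
noncomputable def mkChar (ω : AddChar L ℂ) (u v : L →ₗ[ℤ] ℤ) (y z : Kˣ) : AddChar L K where
  toFun m := algebraMap ℂ K (ω m) * (y ^ u m : Kˣ) * (z ^ v m : Kˣ)
  map_zero_eq_one' := by simp
  map_add_eq_mul' a b := by
    simp only [AddChar.map_add_eq_mul, map_add, map_mul, zpow_add, Units.val_mul]
    ring

theorem mkChar_apply (ω : AddChar L ℂ) (u v : L →ₗ[ℤ] ℤ) (y z : Kˣ) (m : L) :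
    mkChar ω u v y z m = algebraMap ℂ K (ω m) * (y ^ u m : Kˣ) * (z ^ v m : Kˣ) := rfl

/-- The plane polynomial whose zeros are the parameters at which `f` vanishes. -/
noncomputable def plane (ω : AddChar L ℂ) (u v : L →ₗ[ℤ] ℤ) (A B : ℕ) (f : L →₀ ℤ) :
    MvPolynomial (Fin 2) ℂ :=
  f.sum fun m c => MvPolynomial.C ((c : ℂ) * ω m) *
    (MvPolynomial.X 0 ^ (u m + A).toNat * MvPolynomial.X 1 ^ (v m + B).toNat)

theorem units_pow_toNat (y : Kˣ) (n : ℤ) (A : ℕ) (h : |n| ≤ A) :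
    (y : K) ^ (n + A).toNat = (y : K) ^ A * (y ^ n : Kˣ) := by
  have h1 : ((n + A).toNat : ℤ) = n + A := Int.toNat_of_nonneg (by
    have := neg_abs_le n; omega)
  rw [← zpow_natCast, h1, zpow_add₀ y.ne_zero, zpow_natCast, mul_comm, Units.val_zpow_eq_zpow_val]

theorem aeval_plane (ω : AddChar L ℂ) (u v : L →ₗ[ℤ] ℤ) (A B : ℕ) (f : L →₀ ℤ)
    (hf : ∀ m ∈ f.support, |u m| ≤ A ∧ |v m| ≤ B) (y z : Kˣ) (Y : Fin 2 → K) (hY0 : Y 0 = y)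
    (hY1 : Y 1 = z) :
    MvPolynomial.aeval Y (plane ω u v A B f) =
      (y : K) ^ A * (z : K) ^ B * ev (mkChar ω u v y z) f := by
  rw [plane, Finsupp.sum, map_sum, ev_eq_sum, Finset.mul_sum]
  refine Finset.sum_congr rfl fun m hm => ?_
  rw [map_mul, map_mul (MvPolynomial.aeval Y) (_ ^ _), map_pow, map_pow, MvPolynomial.aeval_X, MvPolynomial.aeval_X, hY0, hY1,
    units_pow_toNat y _ A (hf m hm).1, units_pow_toNat z _ B (hf m hm).2, mkChar_apply,
    MvPolynomial.algHom_C, map_mul, map_intCast]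
  ring

theorem aeval_plane_eq_zero (ω : AddChar L ℂ) (u v : L →ₗ[ℤ] ℤ) (A B : ℕ) (f : L →₀ ℤ)
    (hf : ∀ m ∈ f.support, |u m| ≤ A ∧ |v m| ≤ B) (y z : Kˣ) (Y : Fin 2 → K) (hY0 : Y 0 = y)
    (hY1 : Y 1 = z) :
    MvPolynomial.aeval Y (plane ω u v A B f) = 0 ↔ ev (mkChar ω u v y z) f = 0 := by
  rw [aeval_plane ω u v A B f hf y z Y hY0 hY1, mul_eq_zero, or_iff_right]
  exact mul_ne_zero (pow_ne_zero _ y.ne_zero) (pow_ne_zero _ z.ne_zero)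

theorem degreeOf_plane (ω : AddChar L ℂ) (u v : L →ₗ[ℤ] ℤ) (A B : ℕ) (f : L →₀ ℤ)
    (hf : ∀ m ∈ f.support, |u m| ≤ A ∧ |v m| ≤ B) :
    (plane ω u v A B f).degreeOf 0 ≤ 2 * A ∧ (plane ω u v A B f).degreeOf 1 ≤ 2 * B := by
  constructor
  · rw [plane, Finsupp.sum]
    refine (MvPolynomial.degreeOf_sum_le _ _ _).trans (Finset.sup_le fun m hm => ?_)
    refine (MvPolynomial.degreeOf_C_mul_le _ _ _).trans
      ((MvPolynomial.degreeOf_mul_le _ _ _).trans ?_)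
    refine (add_le_add (MvPolynomial.degreeOf_pow_le _ _ _)
      (MvPolynomial.degreeOf_pow_le _ _ _)).trans ?_
    rw [MvPolynomial.degreeOf_X_self, MvPolynomial.degreeOf_X_of_ne (by decide)]
    have := (le_abs_self _).trans (hf m hm).1
    omega
  · rw [plane, Finsupp.sum]
    refine (MvPolynomial.degreeOf_sum_le _ _ _).trans (Finset.sup_le fun m hm => ?_)
    refine (MvPolynomial.degreeOf_C_mul_le _ _ _).trans
      ((MvPolynomial.degreeOf_mul_le _ _ _).trans ?_)
    refine (add_le_add (MvPolynomial.degreeOf_pow_le _ _ _)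
      (MvPolynomial.degreeOf_pow_le _ _ _)).trans ?_
    rw [MvPolynomial.degreeOf_X_self, MvPolynomial.degreeOf_X_of_ne (by decide)]
    have := (le_abs_self _).trans (hf m hm).2
    omega
end

theorem eq_zero_of_eigen_sum {F : Type*} [Field F] [CharZero F] (E : F →+ F) (x : ℤ → F)
    (hE : ∀ e, E (x e) = e * x e) (T : Finset ℤ) :
    ∀ b : ℤ → ℤ, (∑ e ∈ T, b e * x e = 0) → ∀ e ∈ T, b e * x e = 0 := by
  classical
  have hE' : ∀ (n : ℤ) e, E (n * x e) = n * (e * x e) := by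
    intro n e
    rw [← zsmul_eq_mul, map_zsmul, hE, zsmul_eq_mul]
  induction T using Finset.induction_on with
  | empty => simp
  | insert a T ha ih =>
    intro b hb
    rw [Finset.sum_insert ha] at hb
    have h1 : ∑ e ∈ T, ((b e * (e - a) : ℤ) : F) * x e = 0 := by
      have h2 := congrArg E hb
      rw [map_add, map_sum, map_zero, hE'] at h2
      simp only [hE'] at h2
      have h3 : ∑ e ∈ T, ((b e * (e - a) : ℤ) : F) * x e =
          ∑ e ∈ T, (b e : F) * (e * x e) - a * ∑ e ∈ T, b e * x e := by
        rw [Finset.mul_sum, ← Finset.sum_sub_distrib]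
        refine Finset.sum_congr rfl fun e _ => ?_
        push_cast
        ring
      rw [h3]
      linear_combination h2 - a * hb
    have h4 : ∀ e ∈ T, b e * x e = 0 := by
      intro e he
      have := ih _ h1 e he
      push_cast at this
      have h5 : (e - a : F) ≠ 0 := by
        rw [sub_ne_zero]
        intro h
        rw [Int.cast_injective h] at he
        exact ha he
      have h6 : (b e * x e) * (e - a : F) = 0 := by rw [← this]; ring
      exact (mul_eq_zero.1 h6).resolve_right h5
    intro e he
    rcases Finset.mem_insert.1 he with rfl | he
    · rw [Finset.sum_eq_zero h4, add_zero] at hb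
      exact hb
    · exact h4 e he

theorem curve_lemma {L : Type} [AddCommGroup L] [Free ℤ L] [Module.Finite ℤ L]
    {fam : Finset (L →₀ ℤ)} (hfam : Codim2 fam) :
    ∃ S : Finset L, 0 ∉ S ∧ ∀ (ω : AddChar L ℂ) (u v : L →ₗ[ℤ] ℤ) (A B : ℕ)
      (g : MvPolynomial (Fin 2) ℂ) (y z : ℂˣ), IsTors ω →
      (∀ i j : ℤ, i • u + j • v = 0 → i = 0 ∧ j = 0) →
      (∀ f ∈ fam, ∀ m ∈ f.support, |u m| ≤ A ∧ |v m| ≤ B) → Irreducible g →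
      MvPolynomial.eval ![(y : ℂ), (z : ℂ)] g = 0 → (∀ f ∈ fam, g ∣ plane ω u v A B f) →
      (∃ s ∈ S, mkChar ω u v y z s = 1) ∨ Degen fam (mkChar ω u v y z) := by
  classical
  obtain ⟨Ω, _, _, _, _, D, hΩ⟩ := exists_diff_field
  obtain ⟨S, hS0, hS⟩ := dlog_relation_or hfam D
  refine ⟨S, hS0, fun ω u v A B g y z hω huv hAB hg hgz hdvd => ?_⟩
  obtain ⟨Y, hYD, hY⟩ := hΩ g hg
  have hdvd0 : ∀ h, g ∣ h → MvPolynomial.eval ![(y : ℂ), (z : ℂ)] h = 0 := by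
    rintro _ ⟨q, rfl⟩
    rw [map_mul, hgz, zero_mul]
  have hYne : ∀ i, Y i ≠ 0 := by
    intro i h0
    have h1 := hdvd0 _ ((hY (MvPolynomial.X i)).1 (by rw [MvPolynomial.aeval_X, h0]))
    rw [MvPolynomial.eval_X] at h1
    fin_cases i
    · exact y.ne_zero h1
    · exact z.ne_zero h1
  let Y0 := Units.mk0 (Y 0) (hYne 0)
  let Y1 := Units.mk0 (Y 1) (hYne 1)
  have hkey : ∀ f : L →₀ ℤ, (∀ m ∈ f.support, |u m| ≤ A ∧ |v m| ≤ B) →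
      (ev (mkChar ω u v Y0 Y1) f = 0 ↔ g ∣ plane ω u v A B f) := by
    intro f hf
    rw [← aeval_plane_eq_zero ω u v A B f hf Y0 Y1 Y rfl rfl, hY]
  have hkill : Kills fam (mkChar ω u v Y0 Y1) := fun f hf => (hkey f (hAB f hf)).2 (hdvd f hf)
  rcases hS ω u v (Y 0) (Y 1) (mkChar ω u v Y0 Y1) hω (hYne 0) (hYne 1) (fun m => by
    rw [mkChar_apply]; simp [Y0, Y1]) hkill with ⟨i, j, hij, hrel⟩ | ⟨s, hs, h1, h2, h3⟩
  · right
    set η0 := D (Y 0) / Y 0 with hη0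
    set η1 := D (Y 1) / Y 1 with hη1
    have hη : ¬ (η0 = 0 ∧ η1 = 0) := by
      rintro ⟨h0, h1⟩
      obtain ⟨k, hk⟩ := hYD
      rw [hη0, div_eq_zero_iff, or_iff_left (hYne 0)] at h0
      rw [hη1, div_eq_zero_iff, or_iff_left (hYne 1)] at h1
      fin_cases k
      · exact hk h0
      · exact hk h1
    obtain ⟨θ, hθ0, hθ1⟩ : ∃ θ : Ω, η0 = -(j : Ω) * θ ∧ η1 = i * θ := by
      by_cases hi : i = 0
      · have hj : (j : Ω) ≠ 0 := by
          rcases hij with h | h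
          · exact absurd hi h
          · exact_mod_cast h
        subst hi
        have : η1 = 0 := by
          simp only [Int.cast_zero, zero_mul, zero_add, mul_eq_zero] at hrel
          exact hrel.resolve_left hj
        exact ⟨-(η0 / j), by field_simp, by simp [this]⟩
      · have hi : (i : Ω) ≠ 0 := by exact_mod_cast hi
        refine ⟨η1 / i, ?_, by field_simp⟩
        field_simp
        linear_combination hrel
    have hθ : θ ≠ 0 := by
      rintro rfl
      exact hη ⟨by simpa using hθ0, by simpa using hθ1⟩
    let w : L →ₗ[ℤ] ℤ := i • v - j • u
    have hw : w ≠ 0 := by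
      intro h0
      have := huv (-j) i (by rw [← h0]; simp only [w, neg_smul]; abel)
      rcases hij with h | h
      · exact h this.2
      · exact h (neg_eq_zero.1 this.1)
    set c := mkChar ω u v Y0 Y1 with hc
    have hDc : ∀ m, D (c m) = θ * (w m : Ω) * c m := by
      intro m
      have hω0 : algebraMap ℂ Ω (ω m) ≠ 0 := by
        rw [ne_eq, map_eq_zero_iff _ (algebraMap ℂ Ω).injective]
        exact char_ne_zero _ _
      have h1 : c m = algebraMap ℂ Ω (ω m) * Y 0 ^ u m * Y 1 ^ v m := by
        rw [hc, mkChar_apply]; simp [Y0, Y1]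
      have h2 : D (c m) / c m = u m * η0 + v m * η1 := by
        rw [h1, dlog_mul _ (mul_ne_zero hω0 (zpow_ne_zero _ (hYne 0))) (zpow_ne_zero _ (hYne 1)),
          dlog_mul _ hω0 (zpow_ne_zero _ (hYne 0)), dlog_zpow _ (hYne 0), dlog_zpow _ (hYne 1)]
        simp [hη0, hη1]
      rw [div_eq_iff (char_ne_zero c m)] at h2
      rw [h2, hθ0, hθ1]
      simp only [w, LinearMap.sub_apply, LinearMap.smul_apply, smul_eq_mul]
      push_cast
      ring
    have hparts : ∀ f ∈ fam, ∀ e, ev c (part w e f) = 0 := by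
      intro f hf e
      let E : Ω →+ Ω := (AddMonoidHom.mulLeft θ⁻¹).comp
        ((D : Ω →ₗ[ℂ] Ω).toAddMonoidHom)
      have hE : ∀ e, E (ev c (part w e f)) = e * ev c (part w e f) := by
        intro e
        rw [ev_eq_sum, map_sum, Finset.mul_sum]
        refine Finset.sum_congr rfl fun m hm => ?_
        have hme : w m = e := by
          rw [Finsupp.mem_support_iff, part_apply] at hm
          by_contra h
          exact hm (if_neg h)
        change θ⁻¹ * D (_ * c m) = _
        rw [Derivation.leibniz, hDc, Derivation.map_intCast, hme]
        simp only [smul_eq_mul]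
        field_simp
        ring
      let T : Finset ℤ := insert e (f.support.image w)
      have hsum := ev_eq_sum_parts w f c T (fun m hm =>
        Finset.mem_insert_of_mem (Finset.mem_image_of_mem _ hm))
      rw [hkill f hf] at hsum
      have := eq_zero_of_eigen_sum E _ hE T (fun _ => 1) (by simpa using hsum.symm) e
        (Finset.mem_insert_self _ _)
      simpa using this
    refine ⟨w, hw, fun f hf e => ?_⟩
    have hbd : ∀ m ∈ (part w e f).support, |u m| ≤ A ∧ |v m| ≤ B := fun m hm =>
      hAB f hf m (by
        rw [Finsupp.mem_support_iff, part_apply] at hm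
        rw [Finsupp.mem_support_iff]
        exact fun h0 => hm (by rw [h0, ite_self]))
    have h1 := hdvd0 _ ((hkey _ hbd).1 (hparts f hf e))
    exact (aeval_plane_eq_zero ω u v A B _ hbd y z ![(y : ℂ), (z : ℂ)] rfl rfl).1 h1
  · left
    exact ⟨s, hs, by rw [mkChar_apply, h1, h2, h3]; simp⟩
end BZ

namespace BZ
open Module

theorem exists_irreducible_eval {σ k : Type*} [Finite σ] [Field k] (z : σ → k)
    (p : MvPolynomial σ k) (hp : p ≠ 0) (hz : MvPolynomial.eval z p = 0) :
    ∃ g, Irreducible g ∧ MvPolynomial.eval z g = 0 := by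
  induction p using WfDvdMonoid.induction_on_irreducible with
  | zero => exact absurd rfl hp
  | unit u hu => exact absurd hz (hu.map (MvPolynomial.eval z)).ne_zero
  | mul a g ha hg ih =>
    rw [map_mul, mul_eq_zero] at hz
    rcases hz with hz | hz
    · exact ⟨g, hg, hz⟩
    · exact ih ha hz

/-- The number of isolated points of a two-parameter family of characters at which the family of
polynomials vanishes is bounded by the bidegree. -/
theorem plane_count {L : Type} [AddCommGroup L] [Free ℤ L] [Module.Finite ℤ L]
    {fam : Finset (L →₀ ℤ)} (hfam : Codim2 fam) :
    ∃ S : Finset L, 0 ∉ S ∧ ∀ (ω : AddChar L ℂ) (u v : L →ₗ[ℤ] ℤ) (A B : ℕ)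
      (Z : Finset (Fin 2 → ℂˣ)), IsTors ω →
      (∀ i j : ℤ, i • u + j • v = 0 → i = 0 ∧ j = 0) →
      (∀ f ∈ fam, ∀ m ∈ f.support, |u m| ≤ A ∧ |v m| ≤ B) →
      (∀ z ∈ Z, Kills fam (mkChar ω u v (z 0) (z 1))) →
      (∀ z ∈ Z, ∀ s ∈ S, mkChar ω u v (z 0) (z 1) s ≠ 1) →
      (∀ z ∈ Z, ¬ Degen fam (mkChar ω u v (z 0) (z 1))) → Z.card ≤ 8 * A * B := by
  classical
  obtain ⟨S, hS0, hS⟩ := curve_lemma hfam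
  refine ⟨S, hS0, fun ω u v A B Z hω huv hAB hk hrel hdeg => ?_⟩
  let ι : (Fin 2 → ℂˣ) → (Fin 2 → ℂ) := fun z i => z i
  have hι : Function.Injective ι := fun a b h => funext fun i => Units.ext (congrFun h i)
  have hvec : ∀ z : Fin 2 → ℂˣ, ι z = ![(z 0 : ℂ), (z 1 : ℂ)] := by
    intro z; ext i; fin_cases i <;> rfl
  have hcomp : ∀ z ∈ Z, ∀ g, Irreducible g → MvPolynomial.eval (ι z) g = 0 →
      ∃ f ∈ fam, ¬ g ∣ plane ω u v A B f := by
    intro z hz g hg hgz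
    by_contra hcon
    push Not at hcon
    rw [hvec] at hgz
    rcases hS ω u v A B g (z 0) (z 1) hω huv hAB hg hgz hcon with ⟨s, hs, h1⟩ | h1
    · exact hrel z hz s hs h1
    · exact hdeg z hz h1
  by_cases hp : ∃ f ∈ fam, plane ω u v A B f ≠ 0
  · obtain ⟨f, hf, hf0⟩ := hp
    have h1 := degreeOf_plane ω u v A B f (hAB f hf)
    have hz0 : ∀ z ∈ Z.image ι, ∀ f ∈ fam, MvPolynomial.eval z (plane ω u v A B f) = 0 := by
      intro z hz f hf
      obtain ⟨z, hz', rfl⟩ := Finset.mem_image.1 hz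
      exact (aeval_plane_eq_zero ω u v A B f (hAB f hf) (z 0) (z 1) (ι z) rfl rfl).2
        (hk z hz' f hf)
    have := bezout (2 * A) (2 * B) {q | ∃ f ∈ fam, q = plane ω u v A B f}
      (by rintro _ ⟨f, hf, rfl⟩; exact degreeOf_plane ω u v A B f (hAB f hf))
      (plane ω u v A B f) hf0 (Z.image ι)
      (by rintro z hz _ ⟨f, hf, rfl⟩; exact hz0 z hz f hf) (fun z hz => hz0 z hz f hf)
      (by
        intro z hz g hg hgz
        obtain ⟨z, hz', rfl⟩ := Finset.mem_image.1 hz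
        obtain ⟨f, hf, hfg⟩ := hcomp z hz' g hg hgz
        exact ⟨_, ⟨f, hf, rfl⟩, hfg⟩)
    rw [Finset.card_image_of_injective _ hι] at this
    have h2 := Nat.mul_le_mul_right (2 * B) h1.1
    have h3 := Nat.mul_le_mul_right (2 * A) h1.2
    nlinarith
  · push Not at hp
    have : Z = ∅ := by
      rw [Finset.eq_empty_iff_forall_notMem]
      intro z hz
      obtain ⟨g, hg, hgz⟩ := exists_irreducible_eval (ι z)
        (MvPolynomial.X 0 - MvPolynomial.C (z 0 : ℂ)) (fun h0 => by
          have := congrArg (MvPolynomial.eval fun _ => (z 0 : ℂ) + 1) h0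
          simp at this) (by simp [ι])
      obtain ⟨f, hf, hfg⟩ := hcomp z hz g hg hgz
      exact hfg (by rw [hp f hf]; exact dvd_zero _)
    simp [this]
end BZ

namespace BZ
open Module

theorem kills_mapChar {L K K' : Type*} [AddCommGroup L] [Field K] [Field K'] (σ : K →+* K')
    (fam : Finset (L →₀ ℤ)) (χ : AddChar L K) : Kills fam (mapChar σ χ) ↔ Kills fam χ := by
  simp only [Kills, ev_map, map_eq_zero]

theorem degen_mapChar {L K K' : Type*} [AddCommGroup L] [Field K] [Field K'] (σ : K →+* K')
    (fam : Finset (L →₀ ℤ)) (χ : AddChar L K) : Degen fam (mapChar σ χ) ↔ Degen fam χ := by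
  simp only [Degen, PartsVanish, ev_map, map_eq_zero]

theorem mapChar_eq_one {L K K' : Type*} [AddCommGroup L] [Field K] [Field K'] (σ : K →+* K')
    (χ : AddChar L K) (m : L) : mapChar σ χ m = 1 ↔ χ m = 1 := by
  rw [mapChar_apply, map_eq_one_iff σ σ.injective]

section
variable {L : Type} [AddCommGroup L] [Free ℤ L] [Module.Finite ℤ L]

theorem natAbs_le_sz (a : L →ₗ[ℤ] ℤ) (i : Free.ChooseBasisIndex ℤ L) :
    (a (Free.chooseBasis ℤ L i)).natAbs ≤ sz a :=
  Finset.le_sup (f := fun i => (a (Free.chooseBasis ℤ L i)).natAbs) (Finset.mem_univ i)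

theorem exists_le_mul_sz (fam : Finset (L →₀ ℤ)) :
    ∃ κ : ℕ, 0 < κ ∧ ∀ u : L →ₗ[ℤ] ℤ, ∀ f ∈ fam, ∀ m ∈ f.support, |u m| ≤ ((κ * sz u : ℕ) : ℤ) := by
  classical
  let b := Free.chooseBasis ℤ L
  let t : L → ℕ := fun m => ∑ i, (b.repr m i).natAbs
  refine ⟨(fam.biUnion Finsupp.support).sup t + 1, Nat.succ_pos _, fun u f hf m hm => ?_⟩
  have h1 : t m ≤ (fam.biUnion Finsupp.support).sup t :=
    Finset.le_sup (f := t) (Finset.mem_biUnion.2 ⟨f, hf, hm⟩)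
  have h2 : u m = ∑ i, b.repr m i * u (b i) := by
    conv_lhs => rw [← b.sum_repr m]
    rw [map_sum]
    simp only [map_smul, smul_eq_mul]
  calc |u m| ≤ ∑ i, |b.repr m i * u (b i)| := h2 ▸ Finset.abs_sum_le_sum_abs _ _
    _ ≤ ∑ i, |b.repr m i| * (sz u : ℤ) := by
      refine Finset.sum_le_sum fun i _ => ?_
      rw [abs_mul]
      refine mul_le_mul_of_nonneg_left ?_ (abs_nonneg _)
      rw [← Int.natCast_natAbs]
      exact_mod_cast natAbs_le_sz u i
    _ = ((t m * sz u : ℕ) : ℤ) := by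
      rw [← Finset.sum_mul]; push_cast; simp [t]
    _ ≤ _ := by
      gcongr
      exact h1.trans (Nat.le_succ _)

theorem eq_smul_of_smul_eq {a w : L →ₗ[ℤ] ℤ} {l0 : L} (ha : a l0 = 1) {k l : ℤ} (hk : k ≠ 0)
    (h : k • w = l • a) (m : L) : w m = w l0 * a m := by
  have h0 : k * w l0 = l := by simpa [ha] using LinearMap.congr_fun h l0
  have h1 : k * w m = l * a m := by simpa using LinearMap.congr_fun h m
  apply mul_left_cancel₀ hk
  rw [h1, ← h0, mul_assoc]

theorem exists_simultaneous_approx (c : L →ₗ[ℤ] ℤ) {M Q : ℕ} (hQ : 1 ≤ Q) (hM : 0 < M) :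
    ∃ r : ℕ, 0 < r ∧ r ≤ Q ^ Fintype.card (Free.ChooseBasisIndex ℤ L) ∧ ∃ u w : L →ₗ[ℤ] ℤ,
      (∀ m, r * c m = M * u m + w m) ∧ sz w * Q < M := by
  classical
  let b := Free.chooseBasis ℤ L
  let ι := Free.ChooseBasisIndex ℤ L
  have hM' : (0 : ℤ) < M := by exact_mod_cast hM
  have hQ' : (0 : ℤ) < Q := by exact_mod_cast hQ
  let x : ℕ → ι → ℤ := fun j i => (j * c (b i)) % M
  have hx0 : ∀ j i, 0 ≤ x j i := fun j i => Int.emod_nonneg _ hM'.ne'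
  have hxM : ∀ j i, x j i < M := fun j i => Int.emod_lt_of_pos _ hM'
  let F : ℕ → ι → Fin Q := fun j i => ⟨(Q * x j i / M).toNat, by
    have h1 : 0 ≤ Q * x j i / M := Int.ediv_nonneg (mul_nonneg hQ'.le (hx0 j i)) hM'.le
    have h2 : Q * x j i / M < Q := by
      apply Int.ediv_lt_of_lt_mul hM'
      exact mul_lt_mul_of_pos_left (hxM j i) hQ'
    omega⟩
  have hcard : (Finset.univ : Finset (ι → Fin Q)).card < (Finset.range (Q ^ Fintype.card ι + 1)).card := by
    rw [Finset.card_range, Finset.card_univ, Fintype.card_fun, Fintype.card_fin]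
    exact Nat.lt_succ_self _
  obtain ⟨j1, hj1, j2, hj2, hne, hF⟩ :=
    Finset.exists_ne_map_eq_of_card_lt_of_maps_to hcard (f := F) (fun _ _ => Finset.mem_univ _)
  wlog hlt : j1 < j2 generalizing j1 j2
  · exact this j2 hj2 j1 hj1 hne.symm hF.symm (lt_of_le_of_ne (not_lt.1 hlt) hne.symm)
  have hj2' := Finset.mem_range.1 hj2
  let u : L →ₗ[ℤ] ℤ := b.constr ℤ fun i => j2 * c (b i) / M - j1 * c (b i) / M
  let w : L →ₗ[ℤ] ℤ := b.constr ℤ fun i => x j2 i - x j1 i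
  refine ⟨j2 - j1, by omega, (show j2 - j1 ≤ Q ^ Fintype.card ι by omega), u, w, ?_, ?_⟩
  · have : ((j2 - j1 : ℕ) : ℤ) • c = (M : ℤ) • u + w := by
      apply b.ext
      intro i
      simp only [LinearMap.smul_apply, LinearMap.add_apply, u, w, Basis.constr_basis, smul_eq_mul, x]
      rw [Nat.cast_sub hlt.le]
      have h1 := Int.emod_add_mul_ediv (j1 * c (b i)) M
      have h2 := Int.emod_add_mul_ediv (j2 * c (b i)) M
      linear_combination h1 - h2
    intro m
    simpa using LinearMap.congr_fun this m
  · have : sz w ≤ (M - 1) / Q := by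
      refine Finset.sup_le fun i _ => ?_
      rw [Nat.le_div_iff_mul_le hQ]
      have hwi : w (b i) = x j2 i - x j1 i := by simp [w]
      have hFi : (Q * x j1 i / M).toNat = (Q * x j2 i / M).toNat := congrArg Fin.val (congrFun hF i)
      have g1 : 0 ≤ Q * x j1 i / M := Int.ediv_nonneg (mul_nonneg hQ'.le (hx0 _ i)) hM'.le
      have g2 : 0 ≤ Q * x j2 i / M := Int.ediv_nonneg (mul_nonneg hQ'.le (hx0 _ i)) hM'.le
      have hFi' : Q * x j1 i / M = Q * x j2 i / M := by omega
      have h1 := Int.emod_add_mul_ediv (Q * x j1 i) M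
      have h2 := Int.emod_add_mul_ediv (Q * x j2 i) M
      have h3 := Int.emod_lt_of_pos (Q * x j1 i) hM'
      have h4 := Int.emod_lt_of_pos (Q * x j2 i) hM'
      have h5 := Int.emod_nonneg (Q * x j1 i) hM'.ne'
      have h6 := Int.emod_nonneg (Q * x j2 i) hM'.ne'
      rw [hFi'] at h1
      have h7 : |w (b i) * Q| < M := by
        rw [hwi, abs_lt]; constructor <;> nlinarith
      have h8 : (((w (b i)).natAbs * Q : ℕ) : ℤ) < M := by
        push_cast; rwa [abs_mul, Nat.abs_cast] at h7
      have h9 : (w (b i)).natAbs * Q < M := by exact_mod_cast h8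
      change (w (b i)).natAbs * Q ≤ _
      omega
    calc sz w * Q ≤ (M - 1) / Q * Q := Nat.mul_le_mul_right _ this
      _ ≤ M - 1 := Nat.div_mul_le_self _ _
      _ < M := by omega

end

/-- The conclusion of the bound on isolated zeros on two-parameter families. -/
def PlaneBound {L : Type} [AddCommGroup L] (fam : Finset (L →₀ ℤ)) (S : Finset L) : Prop :=
  ∀ (ω : AddChar L ℂ) (u v : L →ₗ[ℤ] ℤ) (A B : ℕ) (Z : Finset (Fin 2 → ℂˣ)), IsTors ω →
      (∀ i j : ℤ, i • u + j • v = 0 → i = 0 ∧ j = 0) →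
      (∀ f ∈ fam, ∀ m ∈ f.support, |u m| ≤ A ∧ |v m| ≤ B) →
      (∀ z ∈ Z, Kills fam (mkChar ω u v (z 0) (z 1))) →
      (∀ z ∈ Z, ∀ s ∈ S, mkChar ω u v (z 0) (z 1) s ≠ 1) →
      (∀ z ∈ Z, ¬ Degen fam (mkChar ω u v (z 0) (z 1))) → Z.card ≤ 8 * A * B

/-- A character in normal form: `χ m = ε ^ c m * ξ ^ a m` with `a` primitive and `ε` of the
smallest possible order `M`. -/
structure NormalForm {L : Type} [AddCommGroup L] (χ : AddChar L ℂ) (l0 : L) (a c : L →ₗ[ℤ] ℤ)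
    (M : ℕ) (ε ξ : ℂ) : Prop where
  al0 : a l0 = 1
  cl0 : c l0 = 0
  Mpos : 0 < M
  exp : ε = Complex.exp (2 * Real.pi * Complex.I / M)
  ne : ξ ≠ 0
  eq : ∀ m, χ m = ε ^ c m * ξ ^ a m
  min : ∀ r : ℕ, 0 < r → (∀ m, (M : ℤ) ∣ r * c m) → M ≤ r

theorem NormalForm.prim {L : Type} [AddCommGroup L] {χ : AddChar L ℂ} {l0 : L} {a c : L →ₗ[ℤ] ℤ}
    {M : ℕ} {ε ξ : ℂ} (h : NormalForm χ l0 a c M ε ξ) : IsPrimitiveRoot ε M :=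
  h.exp ▸ Complex.isPrimitiveRoot_exp M h.Mpos.ne'

theorem Rank1.exists_normalForm {L : Type} [AddCommGroup L] [Free ℤ L] [Module.Finite ℤ L]
    {χ ζ : AddChar L ℂ} {a : L →ₗ[ℤ] ℤ} {ξ : ℂ} (hζ : IsTors ζ) (hξ : ξ ≠ 0) (ha : a ≠ 0)
    (h : ∀ m, χ m = ζ m * ξ ^ a m) :
    ∃ l0 a' c M ε ξ', NormalForm χ l0 a' c M ε ξ' ∧
      ((∃ n : ℕ, 0 < n ∧ ξ' ^ n = 1) → IsTors χ) := by
  obtain ⟨l0, v, g, hg, hv, hvg⟩ := exists_section a ha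
  set ξ' := χ l0 with hξ'
  have hξ'0 : ξ' ≠ 0 := char_ne_zero _ _
  let ζ' : L → ℂ := fun m => χ m / ξ' ^ v m
  have hζadd : ∀ x y, ζ' (x + y) = ζ' x * ζ' y := by
    intro x y
    simp only [ζ', map_add, AddChar.map_add_eq_mul, zpow_add₀ hξ'0]
    field_simp
  have hex : ∃ M : ℕ, 0 < M ∧ ∀ m, ζ' m ^ M = 1 := by
    obtain ⟨M, hM, hM1⟩ := hζ
    refine ⟨M, hM, fun m => ?_⟩
    have : ζ' m = ζ m * (ζ l0 ^ (v m))⁻¹ := by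
      simp only [ζ', hξ', h, hvg, hv, one_mul, mul_zpow]
      rw [← zpow_mul, mul_comm g]
      have h1 : ξ ^ (v m * g) ≠ 0 := zpow_ne_zero _ hξ
      have h2 : ζ l0 ^ v m ≠ 0 := zpow_ne_zero _ (char_ne_zero _ _)
      field_simp
    have h3 : (ζ l0 ^ v m) ^ M = 1 := by
      rw [← zpow_natCast, ← zpow_mul, mul_comm, zpow_mul, zpow_natCast, hM1, one_zpow]
    rw [this, mul_pow, hM1, inv_pow, h3, inv_one, one_mul]
  classical
  let M := Nat.find hex
  obtain ⟨hM, hM1⟩ := Nat.find_spec hex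
  change 0 < M at hM
  change ∀ m, ζ' m ^ M = 1 at hM1
  set ε : ℂ := Complex.exp (2 * Real.pi * Complex.I / M)
  have hε : IsPrimitiveRoot ε M := Complex.isPrimitiveRoot_exp M hM.ne'
  have hε0 : ε ≠ 0 := hε.ne_zero hM.ne'
  let b := Free.chooseBasis ℤ L
  have hk : ∀ m, ∃ k : ℕ, ε ^ k = ζ' m := fun m => by
    have : NeZero M := ⟨hM.ne'⟩
    obtain ⟨i, _, hi⟩ := hε.eq_pow_of_pow_eq_one (hM1 m)
    exact ⟨i, hi⟩
  choose k hk using hk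
  let c0 : L →ₗ[ℤ] ℤ := b.constr ℤ fun i => (k (b i) : ℤ)
  let Z : AddChar L ℂ := { toFun := ζ', map_zero_eq_one' := by simp [ζ'], map_add_eq_mul' := hζadd }
  have hc0 : ∀ m, ζ' m = ε ^ c0 m := by
    intro m
    let f : L →+ Additive ℂˣ :=
      { toFun := fun m => Additive.ofMul (Units.mk0 (ζ' m) (char_ne_zero Z m))
        map_zero' := by
          apply Additive.toMul.injective; ext; simp [ζ']
        map_add' := fun x y => by
          apply Additive.toMul.injective; ext; simp [hζadd] }
    let f2 : L →+ Additive ℂˣ :=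
      { toFun := fun m => Additive.ofMul (Units.mk0 ε hε0 ^ c0 m)
        map_zero' := by simp
        map_add' := fun x y => by
          apply Additive.toMul.injective; simp [zpow_add] }
    have : f.toIntLinearMap = f2.toIntLinearMap := by
      apply b.ext
      intro i
      apply Additive.toMul.injective
      ext
      have hcb : c0 (b i) = k (b i) := Basis.constr_basis _ _ _ _
      simp [f, f2, hcb, hk]
    have h2 := LinearMap.congr_fun this m
    have h3 := congrArg (fun t : Additive ℂˣ => ((t.toMul : ℂˣ) : ℂ)) h2
    simpa [f, f2] using h3
  have hζl0 : ε ^ c0 l0 = 1 := by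
    rw [← hc0]; simp [ζ', hv, ← hξ', hξ'0]
  refine ⟨l0, v, c0 - c0 l0 • v, M, ε, ξ', ⟨hv, by simp [hv], hM, rfl, hξ'0, ?_, ?_⟩, ?_⟩
  · intro m
    have : ε ^ (c0 - c0 l0 • v) m = ζ' m := by
      rw [hc0]
      simp only [LinearMap.sub_apply, LinearMap.smul_apply, smul_eq_mul, zpow_sub₀ hε0, zpow_mul,
        hζl0, one_zpow, div_one]
    rw [this]
    simp only [ζ']
    rw [div_mul_cancel₀ _ (zpow_ne_zero _ hξ'0)]
  · intro r hr hdiv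
    refine Nat.find_min' hex ⟨hr, fun m => ?_⟩
    have h1 : ζ' m = ε ^ (c0 - c0 l0 • v) m := by
      rw [hc0]
      simp only [LinearMap.sub_apply, LinearMap.smul_apply, smul_eq_mul, zpow_sub₀ hε0, zpow_mul,
        hζl0, one_zpow, div_one]
    obtain ⟨t, ht⟩ := hdiv m
    rw [h1, ← zpow_natCast, ← zpow_mul, mul_comm, ht, zpow_mul, zpow_natCast, hε.pow_eq_one,
      one_zpow]
  · rintro ⟨n, hn, h1⟩
    refine ⟨M * n, Nat.mul_pos hM hn, fun m => ?_⟩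
    have h2 : χ m = ζ' m * ξ' ^ v m := by
      simp only [ζ']; rw [div_mul_cancel₀ _ (zpow_ne_zero _ hξ'0)]
    rw [h2, mul_pow, pow_mul, hM1, one_pow, one_mul, ← zpow_natCast, ← zpow_mul, mul_comm (v m),
      zpow_mul, zpow_natCast, mul_comm M, pow_mul, h1, one_pow, one_zpow]

end BZ

namespace BZ
open Module

theorem prod_le_card_succ_mul_prod_pred (s : Finset ℕ) (hs : ∀ p ∈ s, 2 ≤ p) :
    ∏ p ∈ s, p ≤ (s.card + 1) * ∏ p ∈ s, (p - 1) := by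
  induction s using Finset.induction_on_max with
  | empty => simp
  | insert p s hp ih =>
    have hps : p ∉ s := fun h => lt_irrefl _ (hp p h)
    have h2 := hs p (Finset.mem_insert_self _ _)
    have ih := ih fun q hq => hs q (Finset.mem_insert_of_mem hq)
    have hcard : s.card + 2 ≤ p := by
      have : s ⊆ Finset.Ico 2 p := fun q hq =>
        Finset.mem_Ico.2 ⟨hs q (Finset.mem_insert_of_mem hq), hp q hq⟩
      have := Finset.card_le_card this
      rw [Nat.card_Ico] at this
      omega
    rw [Finset.prod_insert hps, Finset.prod_insert hps, Finset.card_insert_of_notMem hps]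
    obtain ⟨t, rfl⟩ := Nat.exists_eq_add_of_le hcard
    have e : s.card + 2 + t - 1 = s.card + 1 + t := by omega
    rw [e]
    calc (s.card + 2 + t) * ∏ p ∈ s, p
        ≤ (s.card + 2 + t) * ((s.card + 1) * ∏ p ∈ s, (p - 1)) := Nat.mul_le_mul_left _ ih
      _ = ((s.card + 2 + t) * (s.card + 1)) * ∏ p ∈ s, (p - 1) := by ring
      _ ≤ ((s.card + 1 + 1) * (s.card + 1 + t)) * ∏ p ∈ s, (p - 1) := by
        refine Nat.mul_le_mul_right _ ?_
        nlinarith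
      _ = _ := by ring

theorem le_totient_mul_log (M : ℕ) (hM : 0 < M) : M ≤ M.totient * (Nat.log 2 M + 1) := by
  have h1 := Nat.totient_mul_prod_primeFactors M
  have h2 := prod_le_card_succ_mul_prod_pred M.primeFactors
    fun p hp => (Nat.prime_of_mem_primeFactors hp).two_le
  have h3 : M.primeFactors.card ≤ Nat.log 2 M := by
    apply Nat.le_log_of_pow_le one_lt_two
    calc 2 ^ M.primeFactors.card ≤ ∏ p ∈ M.primeFactors, p := by
          rw [← Finset.prod_const]
          exact Finset.prod_le_prod' fun p hp => (Nat.prime_of_mem_primeFactors hp).two_le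
      _ ≤ M := Nat.le_of_dvd hM (Nat.prod_primeFactors_dvd M)
  have h4 : 0 < ∏ p ∈ M.primeFactors, (p - 1) := Finset.prod_pos fun p hp => by
    have := (Nat.prime_of_mem_primeFactors hp).two_le; omega
  refine Nat.le_of_mul_le_mul_right ?_ h4
  rw [← h1]
  calc M.totient * ∏ p ∈ M.primeFactors, p
      ≤ M.totient * ((M.primeFactors.card + 1) * ∏ p ∈ M.primeFactors, (p - 1)) := by gcongr
    _ ≤ M.totient * ((Nat.log 2 M + 1) * ∏ p ∈ M.primeFactors, (p - 1)) := by gcongr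
    _ = _ := by ring

theorem log_succ_pow_le (d M : ℕ) (hM : 0 < M) : (Nat.log 2 M + 1) ^ d ≤ d ^ d * M := by
  rcases Nat.eq_zero_or_pos d with rfl | hd
  · simpa using Nat.succ_le_of_lt hM
  set k := Nat.log 2 M
  have h1 : k + 1 ≤ d * 2 ^ (k / d) := by
    have h2 : k < d * (k / d + 1) := Nat.lt_mul_div_succ k hd
    have h3 : k / d + 1 ≤ 2 ^ (k / d) := Nat.lt_two_pow_self
    calc k + 1 ≤ d * (k / d + 1) := h2
      _ ≤ _ := Nat.mul_le_mul_left _ h3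
  calc (k + 1) ^ d ≤ (d * 2 ^ (k / d)) ^ d := Nat.pow_le_pow_left h1 _
    _ = d ^ d * 2 ^ (k / d * d) := by rw [mul_pow, pow_mul]
    _ ≤ d ^ d * 2 ^ k := by
      gcongr
      · norm_num
      · exact Nat.div_mul_le_self _ _
    _ ≤ d ^ d * M := by
      gcongr
      exact Nat.pow_log_le_self 2 hM.ne'

theorem exists_max_pow_lt (n M : ℕ) (hn : 0 < n) (hM : 1 < M) :
    ∃ Q : ℕ, 1 ≤ Q ∧ Q ^ n < M ∧ M ≤ (2 * Q) ^ n := by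
  classical
  have hex : ∃ Q : ℕ, M ≤ Q ^ n := ⟨M, Nat.le_self_pow hn.ne' M⟩
  obtain ⟨Q, hQ⟩ : ∃ Q, Nat.find hex = Q + 1 := by
    refine Nat.exists_eq_succ_of_ne_zero fun h => ?_
    have := Nat.find_spec hex
    rw [h, zero_pow hn.ne'] at this
    omega
  have h1 : M ≤ (Q + 1) ^ n := hQ ▸ Nat.find_spec hex
  have h2 : Q ^ n < M := not_le.1 (Nat.find_min hex (m := Q) (by omega))
  have h3 : 1 ≤ Q := by
    rcases Nat.eq_zero_or_pos Q with rfl | h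
    · simp at h1; omega
    · exact h
  exact ⟨Q, h3, h2, h1.trans (Nat.pow_le_pow_left (by omega) _)⟩

theorem order_numerics (n C A M : ℕ) (hn : 0 < n) (hM : 0 < M)
    (h : ∀ Q : ℕ, 1 ≤ Q → Q ^ n < M → M.totient * Q ≤ C * M * A) :
    M ≤ ((2 * n) ^ (2 * n) * (2 * C) ^ (2 * n) + 1) * A ^ (2 * n) ∨ M = 1 := by
  rcases Nat.lt_or_ge 1 M with h1 | h1
  swap
  · right; omega
  left
  obtain ⟨Q, hQ1, hQM, hMQ⟩ := exists_max_pow_lt n M hn h1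
  have h2 : M.totient * Q ≤ M.totient * (C * (Nat.log 2 M + 1) * A) := by
    calc _ ≤ C * M * A := h Q hQ1 hQM
      _ ≤ C * (M.totient * (Nat.log 2 M + 1)) * A := by gcongr; exact le_totient_mul_log M hM
      _ = _ := by ring
  have h3 : Q ≤ C * (Nat.log 2 M + 1) * A :=
    Nat.le_of_mul_le_mul_left h2 (Nat.totient_pos.2 hM)
  have h4 : M * M ≤ M * (((2 * n) ^ (2 * n) * (2 * C) ^ (2 * n)) * A ^ (2 * n)) := by
    calc M * M ≤ (2 * Q) ^ n * (2 * Q) ^ n := Nat.mul_le_mul hMQ hMQ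
      _ = (2 * Q) ^ (2 * n) := by rw [← pow_add, two_mul n]
      _ ≤ (2 * (C * (Nat.log 2 M + 1) * A)) ^ (2 * n) := by gcongr
      _ = (Nat.log 2 M + 1) ^ (2 * n) * ((2 * C) ^ (2 * n) * A ^ (2 * n)) := by
        rw [← mul_pow, ← mul_pow]; ring
      _ ≤ ((2 * n) ^ (2 * n) * M) * ((2 * C) ^ (2 * n) * A ^ (2 * n)) := by
        gcongr; exact log_succ_pow_le _ M hM
      _ = _ := by ring
  have h5 := Nat.le_of_mul_le_mul_left h4 hM
  exact h5.trans (Nat.mul_le_mul_right _ (Nat.le_succ _))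

end BZ

namespace BZ
open Module

theorem exists_totient_le_card (r M : ℕ) (hr : 0 < r) (hM : 0 < M) :
    ∃ T : Finset ℕ, M.totient ≤ T.card ∧
      ∀ j ∈ T, j < r * M ∧ j.Coprime (r * M) ∧ j ≡ 1 [MOD r] := by
  classical
  have : NeZero r := ⟨hr.ne'⟩
  have : NeZero (r * M) := ⟨(Nat.mul_pos hr hM).ne'⟩
  have hd : r ∣ r * M := dvd_mul_right _ _
  let f := ZMod.unitsMap hd
  have hf : Function.Surjective f := ZMod.unitsMap_surjective hd
  let T : Finset (ZMod (r * M))ˣ := Finset.univ.filter fun x => f x = 1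
  have hcard : M.totient ≤ T.card := by
    have h1 : Nat.card f.ker * Nat.card (f.range) = Nat.card (ZMod (r * M))ˣ := by
      rw [← Subgroup.index_ker, Subgroup.card_mul_index]
    rw [MonoidHom.range_eq_top.2 hf, Subgroup.card_top, Nat.card_eq_fintype_card (α := (ZMod r)ˣ),
      Nat.card_eq_fintype_card (α := (ZMod (r * M))ˣ), ZMod.card_units_eq_totient,
      ZMod.card_units_eq_totient] at h1
    have h2 : Nat.card f.ker = T.card := by
      rw [Nat.card_eq_fintype_card, Fintype.card_subtype]
      congr 1
      ext x
      simp [T, MonoidHom.mem_ker]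
    have h3 := Nat.totient_super_multiplicative r M
    rw [← h1, h2, mul_comm] at h3
    exact Nat.le_of_mul_le_mul_right h3 (Nat.totient_pos.2 hr)
  refine ⟨T.image fun x : (ZMod (r * M))ˣ => (x : ZMod (r * M)).val, ?_, ?_⟩
  · rw [Finset.card_image_of_injective]
    · exact hcard
    · intro x y h
      exact Units.ext (ZMod.val_injective _ h)
  · intro j hj
    obtain ⟨x, hx, rfl⟩ := Finset.mem_image.1 hj
    refine ⟨ZMod.val_lt _, ZMod.val_coe_unit_coprime x, ?_⟩
    have hx1 : f x = 1 := (Finset.mem_filter.1 hx).2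
    rw [← ZMod.natCast_eq_natCast_iff]
    have h2 := congrArg Units.val hx1
    simp only [f, ZMod.unitsMap_val, Units.val_one] at h2
    rw [← ZMod.cast_eq_val, h2, Nat.cast_one]

/-- The character `m ↦ y ^ u m`. -/
def zpowChar {L K : Type*} [AddCommGroup L] [Field K] (y : K) (hy : y ≠ 0) (u : L →ₗ[ℤ] ℤ) :
    AddChar L K where
  toFun m := y ^ u m
  map_zero_eq_one' := by simp
  map_add_eq_mul' m n := by rw [map_add, zpow_add₀ hy]

theorem zpowChar_apply {L K : Type*} [AddCommGroup L] [Field K] (y : K) (hy : y ≠ 0)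
    (u : L →ₗ[ℤ] ℤ) (m : L) : zpowChar y hy u m = y ^ u m := rfl

theorem isTors_zpowChar {L K : Type*} [AddCommGroup L] [Field K] (y : K) (hy : y ≠ 0)
    (u : L →ₗ[ℤ] ℤ) (n : ℕ) (hn : 0 < n) (h : y ^ n = 1) : IsTors (zpowChar y hy u) :=
  ⟨n, hn, fun m => by
    rw [zpowChar_apply, ← zpow_natCast, ← zpow_mul, mul_comm, zpow_mul, zpow_natCast, h, one_zpow]⟩

theorem exists_algHom_apply_eq (x : algebraicClosure ℚ ℂ) (y : ℂ) (h : minpoly ℚ (x : ℂ) = minpoly ℚ y) :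
    ∃ φ : algebraicClosure ℚ ℂ →ₐ[ℚ] ℂ, φ x = y := by
  have : Algebra.IsAlgebraic ℚ (algebraicClosure ℚ ℂ) := algebraicClosure.isAlgebraic ℚ ℂ
  have h1 := Algebra.IsAlgebraic.range_eval_eq_rootSet_minpoly ℂ (F := ℚ) x
  have hx : minpoly ℚ x = minpoly ℚ (x : ℂ) :=
    (minpoly.algebraMap_eq (algebraMap (algebraicClosure ℚ ℂ) ℂ).injective x).symm
  have h0 : IsIntegral ℚ x := Algebra.IsIntegral.isIntegral x
  have hy : y ∈ (minpoly ℚ x).rootSet ℂ := by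
    rw [Polynomial.mem_rootSet]
    exact ⟨minpoly.ne_zero h0, by rw [hx, h, minpoly.aeval]⟩
  rw [← h1] at hy
  obtain ⟨φ, hφ⟩ := hy
  exact ⟨φ, hφ⟩

theorem order_ineq {L : Type} [AddCommGroup L] [Free ℤ L] [Module.Finite ℤ L]
    {fam : Finset (L →₀ ℤ)} {S : Finset L} (hPB : PlaneBound fam S) {κ : ℕ}
    (hκ : ∀ u : L →ₗ[ℤ] ℤ, ∀ f ∈ fam, ∀ m ∈ f.support, |u m| ≤ ((κ * sz u : ℕ) : ℤ))
    {χ : AddChar L ℂ} {l0 : L} {a c : L →ₗ[ℤ] ℤ} {M : ℕ} {ε ξ : ℂ}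
    (hN : NormalForm χ l0 a c M ε ξ) (halg : IsAlgebraic ℚ ξ) (hk : Kills fam χ)
    (hnd : ¬ Degen fam χ) (hS : ∀ s ∈ S, χ s ≠ 1) (Q : ℕ) (hQ : 1 ≤ Q)
    (hQM : Q ^ Fintype.card (Free.ChooseBasisIndex ℤ L) < M) :
    M.totient * Q ≤ (8 * κ ^ 2) * M * sz a := by
  classical
  obtain ⟨r, hr, hrQ, u, w, huw, hw⟩ := exists_simultaneous_approx c hQ hN.Mpos
  obtain ⟨T, hTcard, hT⟩ := exists_totient_le_card r M hr hN.Mpos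
  have hrM : 0 < r * M := Nat.mul_pos hr hN.Mpos
  set θ : ℂ := Complex.exp (2 * Real.pi * Complex.I / (r * M : ℕ)) with hθdef
  have hθ : IsPrimitiveRoot θ (r * M) := Complex.isPrimitiveRoot_exp _ hrM.ne'
  have hθ0 : θ ≠ 0 := hθ.ne_zero hrM.ne'
  have hθε : θ ^ r = ε := by
    rw [hN.exp, hθdef, ← Complex.exp_nat_mul]
    congr 1
    have : (r : ℂ) ≠ 0 := by exact_mod_cast hr.ne'
    push_cast
    field_simp
  set ρ := θ ^ M with hρdef
  have hρ0 : ρ ≠ 0 := pow_ne_zero _ hθ0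
  have hρr : ρ ^ r = 1 := by rw [hρdef, ← pow_mul, mul_comm, hθ.pow_eq_one]
  let ω : AddChar L ℂ := zpowChar ρ hρ0 u
  have hω : IsTors ω := isTors_zpowChar ρ hρ0 u r hr hρr
  have hθalg : IsAlgebraic ℚ θ := (hθ.isIntegral hrM).tower_top.isAlgebraic
  let E : IntermediateField ℚ ℂ := algebraicClosure ℚ ℂ
  let θE : E := ⟨θ, (mem_algebraicClosure_iff).2 hθalg⟩
  let ξE : E := ⟨ξ, (mem_algebraicClosure_iff).2 halg⟩
  have hε0 : ε ≠ 0 := hN.prim.ne_zero hN.Mpos.ne'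
  have hχ : ∀ m, χ m = ρ ^ u m * θ ^ w m * ξ ^ a m := by
    intro m
    rw [hN.eq, ← hθε, hρdef, ← zpow_natCast θ r, ← zpow_natCast θ M, ← zpow_mul, ← zpow_mul,
      ← zpow_add₀ hθ0, huw]
  have hχE : ∀ m, χ m ∈ E := fun m => by
    rw [hχ, hρdef]
    exact mul_mem (mul_mem (zpow_mem (pow_mem θE.2 _) _) (zpow_mem θE.2 _)) (zpow_mem ξE.2 _)
  have hφ : ∀ j ∈ T, ∃ φ : E →ₐ[ℚ] ℂ, φ θE = θ ^ j := by
    intro j hj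
    apply exists_algHom_apply_eq
    have h1 := (hθ.pow_of_coprime j (hT j hj).2.1)
    rw [← Polynomial.cyclotomic_eq_minpoly_rat hθ hrM, ← Polynomial.cyclotomic_eq_minpoly_rat h1 hrM]
  have : Nonempty (E →ₐ[ℚ] ℂ) := ⟨E.val⟩
  choose! φ hφ using hφ
  have hφξ : ∀ j, φ j ξE ≠ 0 := fun j =>
    (map_ne_zero (φ j)).2 fun h => hN.ne (congrArg (Subtype.val) h)
  let pt : ℕ → Fin 2 → ℂˣ := fun j => ![Units.mk0 θ hθ0 ^ j, Units.mk0 (φ j ξE) (hφξ j)]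
  have hpt : ∀ j ∈ T, mkChar ω w a (pt j 0) (pt j 1) = mapChar (φ j : E →+* ℂ) (liftChar E χ hχE) := by
    intro j hj
    ext m
    have e1 : liftChar E χ hχE m = (θE ^ M) ^ u m * θE ^ w m * ξE ^ a m := by
      apply Subtype.ext
      rw [liftChar_apply, hχ]
      rfl
    rw [mkChar_apply, mapChar_apply, e1]
    have e2 : (θ ^ j) ^ M = ρ := by
      have : ρ ^ j = ρ ^ 1 := by
        rw [pow_eq_pow_mod j hρr, pow_eq_pow_mod 1 hρr, (hT j hj).2.2]
      rw [← pow_mul, mul_comm, pow_mul, ← hρdef, this, pow_one]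
    simp only [RingHom.coe_coe, map_mul, map_zpow₀, map_pow, hφ j hj, e2, pt, ω, zpowChar_apply]
    simp
  have hinj : Set.InjOn pt T := by
    intro i hi j hj h
    have h1 : θ ^ i = θ ^ j := by
      have := congrArg (fun z : Fin 2 → ℂˣ => ((z 0 : ℂˣ) : ℂ)) h
      simpa [pt] using this
    exact hθ.pow_inj (hT i hi).1 (hT j hj).1 h1
  have hmain := hPB ω w a (κ * sz w) (κ * sz a) (T.image pt) hω ?_
    (fun f hf m hm => ⟨hκ w f hf m hm, hκ a f hf m hm⟩) ?_ ?_ ?_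
  · rw [Finset.card_image_of_injOn hinj] at hmain
    calc M.totient * Q ≤ (8 * (κ * sz w) * (κ * sz a)) * Q := by gcongr; exact hTcard.trans hmain
      _ = 8 * κ ^ 2 * (sz w * Q) * sz a := by ring
      _ ≤ _ := by gcongr
  · intro i j hij
    have hi : i = 0 := by
      by_contra hi
      have h1 := eq_smul_of_smul_eq hN.al0 hi (l := -j) (w := w) (by
        rw [neg_smul]; exact eq_neg_of_add_eq_zero_left hij)
      have h2 := huw l0
      rw [hN.cl0, mul_zero] at h2
      have h3 := hN.min r hr fun m => by
        rw [huw m, h1 m]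
        refine dvd_add (dvd_mul_right _ _) (Dvd.dvd.mul_right ?_ _)
        exact ⟨-u l0, by linarith⟩
      omega
    refine ⟨hi, ?_⟩
    have := LinearMap.congr_fun hij l0
    simpa [hi, hN.al0] using this
  · intro z hz
    obtain ⟨j, hj, rfl⟩ := Finset.mem_image.1 hz
    rw [hpt j hj, kills_mapChar, ← kills_mapChar (algebraMap E ℂ)]
    exact hk
  · intro z hz s hs
    obtain ⟨j, hj, rfl⟩ := Finset.mem_image.1 hz
    rw [hpt j hj, Ne, mapChar_eq_one, ← mapChar_eq_one (algebraMap E ℂ)]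
    exact hS s hs
  · intro z hz
    obtain ⟨j, hj, rfl⟩ := Finset.mem_image.1 hz
    rw [hpt j hj, degen_mapChar, ← degen_mapChar (algebraMap E ℂ)]
    exact hnd

end BZ

namespace BZ
open Module Height

theorem sz_le_of_eq_mul {L : Type} [AddCommGroup L] [Free ℤ L] [Module.Finite ℤ L]
    {a w : L →ₗ[ℤ] ℤ} {k : ℤ} (hk : k ≠ 0) (h : ∀ m, w m = k * a m) : sz a ≤ sz w := by
  refine Finset.sup_le fun i _ => le_trans ?_ (natAbs_le_sz w i)
  rw [h, Int.natAbs_mul]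
  exact Nat.le_mul_of_pos_left _ (Int.natAbs_pos.2 hk)

theorem card_nthRoots_complex (q : ℕ) (hq : 0 < q) (x : ℂ) (hx : x ≠ 0) :
    ((Polynomial.nthRoots q x).toFinset).card = q := by
  have h1 : IsPrimitiveRoot (Complex.exp (2 * Real.pi * Complex.I / q)) q :=
    Complex.isPrimitiveRoot_exp q hq.ne'
  rw [Multiset.toFinset_card_of_nodup (h1.nthRoots_nodup hx), h1.card_nthRoots, if_pos]
  obtain ⟨z, hz⟩ := IsAlgClosed.exists_pow_nat_eq x hq
  exact ⟨z, hz⟩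

theorem orbit_ineq {L : Type} [AddCommGroup L] [Free ℤ L] [Module.Finite ℤ L]
    {fam : Finset (L →₀ ℤ)} {S : Finset L} (hPB : PlaneBound fam S) {κ : ℕ}
    (hκ : ∀ u : L →ₗ[ℤ] ℤ, ∀ f ∈ fam, ∀ m ∈ f.support, |u m| ≤ ((κ * sz u : ℕ) : ℤ))
    {χ : AddChar L ℂ} {l0 : L} {a c : L →ₗ[ℤ] ℤ} {M : ℕ} {ε ξ : ℂ}
    (hN : NormalForm χ l0 a c M ε ξ) (E : IntermediateField ℚ ℂ) [NumberField E] (hε : ε ∈ E)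
    (hξ : ξ ∈ E) (hk : Kills fam χ)
    (hnd : ¬ Degen fam χ) (hS : ∀ s ∈ S, χ s ≠ 1) (Q : ℕ) (hQ : 1 ≤ Q)
    (hQA : Q ^ Fintype.card (Free.ChooseBasisIndex ℤ L) < sz a) :
    (orb (⟨ε, hε⟩ : E) ⟨ξ, hξ⟩).card * Q ≤ (16 * κ ^ 2) * sz a := by
  classical
  have hA : 0 < sz a := by omega
  obtain ⟨q, hq, hqQ, u, w, huw, hw⟩ := exists_simultaneous_approx a hQ hA
  have hε0 : ε ≠ 0 := hN.prim.ne_zero hN.Mpos.ne'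
  set εE : E := ⟨ε, hε⟩ with hεE
  set ξE : E := ⟨ξ, hξ⟩ with hξE
  have hχE : ∀ m, χ m ∈ E := fun m => by
    rw [hN.eq]
    exact mul_mem (zpow_mem hε _) (zpow_mem hξ _)
  let ω : AddChar L ℂ := zpowChar ε hε0 c
  have hω : IsTors ω := isTors_zpowChar ε hε0 c M hN.Mpos hN.prim.pow_eq_one
  have hszw : sz w < sz a := lt_of_le_of_lt (Nat.le_mul_of_pos_right _ hQ) hw
  have hszu : sz u ≤ 2 * q := by
    refine Finset.sup_le fun i _ => ?_
    set b := Free.chooseBasis ℤ L i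
    have h1 := huw b
    have h2 : |a b| ≤ sz a := by rw [← Int.natCast_natAbs]; exact_mod_cast natAbs_le_sz a i
    have h3 : |w b| ≤ sz a := by
      rw [← Int.natCast_natAbs]; exact_mod_cast (natAbs_le_sz w i).trans hszw.le
    have hA' : (0 : ℤ) < sz a := by exact_mod_cast hA
    have hq' : (1 : ℤ) ≤ q := by exact_mod_cast hq
    have h4 : (sz a : ℤ) * |u b| ≤ sz a * (2 * q) := by
      calc (sz a : ℤ) * |u b| = |(sz a : ℤ) * u b| := by rw [abs_mul, Nat.abs_cast]
        _ = |q * a b - w b| := by rw [h1]; ring_nf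
        _ ≤ |(q : ℤ) * a b| + |w b| := abs_sub _ _
        _ = q * |a b| + |w b| := by rw [abs_mul, Nat.abs_cast]
        _ ≤ q * sz a + sz a := by gcongr
        _ ≤ _ := by nlinarith
    have h5 := le_of_mul_le_mul_left h4 hA'
    rw [← Int.natCast_natAbs] at h5
    exact_mod_cast h5
  let pt : ℂ → Fin 2 → ℂˣ := fun θ =>
    ![(if h : θ = 0 then 1 else Units.mk0 θ h) ^ sz a, if h : θ = 0 then 1 else Units.mk0 θ h]
  let R : Finset ℂ := (orb εE ξE).biUnion fun x : E => (Polynomial.nthRoots q (x : ℂ)).toFinset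
  have hξE0 : ξE ≠ 0 := fun h => hN.ne (congrArg Subtype.val h)
  have hx0 : ∀ x ∈ orb εE ξE, (x : ℂ) ≠ 0 := by
    intro x hx
    obtain ⟨τ, -, rfl⟩ := mem_orb.1 hx
    have : τ ξE ≠ 0 := (map_ne_zero τ).2 hξE0
    exact fun h => this (Subtype.ext h)
  have hRcard : R.card = (orb εE ξE).card * q := by
    rw [Finset.card_biUnion, Finset.sum_congr rfl fun (x : E) hx => card_nthRoots_complex q hq x (hx0 x hx),
      Finset.sum_const, smul_eq_mul]
    intro x hx y hy hxy
    rw [Function.onFun, Finset.disjoint_left]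
    intro θ h1 h2
    rw [Multiset.mem_toFinset, Polynomial.mem_nthRoots hq] at h1 h2
    exact hxy (Subtype.ext (h1.symm.trans h2))
  have hR0 : ∀ θ ∈ R, θ ≠ 0 := by
    rintro θ hθ rfl
    obtain ⟨x, hx, hθ⟩ := Finset.mem_biUnion.1 hθ
    rw [Multiset.mem_toFinset, Polynomial.mem_nthRoots hq, zero_pow hq.ne'] at hθ
    exact hx0 x hx hθ.symm
  have hpt : ∀ θ ∈ R, ∃ τ : E ≃ₐ[ℚ] E,
      mkChar ω u w (pt θ 0) (pt θ 1) =
        mapChar ((algebraMap E ℂ).comp (τ : E →+* E)) (liftChar E χ hχE) := by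
    intro θ hθ
    have hθ0 := hR0 θ hθ
    obtain ⟨x, hx, hθx⟩ := Finset.mem_biUnion.1 hθ
    rw [Multiset.mem_toFinset, Polynomial.mem_nthRoots hq] at hθx
    obtain ⟨τ, hτε, rfl⟩ := mem_orb.1 hx
    refine ⟨τ, ?_⟩
    ext m
    have e1 : liftChar E χ hχE m = εE ^ c m * ξE ^ a m := by
      apply Subtype.ext
      rw [liftChar_apply, hN.eq]
      rfl
    rw [mkChar_apply, mapChar_apply, e1]
    simp only [pt, hθ0, dite_false, ω, zpowChar_apply, RingHom.comp_apply, map_mul, map_zpow₀]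
    have e2 : algebraMap E ℂ ((τ : E →+* E) εE) = ε := by
      change ((τ εE : E) : ℂ) = ε
      rw [hτε]
    have e3 : algebraMap E ℂ ((τ : E →+* E) ξE) = θ ^ q := hθx.symm
    rw [e2, e3, ← zpow_natCast θ q, ← zpow_mul, huw, zpow_add₀ hθ0]
    simp [zpow_mul, mul_assoc]
  have hinj : Set.InjOn pt R := by
    intro i hi j hj h
    have := congrArg (fun z : Fin 2 → ℂˣ => ((z 1 : ℂˣ) : ℂ)) h
    simpa [pt, hR0 i hi, hR0 j hj] using this
  have hmain := hPB ω u w (κ * sz u) (κ * sz w) (R.image pt) hω ?_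
    (fun f hf m hm => ⟨hκ u f hf m hm, hκ w f hf m hm⟩) ?_ ?_ ?_
  · rw [Finset.card_image_of_injOn hinj, hRcard] at hmain
    have h1 : (orb εE ξE).card * q ≤ (16 * κ ^ 2 * sz w) * q := by
      calc _ ≤ 8 * (κ * sz u) * (κ * sz w) := hmain
        _ ≤ 8 * (κ * (2 * q)) * (κ * sz w) := by gcongr
        _ = _ := by ring
    calc _ ≤ (16 * κ ^ 2 * sz w) * Q := Nat.mul_le_mul_right _ (Nat.le_of_mul_le_mul_right h1 hq)
      _ = 16 * κ ^ 2 * (sz w * Q) := by ring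
      _ ≤ _ := by gcongr
  · intro i j hij
    have hA' : (sz a : ℤ) ≠ 0 := by exact_mod_cast hA.ne'
    have hq' : (q : ℤ) ≠ 0 := by exact_mod_cast hq.ne'
    have h1 : (i - sz a * j) • w = (i * q) • a := by
      ext m
      have h2 : i * u m + j * w m = 0 := by simpa using LinearMap.congr_fun hij m
      simp only [LinearMap.smul_apply, smul_eq_mul]
      linear_combination (-i) * huw m - (sz a : ℤ) * h2
    by_cases h0 : i - sz a * j = 0
    · have h2 := LinearMap.congr_fun h1 l0
      simp only [h0, zero_smul, LinearMap.zero_apply, LinearMap.smul_apply, hN.al0, smul_eq_mul,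
        mul_one] at h2
      have hi : i = 0 := by
        rcases mul_eq_zero.1 h2.symm with h | h
        · exact h
        · exact absurd h hq'
      refine ⟨hi, ?_⟩
      rw [hi, zero_sub, neg_eq_zero] at h0
      exact (mul_eq_zero.1 h0).resolve_left hA'
    · exfalso
      have h2 := eq_smul_of_smul_eq hN.al0 h0 h1
      have h3 : w l0 = 0 := by
        by_contra h3
        exact absurd (sz_le_of_eq_mul h3 h2) (not_le.2 hszw)
      have h4 := huw l0
      rw [h3, hN.al0, mul_one, add_zero] at h4
      have h5 : sz a ∣ q := by
        rw [← Int.natCast_dvd_natCast]; exact ⟨_, h4⟩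
      have := Nat.le_of_dvd hq h5
      omega
  · intro z hz
    obtain ⟨θ, hθ, rfl⟩ := Finset.mem_image.1 hz
    obtain ⟨τ, hτ⟩ := hpt θ hθ
    rw [hτ, kills_mapChar, ← kills_mapChar (algebraMap E ℂ)]
    exact hk
  · intro z hz s hs
    obtain ⟨θ, hθ, rfl⟩ := Finset.mem_image.1 hz
    obtain ⟨τ, hτ⟩ := hpt θ hθ
    rw [hτ, Ne, mapChar_eq_one, ← mapChar_eq_one (algebraMap E ℂ)]
    exact hS s hs
  · intro z hz
    obtain ⟨θ, hθ, rfl⟩ := Finset.mem_image.1 hz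
    obtain ⟨τ, hτ⟩ := hpt θ hθ
    rw [hτ, degen_mapChar, ← degen_mapChar (algebraMap E ℂ)]
    exact hnd

theorem exists_normalForm_bound {L : Type} [AddCommGroup L] [Free ℤ L] [Module.Finite ℤ L]
    {fam : Finset (L →₀ ℤ)} {S : Finset L} (hPB : PlaneBound fam S) :
    ∃ A₁ : ℕ, ∀ (χ : AddChar L ℂ) (l0 : L) (a c : L →ₗ[ℤ] ℤ) (M : ℕ) (ε ξ : ℂ),
      NormalForm χ l0 a c M ε ξ → IsAlgebraic ℚ ξ → (∀ n, 0 < n → ξ ^ n ≠ 1) → Kills fam χ →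
      ¬ Degen fam χ → (∀ s ∈ S, χ s ≠ 1) → sz a ≤ A₁ ∧ M ≤ A₁ := by
  classical
  obtain ⟨κ, hκ0, hκ⟩ := exists_le_mul_sz fam
  obtain ⟨Ch, hCh0, hCh⟩ := height_lemma fam
  set n := Fintype.card (Free.ChooseBasisIndex ℤ L) with hn
  rcases Nat.eq_zero_or_pos n with h0 | hnpos
  · refine ⟨0, fun χ l0 a c M ε ξ hN => ?_⟩
    exfalso
    have : IsEmpty (Free.ChooseBasisIndex ℤ L) := Fintype.card_eq_zero_iff.1 h0
    have h1 : a = 0 := (Free.chooseBasis ℤ L).ext fun i => isEmptyElim i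
    have := hN.al0
    simp [h1] at this
  set K1 := (2 * n) ^ (2 * n) * (2 * (8 * κ ^ 2)) ^ (2 * n) + 1 with hK1
  set C := Ch + K1 + (32 * κ ^ 2) ^ n with hC
  obtain ⟨A₀, hA₀⟩ := dobrowolski C n (2 * n) (by omega) hnpos
  set A₂ := A₀ + C + 1 with hA₂
  refine ⟨A₂ + K1 * A₂ ^ (2 * n), fun χ l0 a c M ε ξ hN halg hru hk hnd hS => ?_⟩
  have hM := order_numerics n (8 * κ ^ 2) (sz a) M hnpos hN.Mpos
    (order_ineq hPB hκ hN halg hk hnd hS)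
  suffices hsz : sz a ≤ A₂ by
    refine ⟨hsz.trans (Nat.le_add_right _ _), ?_⟩
    rcases hM with hM | hM
    · refine hM.trans (le_trans ?_ (Nat.le_add_left _ _))
      gcongr
    · omega
  by_contra! hcon
  obtain ⟨E, hfin, hgal, hE⟩ := exists_galois_field {ε, ξ} (by
    intro t ht
    rcases Finset.mem_insert.1 ht with rfl | ht
    · exact (hN.prim.isIntegral hN.Mpos).tower_top.isAlgebraic
    · rw [Finset.mem_singleton.1 ht]; exact halg)
  have hε : ε ∈ E := hE ε (by simp)
  have hξ : ξ ∈ E := hE ξ (by simp)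
  have : NumberField E := { to_charZero := inferInstance, to_finiteDimensional := hfin }
  have hA1 : 1 < sz a := by omega
  have hA0 : 0 < sz a := by omega
  have hε0 : ε ≠ 0 := hN.prim.ne_zero hN.Mpos.ne'
  have hχE : ∀ m, χ m ∈ E := fun m => by
    rw [hN.eq]
    exact mul_mem (zpow_mem hε _) (zpow_mem hξ _)
  have hprim : IsPrimitiveRoot (⟨ε, hε⟩ : E) M :=
    IsPrimitiveRoot.of_map_of_injective (f := algebraMap E ℂ) hN.prim (algebraMap E ℂ).injective
  have hξ0 : (⟨ξ, hξ⟩ : E) ≠ 0 := fun h => hN.ne (congrArg Subtype.val h)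
  have := hA₀ E M ⟨ε, hε⟩ ⟨ξ, hξ⟩ (sz a) hN.Mpos hprim hξ0
    (fun m hm h => hru m hm (congrArg Subtype.val h)) hA0 ?_ ?_ ?_
  · omega
  · rcases hM with hM | hM
    · refine hM.trans ?_
      gcongr
      omega
    · rw [hM]
      exact Nat.mul_pos (by omega) (Nat.pow_pos hA0)
  · obtain ⟨Q, hQ1, hQA, hAQ⟩ := exists_max_pow_lt n (sz a) hnpos hA1
    have h1 := orbit_ineq hPB hκ hN E hε hξ hk hnd hS Q hQ1 hQA
    set D := (orb (⟨ε, hε⟩ : E) ⟨ξ, hξ⟩).card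
    have h2 : D ^ n * sz a ≤ (C * sz a ^ (n - 1)) * sz a := by
      calc D ^ n * sz a ≤ D ^ n * (2 * Q) ^ n := by gcongr
        _ = 2 ^ n * (D * Q) ^ n := by rw [mul_pow, mul_pow]; ring
        _ ≤ 2 ^ n * ((16 * κ ^ 2) * sz a) ^ n := by gcongr
        _ = (32 * κ ^ 2) ^ n * sz a ^ n := by rw [← mul_pow, ← mul_pow]; ring
        _ ≤ C * sz a ^ n := by gcongr; omega
        _ = _ := by
          rw [mul_assoc, ← pow_succ, Nat.sub_add_cancel hnpos]
    exact Nat.le_of_mul_le_mul_right h2 hA0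
  · intro σ
    have hσε : σ ⟨ε, hε⟩ ≠ 0 := (map_ne_zero σ).2 fun h => hε0 (congrArg Subtype.val h)
    have hσM : (σ ⟨ε, hε⟩) ^ M = 1 := by rw [← map_pow, hprim.pow_eq_one, map_one]
    have h1 := hCh E (mapChar (σ : E →+* E) (liftChar E χ hχE)) (zpowChar (σ ⟨ε, hε⟩) hσε c) a
      (σ ⟨ξ, hξ⟩) (isTors_zpowChar _ _ _ M hN.Mpos hσM) ((map_ne_zero σ).2 hξ0) ?_ ?_ ?_ (by omega)
    · refine h1.trans ?_
      gcongr
      omega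
    · intro m
      have e1 : liftChar E χ hχE m = (⟨ε, hε⟩ : E) ^ c m * (⟨ξ, hξ⟩ : E) ^ a m := by
        apply Subtype.ext
        rw [liftChar_apply, hN.eq]
        rfl
      rw [mapChar_apply, e1, zpowChar_apply, map_mul, map_zpow₀, map_zpow₀]
      rfl
    · rw [kills_mapChar, ← kills_mapChar (algebraMap E ℂ)]
      exact hk
    · rw [degen_mapChar, ← degen_mapChar (algebraMap E ℂ)]
      exact hnd

end BZ

namespace BZ
open Module Polynomial

theorem eq_zero_of_transcendental_sum {ξ : ℂ} (hξ : Transcendental ℚ ξ) (J : Finset ℤ) (P : ℤ → ℂ)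
    (hP : ∀ e ∈ J, IsAlgebraic ℚ (P e)) (h : ∑ e ∈ J, P e * ξ ^ e = 0) : ∀ e ∈ J, P e = 0 := by
  classical
  let K : IntermediateField ℚ ℂ := algebraicClosure ℚ ℂ
  have : Algebra.IsAlgebraic ℚ K := algebraicClosure.isAlgebraic ℚ ℂ
  have hξK : Transcendental K ξ := hξ.extendScalars K
  have hξ0 : ξ ≠ 0 := by
    rintro rfl; exact hξ isAlgebraic_zero
  let p : ℤ → K := fun e => if he : e ∈ J then ⟨P e, mem_algebraicClosure_iff.2 (hP e he)⟩ else 0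
  have hp : ∀ e ∈ J, (p e : ℂ) = P e := fun e he => by simp [p, he]
  obtain ⟨B, hB⟩ : ∃ B : ℕ, ∀ e ∈ J, 0 ≤ e + B := by
    refine ⟨J.sup Int.natAbs, fun e he => ?_⟩
    have := Finset.le_sup (f := Int.natAbs) he
    omega
  let q : K[X] := ∑ e ∈ J, C (p e) * X ^ (e + B).toNat
  have hq : aeval ξ q = 0 := by
    have : aeval ξ q = (∑ e ∈ J, P e * ξ ^ e) * ξ ^ B := by
      simp only [q, map_sum, map_mul, aeval_C, map_pow, aeval_X, Finset.sum_mul]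
      refine Finset.sum_congr rfl fun e he => ?_
      have h1 : ξ ^ (e + B).toNat = ξ ^ e * ξ ^ B := by
        rw [← zpow_natCast, Int.toNat_of_nonneg (hB e he), zpow_add₀ hξ0, zpow_natCast]
      rw [h1, ← mul_assoc]
      congr 2
      exact hp e he
    rw [this, h, zero_mul]
  have hq0 : q = 0 := by
    by_contra hne
    exact hξK ⟨q, hne, hq⟩
  intro e he
  have h1 : q.coeff (e + B).toNat = p e := by
    simp only [q, finsetSum_coeff, coeff_C_mul, coeff_X_pow]
    rw [Finset.sum_eq_single e]
    · simp
    · intro e' he' hne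
      rw [if_neg, mul_zero]
      have := hB e he
      have := hB e' he'
      omega
    · exact fun h => absurd he h
  rw [← hp e he, ← h1, hq0, coeff_zero]
  rfl

theorem tStat (n : ℕ) : ∀ (L : Type) [AddCommGroup L] [Free ℤ L] [Module.Finite ℤ L],
    finrank ℤ L = n → TStat L := by
  classical
  induction n using Nat.strong_induction_on with
  | _ n ih =>
  intro L _ _ _ hLn fam hfam
  have hrank : ∀ c : AddChar L ℂ, Kills fam c → 2 ≤ finrank ℤ L := fun c hc => by
    have := hfam ℂ c hc Empty (fun e => e.elim)
      (algebraicIndependent_empty_type_iff.2 (algebraMap ℚ ℂ).injective)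
    simpa using this
  obtain ⟨SD, hSD0, hSD⟩ := degen_lemma (L := L) (fam := fam)
    (fun L' _ _ _ h => ih _ (hLn ▸ h) L' rfl) hfam
  obtain ⟨ST, hST0, hST⟩ : ∃ S : Finset L, 0 ∉ S ∧ ((∃ f ∈ fam, f ≠ 0) → ∀ χ : AddChar L ℂ,
      IsTors χ → Kills fam χ → ∃ s ∈ S, χ s = 1) := by
    by_cases h : ∃ f ∈ fam, f ≠ 0
    · obtain ⟨f, hf, hf0⟩ := h
      obtain ⟨S, hS0, hS⟩ := torsion_lemma hf0
      exact ⟨S, hS0, fun _ χ hχ hk => hS χ hχ (hk f hf)⟩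
    · exact ⟨∅, by simp, fun h' => absurd h' h⟩
  obtain ⟨SP, hSP0, hSP⟩ := plane_count hfam
  obtain ⟨A₁, hA₁⟩ := exists_normalForm_bound (S := SP) hSP
  let b := Free.chooseBasis ℤ L
  have hker : 2 ≤ finrank ℤ L → ∀ a : L →ₗ[ℤ] ℤ, ∃ m : L, m ≠ 0 ∧ a m = 0 := by
    intro h2 a
    by_contra! hcon
    have hinj : Function.Injective a := by
      rw [injective_iff_map_eq_zero]
      intro m hm
      by_contra hne
      exact hcon m hne hm
    have := LinearMap.finrank_le_finrank_of_injective hinj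
    rw [finrank_self] at this
    omega
  let g : (L →ₗ[ℤ] ℤ) → L := fun a => if h : ∃ m : L, m ≠ 0 ∧ a m = 0 then h.choose else 0
  let T : Finset (L →ₗ[ℤ] ℤ) :=
    (Fintype.piFinset fun _ : Free.ChooseBasisIndex ℤ L => Finset.Icc (-(A₁ : ℤ)) A₁).image
      fun f => b.constr ℤ f
  have hT : ∀ a : L →ₗ[ℤ] ℤ, sz a ≤ A₁ → a ∈ T := by
    intro a ha
    refine Finset.mem_image.2 ⟨fun i => a (b i), ?_, ?_⟩
    · rw [Fintype.mem_piFinset]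
      intro i
      have := (natAbs_le_sz a i).trans ha
      change (a (b i)).natAbs ≤ A₁ at this
      rw [Finset.mem_Icc]
      omega
    · exact b.ext fun i => Basis.constr_basis _ _ _ _
  let SF : Finset L := ((T ×ˢ Finset.range (A₁ + 1)).image fun x => x.2 • g x.1) \ {0}
  refine ⟨SD ∪ ST ∪ SP ∪ SF, ?_, ?_⟩
  · simp [hSD0, hST0, hSP0, SF]
  intro χ hχ hk
  have h2 := hrank χ hk
  by_contra! hcon
  have hcD : ∀ s ∈ SD, χ s ≠ 1 := fun s hs => hcon s (by simp [hs])
  have hcT : ∀ s ∈ ST, χ s ≠ 1 := fun s hs => hcon s (by simp [hs])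
  have hcP : ∀ s ∈ SP, χ s ≠ 1 := fun s hs => hcon s (by simp [hs])
  have hcF : ∀ s ∈ SF, χ s ≠ 1 := fun s hs => hcon s (by simp [hs])
  have hnd : ¬ Degen fam χ := fun h => by
    obtain ⟨s, hs, h1⟩ := hSD χ hχ h
    exact hcD s hs h1
  have hne : ∃ f ∈ fam, f ≠ 0 := by
    by_contra! h0
    have hpos : 0 < finrank ℤ L := by omega
    rw [finrank_eq_card_basis b] at hpos
    obtain ⟨i⟩ := Fintype.card_pos_iff.1 hpos
    refine hnd ⟨b.coord i, fun h => ?_, fun f hf e => ?_⟩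
    · have := LinearMap.congr_fun h (b i)
      simp at this
    · rw [h0 f hf, part, Finsupp.filter_zero, ev, Finsupp.sum_zero_index]
  have hnt : ¬ IsTors χ := fun h => by
    obtain ⟨s, hs, h1⟩ := hST hne χ h hk
    exact hcT s hs h1
  obtain ⟨ζ, a, ξ, hζ, hξ, hχe⟩ := hχ
  have ha : a ≠ 0 := by
    rintro rfl
    refine hnt ?_
    have : χ = ζ := by ext m; simp [hχe]
    rwa [this]
  obtain ⟨l0, a', c, M, ε, ξ', hN, htors⟩ := Rank1.exists_normalForm hζ hξ ha hχe
  have hru : ∀ n, 0 < n → ξ' ^ n ≠ 1 := fun n hn h => hnt (htors ⟨n, hn, h⟩)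
  have hε0 : ε ≠ 0 := hN.prim.ne_zero hN.Mpos.ne'
  have halg : IsAlgebraic ℚ ξ' := by
    by_contra htr
    refine hnd ⟨a', fun h => by simpa [h] using hN.al0, fun f hf => ?_⟩
    have hpart : ∀ e, ev χ (part a' e f) =
        (∑ m ∈ (part a' e f).support, (part a' e f m : ℂ) * ε ^ c m) * ξ' ^ e := by
      intro e
      rw [ev_eq_sum, Finset.sum_mul]
      refine Finset.sum_congr rfl fun m hm => ?_
      have hm' : a' m = e := by
        by_contra hne
        rw [Finsupp.mem_support_iff, part_apply, if_neg hne] at hm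
        exact hm rfl
      rw [hN.eq, hm', mul_assoc]
    have hεalg : IsAlgebraic ℚ ε := (hN.prim.isIntegral hN.Mpos).tower_top.isAlgebraic
    let J : Finset ℤ := f.support.image a'
    have hsum := ev_eq_sum_parts a' f χ J fun m hm => Finset.mem_image_of_mem _ hm
    rw [hk f hf, Finset.sum_congr rfl fun e _ => hpart e] at hsum
    have hz := eq_zero_of_transcendental_sum htr J _ (fun e _ => ?_) hsum.symm
    · intro e
      by_cases he : e ∈ J
      · rw [hpart, hz e he, zero_mul]
      · have : part a' e f = 0 := by
          ext m
          rw [part_apply]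
          split_ifs with hme
          · by_contra hne
            exact he (Finset.mem_image.2 ⟨m, Finsupp.mem_support_iff.2 hne, hme⟩)
          · rfl
        rw [this]; simp [ev]
    · refine mem_algebraicClosure_iff.1 (sum_mem fun m _ => mul_mem ?_ (zpow_mem ?_ _))
      · exact intCast_mem _ _
      · exact mem_algebraicClosure_iff.2 hεalg
  obtain ⟨hA, hM⟩ := hA₁ χ l0 a' c M ε ξ' hN halg hru hk hnd hcP
  have hg := hker h2 a'
  have hg1 : g a' ≠ 0 ∧ a' (g a') = 0 := by
    simp only [g, hg, dite_true]
    exact hg.choose_spec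
  refine hcF (M • g a') ?_ ?_
  · refine Finset.mem_sdiff.2 ⟨Finset.mem_image.2 ⟨(a', M), ?_, rfl⟩, ?_⟩
    · exact Finset.mk_mem_product (hT a' hA) (Finset.mem_range.2 (by omega))
    · rw [Finset.mem_singleton]
      rw [← natCast_zsmul]
      exact smul_ne_zero (by exact_mod_cast hN.Mpos.ne') hg1.1
  · rw [hN.eq, map_nsmul, map_nsmul, hg1.2, smul_zero, zpow_zero, mul_one, nsmul_eq_mul, zpow_mul,
      zpow_natCast, hN.prim.pow_eq_one, one_zpow]

end BZ

namespace BZ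
open Module Polynomial

/-- Elimination: coprime polynomials over a factorial domain have a nonzero constant in their
ideal. -/
theorem exists_C_eq_of_isRelPrime {A : Type*} [CommRing A] [IsDomain A]
    [UniqueFactorizationMonoid A] {P Q : A[X]} (h : IsRelPrime P Q) :
    ∃ a : A, a ≠ 0 ∧ ∃ u v : A[X], u * P + v * Q = C a := by
  classical
  let _ : NormalizedGCDMonoid A := Nonempty.some inferInstance
  let K := FractionRing A
  have hinj : Function.Injective (algebraMap A K) := IsFractionRing.injective A K
  have hcop : IsCoprime (P.map (algebraMap A K)) (Q.map (algebraMap A K)) := by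
    apply IsRelPrime.isCoprime
    intro g hgP hgQ
    by_cases hg : g = 0
    · subst hg
      have hP : P = 0 := by
        rw [zero_dvd_iff] at hgP
        exact (Polynomial.map_eq_zero_iff hinj).1 hgP
      have hQ : Q = 0 := by
        rw [zero_dvd_iff] at hgQ
        exact (Polynomial.map_eq_zero_iff hinj).1 hgQ
      have := h (d := X) (hP ▸ dvd_zero _) (hQ ▸ dvd_zero _)
      exact absurd this Polynomial.not_isUnit_X
    obtain ⟨c, c0, hc⟩ := IsLocalization.integerNormalization_spec (nonZeroDivisors A) g
    set G := IsLocalization.integerNormalization (nonZeroDivisors A) g with hG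
    have hG0 : G ≠ 0 := fun h0 => hg (IsFractionRing.integerNormalization_eq_zero_iff.1 h0)
    have hc' : G.map (algebraMap A K) = C (algebraMap A K c) * g := by
      rw [hc, Algebra.smul_def, Polynomial.algebraMap_apply]
    have hcU : IsUnit (C (algebraMap A K c) : K[X]) := by
      rw [Polynomial.isUnit_C, isUnit_iff_ne_zero]
      exact fun h0 => nonZeroDivisors.ne_zero c0 (hinj (by rw [h0, map_zero]))
    have hp : G.primPart.map (algebraMap A K) ∣ g := by
      rw [← hcU.dvd_mul_left, ← hc']
      exact Polynomial.map_dvd _ (primPart_dvd G)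
    have hu := h (G.isPrimitive_primPart.dvd_of_fraction_map_dvd_fraction_map (hp.trans hgP))
      (G.isPrimitive_primPart.dvd_of_fraction_map_dvd_fraction_map (hp.trans hgQ))
    exact isUnit_or_eq_zero_of_isUnit_integerNormalization_primPart hg hu
  obtain ⟨u, v, huv⟩ := hcop
  obtain ⟨c, c0, hc⟩ := IsLocalization.integerNormalization_spec (nonZeroDivisors A) u
  obtain ⟨d, d0, hd⟩ := IsLocalization.integerNormalization_spec (nonZeroDivisors A) v
  set U := IsLocalization.integerNormalization (nonZeroDivisors A) u
  set V := IsLocalization.integerNormalization (nonZeroDivisors A) v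
  refine ⟨c * d, mul_ne_zero (nonZeroDivisors.ne_zero c0) (nonZeroDivisors.ne_zero d0),
    C d * U, C c * V, ?_⟩
  apply Polynomial.map_injective _ hinj
  simp only [Polynomial.map_add, Polynomial.map_mul, Polynomial.map_C, hc, hd, Algebra.smul_def,
    Polynomial.algebraMap_apply, map_mul]
  linear_combination (C (algebraMap A K c) * C (algebraMap A K d)) * huv

/-- Eliminating the variable `j`. -/
theorem exists_eliminant {σ k : Type*} [Finite σ] [Field k] {P Q : MvPolynomial σ k}
    (h : IsRelPrime P Q) (j : σ) : ∃ R : MvPolynomial {i // i ≠ j} k, R ≠ 0 ∧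
      ∃ u v : MvPolynomial σ k, u * P + v * Q = MvPolynomial.rename Subtype.val R := by
  classical
  let e : MvPolynomial σ k ≃ₐ[k] Polynomial (MvPolynomial {i // i ≠ j} k) :=
    (MvPolynomial.renameEquiv k (Equiv.optionSubtypeNe j).symm).trans
      (MvPolynomial.optionEquivLeft k {i // i ≠ j})
  have hrel : IsRelPrime (e P) (e Q) := by
    intro d hP hQ
    have := h (d := e.symm d) (by simpa using map_dvd e.symm hP) (by simpa using map_dvd e.symm hQ)
    simpa using this.map e
  obtain ⟨R, hR, u, v, huv⟩ := exists_C_eq_of_isRelPrime hrel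
  refine ⟨R, hR, e.symm u, e.symm v, ?_⟩
  apply e.injective
  simp only [map_add, map_mul, AlgEquiv.apply_symm_apply, huv]
  have hc : e.toAlgHom.comp (MvPolynomial.rename Subtype.val) =
      (IsScalarTower.toAlgHom k (MvPolynomial {i // i ≠ j} k) _) := by
    ext i : 1
    simp [e, MvPolynomial.optionEquivLeft_X_some, Equiv.optionSubtypeNe_symm_of_ne i.2]
  exact (DFunLike.congr_fun hc R).symm

theorem exists_integral_eliminant {σ : Type*} [Finite σ] {P Q : MvPolynomial σ ℂ}
    (hP : ∀ m, IsAlgebraic ℚ (P.coeff m)) (hQ : ∀ m, IsAlgebraic ℚ (Q.coeff m))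
    (h : IsRelPrime P Q) (j : σ) : ∃ F : MvPolynomial {i // i ≠ j} ℤ, F ≠ 0 ∧
      ∀ x : σ → ℂ, MvPolynomial.eval x P = 0 → MvPolynomial.eval x Q = 0 →
        MvPolynomial.aeval (fun i : {i // i ≠ j} => x i) F = 0 := by
  classical
  let K : IntermediateField ℚ ℂ := algebraicClosure ℚ ℂ
  have : Algebra.IsAlgebraic ℚ K := algebraicClosure.isAlgebraic ℚ ℂ
  have : Algebra.IsAlgebraic ℤ K :=
    (IsFractionRing.comap_isAlgebraic_iff (A := ℤ) (K := ℚ) (C := K)).2 this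
  have hlift : ∀ P : MvPolynomial σ ℂ, (∀ m, IsAlgebraic ℚ (P.coeff m)) →
      ∃ P' : MvPolynomial σ K, MvPolynomial.map (algebraMap K ℂ) P' = P := by
    intro P hP
    apply MvPolynomial.mem_range_map_iff_coeffs_subset.2
    intro c hc
    obtain ⟨m, -, rfl⟩ := MvPolynomial.mem_coeffs_iff.1 hc
    exact ⟨⟨_, mem_algebraicClosure_iff.2 (hP m)⟩, rfl⟩
  obtain ⟨P', rfl⟩ := hlift P hP
  obtain ⟨Q', rfl⟩ := hlift Q hQ
  have h' : IsRelPrime P' Q' := by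
    intro d h1 h2
    have := h (map_dvd (MvPolynomial.map (algebraMap K ℂ)) h1)
      (map_dvd (MvPolynomial.map (algebraMap K ℂ)) h2)
    rw [MvPolynomial.isUnit_iff_totalDegree_of_isReduced] at this ⊢
    rwa [MvPolynomial.totalDegree, MvPolynomial.support_map_of_injective _
      (algebraMap K ℂ).injective, MvPolynomial.coeff_map, isUnit_map_iff] at this
  obtain ⟨R, hR, u, v, huv⟩ := exists_eliminant h' j
  obtain ⟨F, hF, w, hw⟩ := MvPolynomial.exists_dvd_map_of_isAlgebraic (R := ℤ) hR
  refine ⟨F, hF, fun x h1 h2 => ?_⟩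
  have e1 := congrArg (MvPolynomial.aeval (fun i : {i // i ≠ j} => x i)) hw
  have e2 := congrArg (MvPolynomial.aeval x) huv
  rw [MvPolynomial.eval_map] at h1 h2
  rw [MvPolynomial.aeval_map_algebraMap] at e1
  rw [e1, map_mul]
  rw [MvPolynomial.aeval_rename, map_add, map_mul, map_mul, MvPolynomial.aeval_def,
    MvPolynomial.aeval_def, h1] at e2
  rw [MvPolynomial.aeval_def x Q', h2, mul_zero, mul_zero, add_zero] at e2
  have e3 : MvPolynomial.aeval (fun i : {i // i ≠ j} => x i) R = 0 := e2.symm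
  rw [e3, zero_mul]

theorem char_finset_sum {L K ι : Type*} [AddCommGroup L] [Field K] (χ : AddChar L K) (s : Finset ι)
    (h : ι → L) : χ (∑ i ∈ s, h i) = ∏ i ∈ s, χ (h i) := by
  classical
  induction s using Finset.induction_on with
  | empty => simp
  | insert i s hi ih => rw [Finset.sum_insert hi, Finset.prod_insert hi, AddChar.map_add_eq_mul, ih]

/-- The Laurent polynomial on `ℤ^N` attached to a polynomial in some of the variables. -/
noncomputable def laurent {N : ℕ} {τ : Type*} (g : τ → Fin N) (F : MvPolynomial τ ℤ) :
    (Fin N → ℤ) →₀ ℤ :=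
  ∑ m ∈ F.support, Finsupp.single (m.sum fun i k => k • Pi.single (g i) (1 : ℤ)) (F.coeff m)

theorem ev_laurent {N : ℕ} {τ K : Type*} [Field K] (g : τ → Fin N) (F : MvPolynomial τ ℤ)
    (χ : AddChar (Fin N → ℤ) K) :
    ev χ (laurent g F) = MvPolynomial.aeval (fun i => χ (Pi.single (g i) 1)) F := by
  classical
  have hadd : ∀ f f' : (Fin N → ℤ) →₀ ℤ, ev χ (f + f') = ev χ f + ev χ f' := fun f f' =>
    Finsupp.sum_add_index' (by simp) (fun m a b => by push_cast; ring)
  let φ : ((Fin N → ℤ) →₀ ℤ) →+ K :=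
    { toFun := ev χ, map_zero' := Finsupp.sum_zero_index, map_add' := hadd }
  have : ev χ (laurent g F) = ∑ m ∈ F.support, ev χ (Finsupp.single
      (m.sum fun i k => k • Pi.single (g i) (1 : ℤ)) (F.coeff m)) :=
    map_sum φ _ _
  rw [this, MvPolynomial.aeval_def, MvPolynomial.eval₂_eq]
  refine Finset.sum_congr rfl fun m _ => ?_
  rw [ev, Finsupp.sum_single_index (by simp), Finsupp.sum]
  congr 1
  rw [char_finset_sum]
  exact Finset.prod_congr rfl fun i _ => AddChar.map_nsmul_eq_pow _ _ _

theorem char_eq_prod {N : ℕ} {K : Type*} [Field K] (χ : AddChar (Fin N → ℤ) K) (m : Fin N → ℤ) :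
    χ m = ∏ i, χ (Pi.single i 1) ^ m i := by
  conv_lhs => rw [← Finset.univ_sum_single m, char_finset_sum]
  refine Finset.prod_congr rfl fun i _ => ?_
  rw [← AddChar.map_zsmul_eq_zpow, ← Pi.single_smul, smul_eq_mul, mul_one]

theorem mem_adjoin_of_char {N : ℕ} {F : Type*} [Field F] [CharZero F]
    (c : AddChar (Fin N → ℤ) F) (m : Fin N → ℤ) :
    c m ∈ IntermediateField.adjoin ℚ (Set.range fun i => c (Pi.single i 1)) := by
  classical
  rw [char_eq_prod]
  exact prod_mem fun i _ => zpow_mem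
    (IntermediateField.subset_adjoin ℚ (Set.range fun i => c (Pi.single i 1)) ⟨i, rfl⟩) _

theorem codim2_of_eliminants {N : ℕ} (hN : 1 ≤ N) (F : ∀ j : Fin N, MvPolynomial {i // i ≠ j} ℤ)
    (hF : ∀ j, F j ≠ 0) :
    Codim2 (Finset.univ.image fun j : Fin N => laurent Subtype.val (F j)) := by
  classical
  intro E _ _ c hc ι _ l hl
  let x : Fin N → E := fun i => c (Pi.single i 1)
  let K := IntermediateField.adjoin ℚ (Set.range x)
  have hx : ∀ i, x i ∈ K := fun i => IntermediateField.subset_adjoin _ _ ⟨i, rfl⟩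
  let x' : Fin N → K := fun i => ⟨x i, hx i⟩
  let y' : ι → K := fun i => ⟨c (l i), mem_adjoin_of_char c (l i)⟩
  have hy' : AlgebraicIndependent ℚ y' := .of_comp K.val hl
  have : Algebra.IsAlgebraic (Algebra.adjoin ℚ (Set.range x')) K := by
    have hmem : ∀ r ∈ Algebra.adjoin ℚ (Set.range x), ∃ r' : Algebra.adjoin ℚ (Set.range x'),
        ((r' : K) : E) = r := by
      intro r hr
      have h1 : Set.range x = K.val '' Set.range x' := by
        rw [← Set.range_comp]; rfl
      rw [h1, ← AlgHom.map_adjoin] at hr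
      obtain ⟨r', hr', rfl⟩ := hr
      exact ⟨⟨r', hr'⟩, rfl⟩
    refine ⟨fun z => ?_⟩
    obtain ⟨r, hr, s, hs, hz⟩ := IntermediateField.mem_adjoin_iff_div.1 z.2
    obtain ⟨r', rfl⟩ := hmem r hr
    obtain ⟨s', rfl⟩ := hmem s hs
    have : z = algebraMap _ K r' * (algebraMap _ K s')⁻¹ := by
      apply Subtype.ext
      rw [hz, div_eq_mul_inv]
      rfl
    rw [this]
    exact (isAlgebraic_algebraMap r').mul (isAlgebraic_algebraMap s').inv
  obtain ⟨t, ht, htb⟩ := exists_isTranscendenceBasis_subset (R := ℚ) (Set.range x')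
  choose g hg using fun a : t => ht a.2
  have hginj : Function.Injective g := fun a b h => Subtype.ext (by rw [← hg, ← hg, h])
  have : Finite t := Finite.of_injective g hginj
  have : Fintype t := Fintype.ofFinite t
  have hcard : Fintype.card ι ≤ Fintype.card t := by
    have h1 := hy'.cardinalMk_le_trdeg
    rw [← htb.cardinalMk_eq_trdeg] at h1
    simpa using h1
  rw [finrank_fin_fun]
  by_contra! hlt
  have hI : (Finset.univ.image g)ᶜ.card ≤ 1 := by
    rw [Finset.card_compl, Finset.card_image_of_injective _ hginj, Fintype.card_fin,
      Finset.card_univ]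
    omega
  obtain ⟨j, hj⟩ : ∃ j, (Finset.univ.image g)ᶜ ⊆ {j} := by
    have : Nonempty (Fin N) := ⟨⟨0, Nat.lt_of_lt_of_le Nat.zero_lt_one hN⟩⟩
    rwa [Finset.card_le_one_iff_subset_singleton] at hI
  have hsec : ∀ i : {i // i ≠ j}, ∃ a : t, g a = i := by
    intro i
    by_contra! hne
    have : i.1 ∈ (Finset.univ.image g)ᶜ := by simpa using hne
    exact i.2 (Finset.mem_singleton.1 (hj this))
  choose r hr using hsec
  have hrinj : Function.Injective r := fun a b h => Subtype.ext (by rw [← hr, ← hr, h])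
  have hind : AlgebraicIndependent ℚ (fun i : {i // i ≠ j} => x i) := by
    have h1 := (htb.1.comp r hrinj).map' (f := K.val) K.val.injective
    convert h1 using 1
    ext i
    simp only [Function.comp_apply]
    rw [← hg, hr]
    rfl
  have hker := hc _ (Finset.mem_image_of_mem _ (Finset.mem_univ j))
  rw [ev_laurent] at hker
  have hindZ : AlgebraicIndependent ℤ (fun i : {i // i ≠ j} => x i) := hind.restrictScalars
    (algebraMap ℤ ℚ).injective_int
  exact hF j (hindZ.eq_zero_of_aeval_eq_zero _ hker)

end BZ

/-- **Theorem (Bombieri–Zannier / Bombieri–Masser–Zannier).**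
Let `N ≥ 1` and let `P, Q ∈ ℚ̄[x_1, …, x_N]` be coprime polynomials (here `ℚ̄ ⊆ ℂ` is the field
of algebraic numbers, and coprime means: without common non-unit factor).  Then there is a
constant `B = B(P, Q)` such that: whenever `a_1, …, a_N ∈ ℤ`, `ζ_1, …, ζ_N` are roots of unity
and `ξ ∈ ℂ^×` satisfy `P(ζ_1 ξ^{a_1}, …, ζ_N ξ^{a_N}) = Q(ζ_1 ξ^{a_1}, …, ζ_N ξ^{a_N}) = 0`,
there are `b_1, …, b_N ∈ ℤ` with `0 < max_j |b_j| ≤ B` and `∏_j (ζ_j ξ^{a_j})^{b_j} = 1`;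
in particular, if `ξ` is not a root of unity then `∑_j a_j b_j = 0`. -/
theorem bombieri_zannier_torsion_curves
    (N : ℕ) (hN : 1 ≤ N) (P Q : MvPolynomial (Fin N) ℂ)
    (hPalg : ∀ m, IsAlgebraic ℚ (P.coeff m)) (hQalg : ∀ m, IsAlgebraic ℚ (Q.coeff m))
    (hcop : ∀ R : MvPolynomial (Fin N) ℂ, R ∣ P → R ∣ Q → IsUnit R) :
    ∃ B : ℕ, ∀ (a : Fin N → ℤ) (ζ : Fin N → ℂˣ), (∀ j, IsOfFinOrder (ζ j)) →
      ∀ ξ : ℂˣ,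
        MvPolynomial.eval (fun j => ((ζ j * ξ ^ a j : ℂˣ) : ℂ)) P = 0 →
        MvPolynomial.eval (fun j => ((ζ j * ξ ^ a j : ℂˣ) : ℂ)) Q = 0 →
        ∃ b : Fin N → ℤ, 0 < vecSize b ∧ vecSize b ≤ B ∧
          (∏ j, (ζ j * ξ ^ a j) ^ b j) = 1 ∧
          (¬ IsOfFinOrder ξ → ∑ j, a j * b j = 0) := by
  classical
  choose F hF hFx using BZ.exists_integral_eliminant hPalg hQalg fun R => hcop R
  obtain ⟨S, hS0, hS⟩ := BZ.tStat _ (Fin N → ℤ) rfl _ (BZ.codim2_of_eliminants hN F hF)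
  refine ⟨S.sup vecSize, fun a ζ hζ ξ hP hQ => ?_⟩
  let toChar : (Fin N → ℂˣ) → AddChar (Fin N → ℤ) ℂ := fun z =>
    { toFun := fun m => ((∏ j, z j ^ m j : ℂˣ) : ℂ)
      map_zero_eq_one' := by simp
      map_add_eq_mul' := fun m n => by
        simp only [Pi.add_apply, zpow_add, Finset.prod_mul_distrib, Units.val_mul] }
  have htoChar : ∀ z m, toChar z m = ((∏ j, z j ^ m j : ℂˣ) : ℂ) := fun _ _ => rfl
  have hsingle : ∀ z i, toChar z (Pi.single i 1) = z i := fun z i => by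
    rw [htoChar, Finset.prod_eq_single i] <;> simp +contextual [Pi.single_apply]
  have hzsum : ∀ c : Fin N → ℤ, ∏ j, ξ ^ c j = ξ ^ ∑ j, c j := fun c => by
    induction (Finset.univ : Finset (Fin N)) using Finset.induction_on with
    | empty => simp
    | insert i s hi ih => rw [Finset.prod_insert hi, Finset.sum_insert hi, zpow_add, ih]
  have hsplit : ∀ m : Fin N → ℤ, (∏ j, (ζ j * ξ ^ a j) ^ m j) =
      (∏ j, ζ j ^ m j) * ξ ^ (∑ j, a j * m j) := fun m => by
    simp only [mul_zpow, Finset.prod_mul_distrib, ← zpow_mul, hzsum]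
  have htors : ∃ M : ℕ, 0 < M ∧ ∀ m : Fin N → ℤ, (∏ j, ζ j ^ m j) ^ M = 1 := by
    refine ⟨∏ j, orderOf (ζ j), Finset.prod_pos fun j _ => (hζ j).orderOf_pos, fun m => ?_⟩
    rw [← Finset.prod_pow]
    refine Finset.prod_eq_one fun j _ => ?_
    obtain ⟨k, hk⟩ := Finset.dvd_prod_of_mem (fun j => orderOf (ζ j)) (Finset.mem_univ j)
    rw [hk, ← zpow_natCast, ← zpow_mul, mul_comm, zpow_mul, zpow_natCast, pow_mul,
      pow_orderOf_eq_one, one_pow, one_zpow]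
  let α : (Fin N → ℤ) →ₗ[ℤ] ℤ := ∑ j, a j • LinearMap.proj j
  have hα : ∀ m, α m = ∑ j, a j * m j := fun m => by simp [α]
  obtain ⟨M, hM, hMζ⟩ := htors
  have hrank : BZ.Rank1 (toChar fun j => ζ j * ξ ^ a j) := by
    refine ⟨toChar ζ, α, ξ, ⟨M, hM, fun m => ?_⟩, ξ.ne_zero, fun m => ?_⟩
    · rw [htoChar, ← Units.val_pow_eq_pow_val, hMζ, Units.val_one]
    · rw [htoChar, hsplit, hα, Units.val_mul, Units.val_zpow_eq_zpow_val, htoChar]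
  have hkills : BZ.Kills (Finset.univ.image fun j => BZ.laurent Subtype.val (F j))
      (toChar fun j => ζ j * ξ ^ a j) := by
    intro f hf
    obtain ⟨j, -, rfl⟩ := Finset.mem_image.1 hf
    rw [BZ.ev_laurent]
    simp only [hsingle]
    have h := hFx j (fun j => ((ζ j * ξ ^ a j : ℂˣ) : ℂ)) hP hQ
    rw [MvPolynomial.aeval_eq_eval₂Hom, Subsingleton.elim (algebraMap ℤ ℂ) (Int.castRingHom ℂ)] at h ⊢
    exact h
  obtain ⟨b, hb, hb1⟩ := hS _ hrank hkills
  have hprod : (∏ j, (ζ j * ξ ^ a j) ^ b j) = 1 := by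
    rw [htoChar] at hb1
    exact Units.ext hb1
  refine ⟨b, ?_, Finset.le_sup (f := vecSize) hb, hprod, fun hξ => ?_⟩
  · rw [Nat.pos_iff_ne_zero]
    intro h0
    have : b = 0 := by
      ext i
      have h1 := Finset.le_sup (f := fun i => (b i).natAbs) (Finset.mem_univ i)
      change _ ≤ vecSize b at h1
      rw [h0] at h1
      simpa using h1
    exact hS0 (this ▸ hb)
  · by_contra hne
    apply hξ
    rw [hsplit] at hprod
    have h1 : (ξ ^ (∑ j, a j * b j)) ^ M = 1 := by
      have := congrArg (· ^ M) hprod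
      simpa [mul_pow, hMζ] using this
    rw [← zpow_natCast, ← zpow_mul] at h1
    exact isOfFinOrder_iff_zpow_eq_one.2 ⟨_, mul_ne_zero hne (by exact_mod_cast hM.ne'), h1⟩
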